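/- Let k be a field, let n be a positive integer not divisible by the characteristic of k, let D be a central division algebra of degree n over k, and let m ≥ 1. Let K = k(x₁,…,x_m) be the field of rational functions in m variables over k (the fraction field of the polynomial ring in m variables). If Δ is a central division algebra of degree n over K that has the same maximal subfields as D ⊗_k K, then there exists a central division algebra D' of degree n over k that has the same maximal subfields as D and such that Δ is isomorphic to D' ⊗_k K as a K-algebra. -/

import Mathlib

open scoped TensorProduct

/-- `D` is a central division algebra of degree `n` over `k`: a division ring which is a
`k`-algebra whose center is exactly `k` and whose dimension over `k` is `n ^ 2`. -/
def IsCentralDivisionAlgebraOfDegree (k : Type) [Field k] (n : ℕ) (D : Type)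
    [DivisionRing D] [Algebra k D] : Prop :=
  Subalgebra.center k D = ⊥ ∧ Module.finrank k D = n ^ 2

/-- Two `k`-algebras have the same maximal subfields (relative to the degree `n`):
a field extension `P/k` of degree `n` embeds into one if and only if it embeds
into the other. -/
def HaveSameMaximalSubfields (k : Type) [Field k] (n : ℕ)
    (D₁ : Type) [Ring D₁] [Algebra k D₁] (D₂ : Type) [Ring D₂] [Algebra k D₂] : Prop :=
  ∀ (P : Type) [Field P] [Algebra k P], Module.finrank k P = n →
    (Nonempty (P →ₐ[k] D₁) ↔ Nonempty (P →ₐ[k] D₂))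

theorem isSimpleRing_tensorProduct_of_center_eq_bot {F L D : Type*} [Field F] [Field L]
    [Algebra F L] [DivisionRing D] [Algebra F D] (hD : Subalgebra.center F D = ⊥) :
    IsSimpleRing (L ⊗[F] D) := by
  classical
  refine IsSimpleRing.of_eq_bot_or_eq_top fun I => ?_
  let b := Module.Basis.ofVectorSpace F L
  let e := TensorProduct.equivFinsuppOfBasisLeft (N := D) b
  have hleft : ∀ (d : D) (x : L ⊗[F] D) i, e (((1 : L) ⊗ₜ[F] d) * x) i = d * e x i := by
    intro d x i
    induction x with
    | zero => simp
    | add x y hx hy => simp [mul_add, hx, hy]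
    | tmul l d' =>
      simp only [e, Algebra.TensorProduct.tmul_mul_tmul, one_mul,
        TensorProduct.equivFinsuppOfBasisLeft_apply_tmul_apply, mul_smul_comm]
  have hright : ∀ (d : D) (x : L ⊗[F] D) i, e (x * ((1 : L) ⊗ₜ[F] d)) i = e x i * d := by
    intro d x i
    induction x with
    | zero => simp
    | add x y hx hy => simp [add_mul, hx, hy]
    | tmul l d' =>
      simp only [e, Algebra.TensorProduct.tmul_mul_tmul, mul_one,
        TensorProduct.equivFinsuppOfBasisLeft_apply_tmul_apply, smul_mul_assoc]
  by_cases hI : ∃ x ∈ I, x ≠ 0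
  · right
    have hex : ∃ N : ℕ, ∃ x ∈ I, x ≠ 0 ∧ (e x).support.card = N := by
      obtain ⟨x, hx, hx0⟩ := hI
      exact ⟨_, x, hx, hx0, rfl⟩
    obtain ⟨x, hx, hx0, hN⟩ := Nat.find_spec hex
    have hmin : ∀ y ∈ I, (e y).support.card < (e x).support.card → y = 0 := by
      intro y hy hlt
      by_contra h0
      exact Nat.find_min hex (hN ▸ hlt) ⟨y, hy, h0, rfl⟩
    have hex0 : e x ≠ 0 := fun h => hx0 (e.map_eq_zero_iff.mp h)
    obtain ⟨i, hi⟩ := Finsupp.ne_iff.mp hex0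
    rw [Finsupp.zero_apply] at hi
    let y := ((1 : L) ⊗ₜ[F] (e x i)⁻¹) * x
    have hy : y ∈ I := I.mul_mem_left _ _ hx
    have hyj : ∀ j, e y j = (e x i)⁻¹ * e x j := hleft _ _
    have hyi : e y i = 1 := by rw [hyj, inv_mul_cancel₀ hi]
    have hysupp : (e y).support = (e x).support := by
      ext j
      simp [hyj, hi]
    have hcomm : ∀ (d : D), ((1 : L) ⊗ₜ[F] d) * y - y * ((1 : L) ⊗ₜ[F] d) = 0 := by
      intro d
      refine hmin _ (I.sub_mem (I.mul_mem_left _ _ hy) (I.mul_mem_right _ _ hy)) ?_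
      refine Finset.card_lt_card ?_
      rw [Finset.ssubset_iff_of_subset]
      · exact ⟨i, by simpa using hi, by simp [hleft, hright, hyi]⟩
      · intro j hj
        rw [← hysupp, Finsupp.mem_support_iff]
        intro h0
        rw [Finsupp.mem_support_iff] at hj
        apply hj
        simp [hleft, hright, h0]
    have hcen : ∀ j, ∃ c : F, algebraMap F D c = e y j := by
      intro j
      have : e y j ∈ Subalgebra.center F D := by
        rw [Subalgebra.mem_center_iff]
        intro d
        have := congrArg (fun z => e z j) (hcomm d)
        simpa [hleft, hright, sub_eq_zero] using this
      rw [hD] at this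
      exact Algebra.mem_bot.mp this
    choose c hc using hcen
    have hyl : ∃ l : L, y = l ⊗ₜ[F] (1 : D) := by
      refine ⟨(e y).sum fun j _ => c j • b j, ?_⟩
      conv_lhs => rw [← e.symm_apply_apply y, TensorProduct.equivFinsuppOfBasisLeft_symm_apply]
      rw [Finsupp.sum, Finsupp.sum, TensorProduct.sum_tmul]
      refine Finset.sum_congr rfl fun j _ => ?_
      rw [← hc, Algebra.algebraMap_eq_smul_one, TensorProduct.tmul_smul,
        TensorProduct.smul_tmul']
    obtain ⟨l, hl⟩ := hyl
    have hl0 : l ≠ 0 := by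
      rintro rfl
      rw [TensorProduct.zero_tmul] at hl
      rw [hl] at hyi
      simp at hyi
    have h1 : (1 : L ⊗[F] D) ∈ I := by
      have := I.mul_mem_left (l⁻¹ ⊗ₜ[F] (1 : D)) _ hy
      rwa [hl, Algebra.TensorProduct.tmul_mul_tmul, inv_mul_cancel₀ hl0, one_mul,
        ← Algebra.TensorProduct.one_def] at this
    rw [eq_top_iff]
    intro z _
    simpa using I.mul_mem_left z _ h1
  · left
    push Not at hI
    rw [eq_bot_iff]
    intro x hx
    simpa using hI x hx

theorem finrank_sq_of_centralizer_le {K Δ P : Type*} [Field K] [DivisionRing Δ] [Algebra K Δ]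
    [FiniteDimensional K Δ] (hΔ : Subalgebra.center K Δ = ⊥) [Field P] [Algebra K P]
    [FiniteDimensional K P]
    (j : P →ₐ[K] Δ) (hj : ∀ x : Δ, (∀ s, x * j s = j s * x) → x ∈ j.range) :
    Module.finrank K Δ = Module.finrank K P ^ 2 := by
  classical
  let R := P ⊗[K] Δ
  have : IsSimpleRing R := isSimpleRing_tensorProduct_of_center_eq_bot hΔ
  have : IsArtinianRing R := IsArtinianRing.of_finite K R
  obtain ⟨f, hf⟩ : ∃ f : P →ₐ[K] Module.End K Δ, ∀ p x, f p x = x * j p :=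
    ⟨AlgHom.ofLinearMap ((LinearMap.mul K Δ).flip.comp j.toLinearMap) (by ext; simp) (by
      intro x y; ext z
      simp only [LinearMap.comp_apply, AlgHom.toLinearMap_apply, LinearMap.flip_apply,
        LinearMap.mul_apply', Module.End.mul_apply, mul_comm x y, map_mul, mul_assoc]),
      fun _ _ => rfl⟩
  obtain ⟨F, hF⟩ : ∃ F : R →ₐ[K] Module.End K Δ, ∀ p d x, F (p ⊗ₜ d) x = d * x * j p := by
    have hcomm : ∀ x y, Commute (f x) (Algebra.lmul K Δ y) := by
      intro x y
      ext z
      simp [hf, mul_assoc]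
    refine ⟨Algebra.TensorProduct.lift f (Algebra.lmul K Δ) hcomm, fun p d x => ?_⟩
    have := Algebra.TensorProduct.lift_tmul f (Algebra.lmul K Δ) hcomm p d
    refine (congrArg (fun u => u x) this).trans ?_
    simp [hf]
  let : Module R Δ := Module.compHom Δ F.toRingHom
  have hsmul : ∀ (r : R) (x : Δ), r • x = F r x := fun _ _ => rfl
  have : IsScalarTower K R Δ := ⟨fun c r x => by simp [hsmul]⟩
  have : SMulCommClass R K Δ := ⟨fun r c x => by simp [hsmul]⟩
  have : SMulCommClass K R Δ := SMulCommClass.symm ..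
  have : IsSimpleModule R Δ := by
    rw [isSimpleModule_iff_toSpanSingleton_surjective]
    refine ⟨inferInstance, fun x hx y => ⟨1 ⊗ₜ (y * x⁻¹), ?_⟩⟩
    simp [hsmul, hF, hx]
  obtain ⟨m, ⟨e⟩⟩ : ∃ m, Nonempty (R ≃ₗ[R] Fin m → Δ) := by
    obtain ⟨I', ⟨e'⟩⟩ : ∃ I' : Submodule R R, Nonempty (I' ≃ₗ[R] Δ) := by
      obtain ⟨J, hJ, ⟨e⟩⟩ := isSimpleModule_iff_quot_maximal.mp ‹IsSimpleModule R Δ›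
      obtain ⟨J', hJ'⟩ := exists_isCompl J
      exact ⟨J', ⟨(Submodule.quotientEquivOfIsCompl _ _ hJ').symm ≪≫ₗ e.symm⟩⟩
    have : IsSimpleModule R I' := IsSimpleModule.congr e'
    obtain ⟨m, ⟨e⟩⟩ := (IsSimpleRing.isIsotypic R R I').linearEquiv_fun
    exact ⟨m, ⟨e ≪≫ₗ LinearEquiv.piCongrRight fun _ => e'⟩⟩
  have hpos : 0 < Module.finrank K Δ := Module.finrank_pos
  have h1 : m = Module.finrank K P := by
    have h := (e.restrictScalars K).finrank_eq
    rw [Module.finrank_tensorProduct, Module.finrank_pi_fintype] at h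
    simp only [Finset.sum_const, Finset.card_univ, Fintype.card_fin, smul_eq_mul] at h
    exact (Nat.eq_of_mul_eq_mul_right hpos h).symm
  have hEnd : Module.finrank K (Δ →ₗ[R] Δ) = Module.finrank K P := by
    let φ : P →ₗ[K] (Δ →ₗ[R] Δ) :=
      { toFun := fun p =>
          { toFun := fun x => x * j p
            map_add' := fun x y => add_mul _ _ _
            map_smul' := fun r x => by
              simp only [hsmul, RingHom.id_apply]
              induction r using TensorProduct.induction_on with
              | zero => simp
              | add r s hr hs => simp [add_mul, hr, hs]
              | tmul q d =>
                simp only [hF, mul_assoc]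
                rw [← map_mul, ← map_mul, mul_comm] }
        map_add' := fun p q => by ext; simp [mul_add]
        map_smul' := fun c p => by ext; simp }
    refine (LinearEquiv.ofBijective φ ⟨?_, ?_⟩).finrank_eq.symm
    · intro p q h
      have := congrArg (fun u => u 1) h
      exact j.toRingHom.injective (by simpa [φ] using this)
    · intro u
      have hu : ∀ x, u x = x * u 1 := by
        intro x
        have := u.map_smul ((1 : P) ⊗ₜ[K] x) 1
        simpa [hsmul, hF] using this
      obtain ⟨p, hp⟩ := hj (u 1) (by
        intro s
        have := u.map_smul (s ⊗ₜ[K] (1 : Δ)) 1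
        simp only [hsmul, hF, one_mul] at this
        rw [← this, hu (j s)])
      refine ⟨p, ?_⟩
      ext x
      change x * j p = u x
      rw [hu x]
      exact congrArg _ hp
  have h2 := (LinearMap.ringLmapEquivSelf R K Δ).finrank_eq
  have h3 : Module.finrank K (R →ₗ[R] Δ) = m * Module.finrank K (Δ →ₗ[R] Δ) := by
    let e3 : (R →ₗ[R] Δ) ≃ₗ[K] ((Fin m → Δ) →ₗ[R] Δ) :=
      LinearEquiv.congrLeft Δ K e
    let e4 : (Fin m → (Δ →ₗ[R] Δ)) ≃ₗ[K] ((Fin m → Δ) →ₗ[R] Δ) :=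
      LinearMap.lsum R (fun _ : Fin m => Δ) K
    rw [e3.finrank_eq, ← e4.finrank_eq]
    have : Module.Finite K (Δ →ₗ[R] Δ) := by
      have hinj : Function.Injective (LinearMap.restrictScalarsₗ K R Δ Δ K) :=
        LinearMap.restrictScalars_injective K
      exact Module.Finite.of_injective _ hinj
    rw [Module.finrank_pi_fintype]
    simp
  rw [h3, hEnd, h1] at h2
  rw [← h2, sq]

theorem exists_field_of_mem_centralDivisionAlgebra {K Δ : Type*} [Field K] [DivisionRing Δ]
    [Algebra K Δ] [FiniteDimensional K Δ] (hΔ : Subalgebra.center K Δ = ⊥) (a : Δ) :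
    ∃ S : Subalgebra K Δ, a ∈ S ∧ (∀ x ∈ S, ∀ y ∈ S, x * y = y * x) ∧
      Module.finrank K Δ = Module.finrank K S ^ 2 := by
  classical
  let p : ℕ → Prop := fun d => ∃ S : Subalgebra K Δ, a ∈ S ∧
    (∀ x ∈ S, ∀ y ∈ S, x * y = y * x) ∧ Module.finrank K S = d
  have hp : ∃ d, p d := by
    refine ⟨_, Algebra.adjoin K {a}, Algebra.subset_adjoin rfl, ?_, rfl⟩
    intro x hx y hy
    exact congrArg Subtype.val
      (mul_comm (⟨x, hx⟩ : Algebra.adjoin K {a}) ⟨y, hy⟩)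
  have hb : ∀ d, p d → d ≤ Module.finrank K Δ := by
    rintro d ⟨S, -, -, rfl⟩
    exact Submodule.finrank_le (Subalgebra.toSubmodule S)
  obtain ⟨d0, hd0⟩ := hp
  have hmax := Nat.findGreatest_spec (P := p) (hb d0 hd0) hd0
  set d := Nat.findGreatest p (Module.finrank K Δ) with hd
  obtain ⟨S, haS, hS, hSd⟩ := hmax
  refine ⟨S, haS, hS, ?_⟩
  let : CommRing S := { (inferInstance : Ring S) with
    mul_comm := fun x y => Subtype.ext (hS x x.2 y y.2) }
  let : Field S := fieldOfFiniteDimensional K S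
  refine finrank_sq_of_centralizer_le hΔ S.val fun x hx => ?_
  rw [Subalgebra.range_val]
  let T := Algebra.adjoin K (insert x (S : Set Δ))
  have hST : S ≤ T := fun y hy => Algebra.subset_adjoin (Set.mem_insert_of_mem _ hy)
  have hT : ∀ y ∈ T, ∀ z ∈ T, y * z = z * y := by
    have hc : ∀ y ∈ insert x (S : Set Δ), ∀ z ∈ insert x (S : Set Δ), y * z = z * y := by
      rintro y (rfl | hy) z (rfl | hz)
      · rfl
      · exact hx ⟨z, hz⟩
      · exact (hx ⟨y, hy⟩).symm
      · exact hS y hy z hz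
    have := Algebra.isMulCommutative_adjoin K hc
    intro y hy z hz
    exact congrArg Subtype.val (mul_comm' (⟨y, hy⟩ : T) ⟨z, hz⟩)
  have hle : Module.finrank K T ≤ Module.finrank K S := by
    rw [hSd]
    exact Nat.le_findGreatest (hb _ ⟨T, hST haS, hT, rfl⟩) ⟨T, hST haS, hT, rfl⟩
  have : Subalgebra.toSubmodule S = Subalgebra.toSubmodule T :=
    Submodule.eq_of_le_of_finrank_le (hST) hle
  have hxT : x ∈ T := Algebra.subset_adjoin (Set.mem_insert _ _)
  rwa [← Subalgebra.mem_toSubmodule, ← this] at hxT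

section
open Polynomial

theorem Polynomial.eq_pow_of_forall_root {F : Type*} [Field F] {f p : F[X]} (hf : Irreducible f)
    (hfm : f.Monic) (hp : p.Monic)
    (h : ∀ β : AlgebraicClosure F, aeval β p = 0 → aeval β f = 0) : ∃ s : ℕ, p = f ^ s := by
  induction hN : p.natDegree using Nat.strong_induction_on generalizing p with
  | _ N ih =>
    by_cases hp0 : p.natDegree = 0
    · exact ⟨0, by rw [pow_zero]; exact eq_one_of_monic_natDegree_zero hp hp0⟩
    · obtain ⟨β, hβ⟩ := IsAlgClosed.exists_aeval_eq_zero (AlgebraicClosure F) p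
        (fun h0 => hp0 (natDegree_eq_of_degree_eq_some h0))
      have hfβ : f = minpoly F β := minpoly.eq_of_irreducible_of_monic hf (h β hβ) hfm
      obtain ⟨q, rfl⟩ : f ∣ p := hfβ ▸ minpoly.dvd F β hβ
      have hq : q.Monic := hfm.of_mul_monic_left hp
      have hdeg : (f * q).natDegree = f.natDegree + q.natDegree := hfm.natDegree_mul hq
      obtain ⟨s, rfl⟩ := ih q.natDegree (by have := hf.natDegree_pos; omega) hq
        (fun γ hγ => h γ (by simp [hγ])) rfl
      exact ⟨s + 1, (pow_succ' f s).symm⟩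

theorem LinearMap.exists_charpoly_eq_pow {F V : Type*} [Field F] [AddCommGroup V] [Module F V]
    [FiniteDimensional F V] (φ : Module.End F V) {f : F[X]} (hf : Irreducible f)
    (hfm : f.Monic) (h : aeval φ f = 0) :
    ∃ s : ℕ, φ.charpoly = f ^ s ∧ Module.finrank F V = s * f.natDegree := by
  obtain ⟨s, hs⟩ := eq_pow_of_forall_root hf hfm φ.charpoly_monic (fun β hβ => by
    let ψ := LinearMap.baseChange (AlgebraicClosure F) φ
    have hψ : aeval ψ (f.map (algebraMap F (AlgebraicClosure F))) = 0 := by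
      have : aeval ψ (f.map (algebraMap F (AlgebraicClosure F))) =
          Module.End.baseChangeHom F (AlgebraicClosure F) V (aeval φ f) := by
        rw [aeval_map_algebraMap]
        exact aeval_algHom_apply (Module.End.baseChangeHom F (AlgebraicClosure F) V) φ f
      rw [this, h, map_zero]
    have hroot : ψ.charpoly.IsRoot β := by
      rw [LinearMap.charpoly_baseChange, IsRoot, eval_map_algebraMap, hβ]
    rw [← Module.End.hasEigenvalue_iff_isRoot_charpoly] at hroot
    obtain ⟨v, hv⟩ := hroot.exists_hasEigenvector
    have h2 := Module.End.aeval_apply_of_hasEigenvector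
      (p := f.map (algebraMap F (AlgebraicClosure F))) hv
    rw [hψ, LinearMap.zero_apply, eval_map_algebraMap] at h2
    exact (smul_eq_zero.mp h2.symm).resolve_right hv.2)
  refine ⟨s, hs, ?_⟩
  rw [← φ.charpoly_natDegree, hs, hfm.natDegree_pow]

theorem LinearMap.det_eq_pow_of_irreducible {F V : Type*} [Field F] [AddCommGroup V] [Module F V]
    [FiniteDimensional F V] (φ : Module.End F V) {f : F[X]} (hf : Irreducible f)
    (hfm : f.Monic) (h : aeval φ f = 0) :
    LinearMap.det φ = ((-1) ^ f.natDegree * f.coeff 0) ^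
      (Module.finrank F V / f.natDegree) := by
  obtain ⟨s, hs, hd⟩ := φ.exists_charpoly_eq_pow hf hfm h
  rw [LinearMap.det_eq_sign_charpoly_coeff, hs, hd, Nat.mul_div_cancel _ hf.natDegree_pos,
    mul_pow, ← pow_mul, mul_comm s, coeff_zero_eq_eval_zero, coeff_zero_eq_eval_zero, eval_pow]

theorem LinearMap.trace_eq_of_irreducible {F V : Type*} [Field F] [AddCommGroup V] [Module F V]
    [FiniteDimensional F V] (φ : Module.End F V) {f : F[X]} (hf : Irreducible f)
    (hfm : f.Monic) (h : aeval φ f = 0) :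
    LinearMap.trace F V φ = -((Module.finrank F V / f.natDegree : ℕ) * f.nextCoeff) := by
  obtain ⟨s, hs, hd⟩ := φ.exists_charpoly_eq_pow hf hfm h
  have ht : LinearMap.trace F V φ = -φ.charpoly.nextCoeff := by
    rw [LinearMap.trace_eq_matrix_trace F (Module.Free.chooseBasis F V),
      Matrix.trace_eq_neg_charpoly_nextCoeff, LinearMap.charpoly_def]
  rw [ht, hs, hd, Nat.mul_div_cancel _ hf.natDegree_pos,
    hfm.nextCoeff_pow, nsmul_eq_mul]

section
variable {F U : Type*} [Field F] [DivisionRing U] [Algebra F U] [FiniteDimensional F U]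

theorem DivisionRing.norm_eq_pow_minpoly (u : U) :
    Algebra.norm F u = ((-1) ^ (minpoly F u).natDegree * (minpoly F u).coeff 0) ^
      (Module.finrank F U / (minpoly F u).natDegree) := by
  have hu := Algebra.IsIntegral.isIntegral (R := F) u
  rw [Algebra.norm_apply]
  refine LinearMap.det_eq_pow_of_irreducible _ (minpoly.irreducible hu) (minpoly.monic hu) ?_
  have := aeval_algHom_apply (Algebra.lmul F U) u (minpoly F u)
  rw [minpoly.aeval, map_zero] at this
  exact this

theorem DivisionRing.trace_eq_minpoly (u : U) :
    LinearMap.trace F U (LinearMap.mulLeft F u) =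
      -((Module.finrank F U / (minpoly F u).natDegree : ℕ) * (minpoly F u).nextCoeff) := by
  have hu := Algebra.IsIntegral.isIntegral (R := F) u
  refine LinearMap.trace_eq_of_irreducible _ (minpoly.irreducible hu) (minpoly.monic hu) ?_
  have := aeval_algHom_apply (Algebra.lmul F U) u (minpoly F u)
  rw [minpoly.aeval, map_zero] at this
  exact this

theorem DivisionRing.det_mulRight_eq_norm (u : U) :
    LinearMap.det (LinearMap.mulRight F u) = Algebra.norm F u := by
  have hu := Algebra.IsIntegral.isIntegral (R := F) u
  rw [norm_eq_pow_minpoly]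
  refine LinearMap.det_eq_pow_of_irreducible _ (minpoly.irreducible hu) (minpoly.monic hu) ?_
  ext z
  have : ∀ p : F[X], aeval (LinearMap.mulRight F u) p z = z * aeval u p := by
    intro p
    induction p using Polynomial.induction_on' with
    | add p q hp hq => simp [hp, hq, mul_add]
    | monomial n a =>
      rw [aeval_monomial, aeval_monomial, LinearMap.pow_mulRight, Module.End.mul_apply,
        LinearMap.mulRight_apply, Module.algebraMap_end_apply, Algebra.smul_def,
        ← mul_assoc, Algebra.commutes, mul_assoc]
  simp [this]
end

end

section
open Polynomial

section
variable {F A : Type*} [Field F] [Ring A] [IsDomain A] [Algebra F A] [FiniteDimensional F A]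

theorem Algebra.norm_eq_pow_minpoly_of_isDomain (u : A) :
    Algebra.norm F u = ((-1) ^ (minpoly F u).natDegree * (minpoly F u).coeff 0) ^
      (Module.finrank F A / (minpoly F u).natDegree) :=
  let _ := divisionRingOfFiniteDimensional F A
  DivisionRing.norm_eq_pow_minpoly u

theorem Algebra.trace_eq_minpoly_of_isDomain (u : A) :
    LinearMap.trace F A (LinearMap.mulLeft F u) =
      -((Module.finrank F A / (minpoly F u).natDegree : ℕ) * (minpoly F u).nextCoeff) :=
  let _ := divisionRingOfFiniteDimensional F A
  DivisionRing.trace_eq_minpoly u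

theorem Algebra.det_mulRight_eq_norm_of_isDomain (u : A) :
    LinearMap.det (LinearMap.mulRight F u) = Algebra.norm F u :=
  let _ := divisionRingOfFiniteDimensional F A
  DivisionRing.det_mulRight_eq_norm u

theorem Algebra.norm_ne_zero_of_isDomain {u : A} (hu : u ≠ 0) : Algebra.norm F u ≠ 0 := by
  let _ := divisionRingOfFiniteDimensional F A
  exact ((isUnit_iff_ne_zero.mpr hu).map (Algebra.norm F)).ne_zero

end

section
variable {K : Type} [Field K]

/-- In a central division algebra of degree `n`, every element lies in the image of a field
extension of degree `n`. -/
theorem exists_field_algHom_of_isDomain {A : Type} [Ring A] [IsDomain A] [Algebra K A]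
    [FiniteDimensional K A] (hA : Subalgebra.center K A = ⊥) {n : ℕ}
    (hn : Module.finrank K A = n ^ 2) (a : A) :
    ∃ (P : Type) (_ : Field P) (_ : Algebra K P) (j : P →ₐ[K] A),
      Module.finrank K P = n ∧ a ∈ j.range := by
  let _ := divisionRingOfFiniteDimensional K A
  obtain ⟨S, haS, hS, hdim⟩ := exists_field_of_mem_centralDivisionAlgebra (K := K) (Δ := A) hA a
  let _ : CommRing S := { (inferInstance : Ring S) with
    mul_comm := fun x y => Subtype.ext (hS x x.2 y y.2) }
  let _ : Field S := fieldOfFiniteDimensional K S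
  refine ⟨S, inferInstance, inferInstance, S.val, ?_, ⟨⟨a, haS⟩, rfl⟩⟩
  exact Nat.pow_left_injective two_ne_zero (hdim.symm.trans hn)

theorem HaveSameMaximalSubfields.symm {n : ℕ} {A B : Type} [Ring A] [Algebra K A] [Ring B]
    [Algebra K B] (h : HaveSameMaximalSubfields K n A B) : HaveSameMaximalSubfields K n B A :=
  fun P _ _ hP => (h P hP).symm

theorem HaveSameMaximalSubfields.exists_minpoly_eq {n : ℕ} {A B : Type} [Ring A] [IsDomain A]
    [Algebra K A] [Ring B] [IsDomain B] [Algebra K B]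
    [FiniteDimensional K A] (hA : Subalgebra.center K A = ⊥)
    (hn : Module.finrank K A = n ^ 2) (h : HaveSameMaximalSubfields K n A B) (a : A) :
    ∃ b : B, minpoly K b = minpoly K a := by
  obtain ⟨P, _, _, j, hP, p, rfl⟩ := exists_field_algHom_of_isDomain hA hn a
  obtain ⟨i⟩ := (h P hP).mp ⟨j⟩
  refine ⟨i p, ?_⟩
  rw [minpoly.algHom_eq i i.toRingHom.injective, AlgHom.toRingHom_eq_coe, AlgHom.coe_toRingHom,
    minpoly.algHom_eq j j.toRingHom.injective]
end

end

section
open IsLocalRing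

theorem Module.length_quotient_range_eq_of_det {O F : Type*} [CommRing O] [IsDomain O]
    [IsDiscreteValuationRing O] [AddCommGroup F] [Module O F] [Module.Free O F]
    [Module.Finite O F] (φ : F →ₗ[O] F) {ϖ : O} (hϖ : Irreducible ϖ) {m : ℕ}
    (h : Associated (LinearMap.det φ) (ϖ ^ m)) :
    Module.length O (F ⧸ LinearMap.range φ) = m := by
  classical
  have hdet : LinearMap.det φ ≠ 0 := fun h0 => by
    rw [h0, Associated.comm, associated_zero_iff_eq_zero] at h
    exact pow_ne_zero m hϖ.ne_zero h
  have hinj : Function.Injective φ := by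
    rw [← LinearMap.ker_eq_bot]
    by_contra hk
    exact hdet (LinearMap.det_eq_zero_iff_ker_ne_bot.mpr hk)
  let N := LinearMap.range φ
  let e : F ≃ₗ[O] N := LinearEquiv.ofInjective φ hinj
  let b := Module.Free.chooseBasis O F
  have hrank : Module.finrank O N = Module.finrank O F := e.finrank_eq.symm
  let a := Submodule.smithNormalFormCoeffs b hrank
  let bT := Submodule.smithNormalFormTopBasis b hrank
  let bB := Submodule.smithNormalFormBotBasis b hrank
  have hassoc : Associated (LinearMap.det φ) (∏ i, a i) := by
    rw [← Matrix.det_diagonal, ← LinearMap.det_toLin bT]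
    let e' : F ≃ₗ[O] F := (bT.equiv bB (Equiv.refl _)).trans e.symm
    refine (LinearMap.associated_det_of_eq_comp e' _ _ ?_).symm
    intro x
    have : (Matrix.toLin bT bT (Matrix.diagonal a)) = φ ∘ₗ (e' : F →ₗ[O] F) := by
      refine bT.ext fun i => ?_
      have h1 : φ (e' (bT i)) = (bB i : F) := by
        have : e (e' (bT i)) = bB i := by simp [e']
        rw [← this]; rfl
      rw [LinearMap.comp_apply, LinearEquiv.coe_coe, h1]
      rw [Matrix.toLin_self]
      simp [Matrix.diagonal_apply, a, bT, bB]
    rw [this]; rfl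
  have ha : ∀ i, ∃ n : ℕ, Associated (a i) (ϖ ^ n) := fun i =>
    IsDiscreteValuationRing.associated_pow_irreducible
      (Submodule.smithNormalFormCoeffs_ne_zero b hrank i) hϖ
  choose n hn using ha
  have hlen : ∀ i, Module.length O (O ⧸ Ideal.span ({a i} : Set O)) = n i := by
    intro i
    rw [Ideal.span_singleton_eq_span_singleton.mpr (hn i), ← Ideal.span_singleton_pow,
      ← hϖ.maximalIdeal_eq, IsDiscreteValuationRing.length_quotient_pow_maximalIdeal]
  rw [(N.quotientEquivPiSpan b hrank).length_eq, Module.length_pi_of_fintype]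
  have hsum : Associated (ϖ ^ m) (ϖ ^ ∑ i, n i) := by
    rw [← Finset.prod_pow_eq_pow_sum]
    exact h.symm.trans (hassoc.trans (Associated.prod _ _ _ fun i _ => hn i))
  have hm : m = ∑ i, n i := by
    apply le_antisymm
    · exact (pow_dvd_pow_iff hϖ.ne_zero hϖ.not_isUnit).mp hsum.dvd
    · exact (pow_dvd_pow_iff hϖ.ne_zero hϖ.not_isUnit).mp hsum.symm.dvd
  rw [hm, Nat.cast_sum]
  exact Finset.sum_congr rfl fun i _ => hlen i

end

section
open IsLocalRing
variable {O A B : Type*} [CommRing O] [IsLocalRing O] [Ring A] [Algebra O A] [Module.Finite O A]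
  [Ring B] [Algebra O B] [IsSimpleRing B] [IsArtinianRing B]

/-- If `B` is simple Artinian and `ρ : A → B` is reduction modulo `ϖ`, then every simple
`A`-module is isomorphic to a given simple `B`-module. -/
theorem nonempty_linearEquiv_of_isSimpleModule {ϖ : O} (hϖ : ϖ ∈ maximalIdeal O)
    (ρ : A →ₐ[O] B) (hρ : Function.Surjective ρ)
    (hker : ∀ x, ρ x = 0 → ∃ y, x = ϖ • y) (I : Submodule B B) [IsSimpleModule B I]
    (W : Type*) [AddCommGroup W] [Module O W] [Module A W] [IsScalarTower O A W]
    [IsSimpleModule A W] : Nonempty (W ≃ₗ[O] I) := by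
  have : Module.Finite O W := Module.Finite.trans A W
  have hW0 : ∀ w : W, ϖ • w = 0 := by
    have hmul : ∀ (a : A) (w : W), a • (ϖ • w) = ϖ • a • w := by
      intro a w
      rw [algebra_compatible_smul A ϖ w, ← mul_smul, ← Algebra.commutes, mul_smul,
        ← algebra_compatible_smul]
    let N : Submodule A W :=
      { carrier := Set.range fun w : W => ϖ • w
        add_mem' := by
          rintro _ _ ⟨x, rfl⟩ ⟨y, rfl⟩
          exact ⟨x + y, smul_add _ _ _⟩
        zero_mem' := ⟨0, smul_zero _⟩
        smul_mem' := by
          rintro a _ ⟨x, rfl⟩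
          exact ⟨a • x, (hmul a x).symm⟩ }
    rcases eq_bot_or_eq_top N with h | h
    · intro w
      have : ϖ • w ∈ N := ⟨w, rfl⟩
      rwa [h, Submodule.mem_bot] at this
    · exfalso
      have htop : (⊤ : Submodule O W) = ⊥ := by
        refine Submodule.eq_bot_of_le_smul_of_le_jacobson_bot (maximalIdeal O) _
          Module.Finite.fg_top ?_ (IsLocalRing.maximalIdeal_le_jacobson _)
        intro w _
        have hw : w ∈ N := h ▸ Submodule.mem_top
        obtain ⟨w', rfl⟩ := hw
        exact Submodule.smul_mem_smul hϖ Submodule.mem_top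
      have : Nontrivial W := IsSimpleModule.nontrivial A W
      exact bot_ne_top htop.symm
  let g : A →+* AddMonoid.End W := Module.toAddMonoidEnd A W
  have hk : RingHom.ker (ρ : A →+* B) ≤ RingHom.ker g := by
    intro x hx
    obtain ⟨y, rfl⟩ := hker x hx
    rw [RingHom.mem_ker]
    ext w
    change (ϖ • y) • w = 0
    rw [smul_assoc, hW0]
  let G : B →+* AddMonoid.End W :=
    RingHom.liftOfRightInverse (ρ : A →+* B) _ (Function.rightInverse_surjInv hρ) ⟨g, hk⟩
  let _ : Module B W := Module.compHom W G
  have hsm : ∀ (a : A) (w : W), ρ a • w = a • w := by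
    intro a w
    have : G (ρ a) = g a := RingHom.liftOfRightInverse_comp_apply (ρ : A →+* B) _
      (Function.rightInverse_surjInv hρ) ⟨g, hk⟩ a
    change G (ρ a) w = g a w
    rw [this]
  have : IsScalarTower O B W := ⟨fun c b w => by
    obtain ⟨a, rfl⟩ := hρ b
    rw [← map_smul, hsm, hsm, smul_assoc]⟩
  have : IsSimpleModule B W := by
    have hA := isSimpleModule_iff_toSpanSingleton_surjective.mp ‹IsSimpleModule A W›
    refine isSimpleModule_iff_toSpanSingleton_surjective.mpr ⟨hA.1, fun x hx y => ?_⟩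
    obtain ⟨a, ha⟩ := hA.2 x hx y
    refine ⟨ρ a, ?_⟩
    rw [LinearMap.toSpanSingleton_apply] at ha ⊢
    rw [hsm, ha]
  obtain ⟨I', ⟨e'⟩⟩ : ∃ I' : Submodule B B, Nonempty (I' ≃ₗ[B] W) := by
    obtain ⟨J, hJ, ⟨e⟩⟩ := isSimpleModule_iff_quot_maximal.mp ‹IsSimpleModule B W›
    obtain ⟨J', hJ'⟩ := exists_isCompl J
    exact ⟨J', ⟨(Submodule.quotientEquivOfIsCompl _ _ hJ').symm ≪≫ₗ e.symm⟩⟩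
  have : IsSimpleModule B I' := IsSimpleModule.congr e'
  obtain ⟨f⟩ := IsSimpleRing.isIsotypic B B I I'
  exact ⟨(e'.symm.trans f).restrictScalars O⟩

theorem exists_length_eq_mul_of_isFiniteLength {ϖ : O} (hϖ : ϖ ∈ maximalIdeal O)
    (ρ : A →ₐ[O] B) (hρ : Function.Surjective ρ)
    (hker : ∀ x, ρ x = 0 → ∃ y, x = ϖ • y) (I : Submodule B B) [IsSimpleModule B I]
    {V : Type*} [AddCommGroup V] [Module A V] (h : IsFiniteLength A V) :
    ∀ [Module O V] [IsScalarTower O A V], ∃ t : ℕ, Module.length O V = t * Module.length O I := by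
  induction h with
  | of_subsingleton =>
    intro _ _
    exact ⟨0, by simp [Module.length_eq_zero]⟩
  | @of_simple_quotient M _ _ N hs hN ih =>
    intro _ _
    obtain ⟨t, ht⟩ := ih
    obtain ⟨e⟩ := nonempty_linearEquiv_of_isSimpleModule hϖ ρ hρ hker I (M ⧸ N)
    have h1 := Module.length_eq_add_of_exact (N.subtype.restrictScalars O)
      (N.mkQ.restrictScalars O) N.subtype_injective N.mkQ_surjective
      (LinearMap.exact_subtype_mkQ N)
    refine ⟨t + 1, ?_⟩
    rw [h1, ht, e.length_eq, Nat.cast_add, add_mul, Nat.cast_one, one_mul]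

theorem exists_length_eq_mul {ϖ : O} (hϖ : ϖ ∈ maximalIdeal O)
    (ρ : A →ₐ[O] B) (hρ : Function.Surjective ρ)
    (hker : ∀ x, ρ x = 0 → ∃ y, x = ϖ • y) (I : Submodule B B) [IsSimpleModule B I]
    (V : Type*) [AddCommGroup V] [Module O V] [Module A V] [IsScalarTower O A V]
    (hV : Module.length O V ≠ ⊤) : ∃ t : ℕ, Module.length O V = t * Module.length O I := by
  have hfl := Module.length_ne_top_iff.mp hV
  rw [isFiniteLength_iff_isNoetherian_isArtinian] at hfl
  obtain ⟨h1, h2⟩ := hfl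
  exact exists_length_eq_mul_of_isFiniteLength hϖ ρ hρ hker I
    (isFiniteLength_iff_isNoetherian_isArtinian.mpr
      ⟨isNoetherian_of_tower O h1, isArtinian_of_tower O h2⟩)
end

section
open IsLocalRing
variable {O A B : Type*} [CommRing O] [IsDomain O] [IsDiscreteValuationRing O] [Ring A]
  [Algebra O A] [Module.Finite O A] [Module.Free O A]
  [Ring B] [Algebra O B] [IsSimpleRing B] [IsArtinianRing B]

/-- Divisibility of valuations of norms from an unramified order `A` with simple reduction `B`, and
existence of an element having many eigenvalues modulo the maximal ideal. -/
theorem exists_dvd_det_and_exists_shifts {ϖ : O} (hϖ : Irreducible ϖ)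
    (ρ : A →ₐ[O] B) (hρ : Function.Surjective ρ)
    (hker : ∀ x, ρ x = 0 → ∃ y, x = ϖ • y) {N : ℕ} (hN : Module.length O B = N) :
    ∃ l s : ℕ, 0 < l ∧ l * s = N ∧
      (∀ (a : A) (m : ℕ), Associated (LinearMap.det (LinearMap.mulRight O a)) (ϖ ^ m) → s ∣ m) ∧
      ∀ c : Fin l → O, ∃ a : A, ∀ i,
        ¬ IsUnit (LinearMap.det (LinearMap.mulRight O (a - algebraMap O A (c i)))) := by
  have hmem : ϖ ∈ maximalIdeal O := hϖ.1
  obtain ⟨l, hl, I, hI, ⟨e⟩⟩ := (IsSimpleRing.isIsotypic B B).linearEquiv_fun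
  have hlen : (N : ℕ∞) = l * Module.length O I := by
    rw [← hN, (e.restrictScalars O).length_eq, Module.length_pi, ENat.card_eq_coe_fintype_card,
      Fintype.card_fin]
  have hl0 : 0 < l := Nat.pos_of_ne_zero hl.out
  have hs : Module.length O I ≠ ⊤ := by
    intro h
    rw [h, ENat.mul_top (by exact_mod_cast hl.out)] at hlen
    exact ENat.natCast_ne_top _ hlen
  obtain ⟨s, hs⟩ := ENat.ne_top_iff_exists.mp hs
  refine ⟨l, s, hl0, ?_, ?_, ?_⟩
  · rw [← hs] at hlen
    exact_mod_cast hlen.symm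
  · intro a m hm
    have h1 := Module.length_quotient_range_eq_of_det _ hϖ hm
    have h2 : Module.length O (A ⧸ LinearMap.range (LinearMap.toSpanSingleton A A a)) = m := by
      rw [← h1]
      exact ((Submodule.Quotient.restrictScalarsEquiv O
        (LinearMap.range (LinearMap.toSpanSingleton A A a))).symm.trans
        (Submodule.quotEquivOfEq _ _ (by ext x; simp))).length_eq
    obtain ⟨t, ht⟩ := exists_length_eq_mul hmem ρ hρ hker I
      (A ⧸ LinearMap.range (LinearMap.toSpanSingleton A A a))
      (by rw [h2]; exact ENat.natCast_ne_top _)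
    rw [h2, ← hs] at ht
    exact ⟨t, by rw [mul_comm]; exact_mod_cast ht⟩
  · intro c
    let b : B := e.symm (fun i => c i • e 1 i)
    have hb : ∀ x : B, x * b = e.symm (fun i => c i • e x i) := by
      intro x
      rw [← smul_eq_mul, ← map_smul]
      congr 1
      ext1 i
      rw [Pi.smul_apply, smul_comm, ← Pi.smul_apply x (e 1), ← map_smul, smul_eq_mul, mul_one]
    obtain ⟨a, ha⟩ := hρ b
    refine ⟨a, fun i hu => ?_⟩
    rw [← LinearMap.isUnit_iff_isUnit_det] at hu
    obtain ⟨y, hy⟩ := ((Module.End.isUnit_iff _).mp hu).2 1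
    rw [LinearMap.mulRight_apply] at hy
    have hy' := congrArg ρ hy
    rw [map_mul, map_one, map_sub, ha, AlgHom.commutes, mul_eq_one_comm] at hy'
    have : Nontrivial I := IsSimpleModule.nontrivial B I
    obtain ⟨v, hv⟩ := exists_ne (0 : I)
    have hsm : ∀ (r : O) (z : Fin l → I), e.symm (r • z) = r • e.symm z :=
      (e.restrictScalars O).symm.map_smul
    have h0 : e.symm (Pi.single i v) * (b - algebraMap O B (c i)) = 0 := by
      rw [mul_sub, hb, ← Algebra.commutes, ← Algebra.smul_def, sub_eq_zero,
        LinearEquiv.apply_symm_apply, ← hsm]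
      congr 1
      ext1 j
      by_cases h : j = i
      · subst h; simp
      · simp [Pi.single_eq_of_ne h]
    have h1 : e.symm (Pi.single i v) = 0 := by
      rw [← mul_one (e.symm _), ← hy', ← mul_assoc, h0, zero_mul]
    rw [LinearEquiv.map_eq_zero_iff] at h1
    exact hv (by simpa using congrFun h1 i)
end

section
open IsLocalRing
variable {k : Type*} [Field k] (D : Type*) [DivisionRing D] [Algebra k D] [FiniteDimensional k D]

/-- Every element of `K ⊗ D` has a denominator in a domain with fraction field `K`. -/
theorem exists_smul_eq_map_tensorProduct (O K : Type*) [CommRing O] [IsDomain O] [Algebra k O]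
    [Field K] [Algebra k K] [Algebra O K] [IsScalarTower k O K] [IsFractionRing O K]
    {D : Type*} [Ring D] [Algebra k D] (a : K ⊗[k] D) :
    ∃ r : O, r ≠ 0 ∧ ∃ x : O ⊗[k] D, algebraMap O K r • a =
      Algebra.TensorProduct.map (IsScalarTower.toAlgHom k O K) (AlgHom.id k D) x := by
  induction a using TensorProduct.induction_on with
  | zero => exact ⟨1, one_ne_zero, 0, by simp⟩
  | tmul y d =>
    obtain ⟨p, q, hq, rfl⟩ := IsFractionRing.div_surjective (A := O) y
    have hq0 : q ≠ 0 := nonZeroDivisors.ne_zero hq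
    have hq1 : algebraMap O K q ≠ 0 := by simpa using hq0
    refine ⟨q, hq0, p ⊗ₜ d, ?_⟩
    rw [Algebra.TensorProduct.map_tmul, TensorProduct.smul_tmul', smul_eq_mul,
      mul_div_cancel₀ _ hq1]
    rfl
  | add a b ha hb =>
    obtain ⟨r, hr, x, hx⟩ := ha
    obtain ⟨s, hs, y, hy⟩ := hb
    refine ⟨r * s, mul_ne_zero hr hs, s • x + r • y, ?_⟩
    have hsm : ∀ (t : O) (z : O ⊗[k] D),
        Algebra.TensorProduct.map (IsScalarTower.toAlgHom k O K) (AlgHom.id k D) (t • z) =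
        algebraMap O K t •
          Algebra.TensorProduct.map (IsScalarTower.toAlgHom k O K) (AlgHom.id k D) z := by
      intro t z
      induction z using TensorProduct.induction_on with
      | zero => simp
      | tmul p d => simp [Algebra.smul_def]
      | add a b ha hb => simp [ha, hb]
    rw [map_add, hsm, hsm, ← hx, ← hy, map_mul, smul_add, smul_smul, smul_smul,
      mul_comm (algebraMap O K s)]

/-- The determinant of right multiplication is compatible with scalar extension. -/
theorem norm_map_tensorProduct (O K : Type*) [CommRing O] [Algebra k O]
    [Field K] [Algebra k K] [Algebra O K] [IsScalarTower k O K] [IsDomain (K ⊗[k] D)]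
    (a : O ⊗[k] D) :
    Algebra.norm K (Algebra.TensorProduct.map (IsScalarTower.toAlgHom k O K) (AlgHom.id k D) a) =
      algebraMap O K (LinearMap.det (LinearMap.mulRight O a)) := by
  classical
  let b := Module.finBasis k D
  let bO := Algebra.TensorProduct.basis O b
  let bK := Algebra.TensorProduct.basis K b
  rw [← Algebra.det_mulRight_eq_norm_of_isDomain, ← LinearMap.det_toMatrix bO,
    ← LinearMap.det_toMatrix bK, RingHom.map_det]
  congr 1
  have key : ∀ (x : O ⊗[k] D) i, bK.repr (Algebra.TensorProduct.map
      (IsScalarTower.toAlgHom k O K) (AlgHom.id k D) x) i = algebraMap O K (bO.repr x i) := by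
    intro x i
    induction x using TensorProduct.induction_on with
    | zero => simp
    | tmul p d => simp [bK, bO, Algebra.smul_def, IsScalarTower.algebraMap_apply k O K]
    | add a b ha hb => simp [ha, hb]
  ext i j
  rw [RingHom.mapMatrix_apply, Matrix.map_apply, LinearMap.toMatrix_apply,
    LinearMap.toMatrix_apply, ← key]
  simp [bK, bO]

theorem constant_exists_dvd_norm_and_exists_shifts (hD : Subalgebra.center k D = ⊥)
    (O K : Type*) [CommRing O] [IsDomain O] [IsDiscreteValuationRing O] [Algebra k O]
    [Field K] [Algebra k K] [Algebra O K] [IsScalarTower k O K] [IsFractionRing O K]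
    [IsDomain (K ⊗[k] D)] {ϖ : O} (hϖ : Irreducible ϖ) :
    ∃ l s : ℕ, 0 < l ∧ l * s = Module.finrank k D ∧
      (∀ a : K ⊗[k] D, a ≠ 0 → ∃ (j : ℤ) (u : Oˣ), Algebra.norm K a =
        algebraMap O K u * algebraMap O K ϖ ^ (s * j)) ∧
      ∀ c : Fin l → k, ∃ a : K ⊗[k] D, ∀ i, ∃ r ∈ maximalIdeal O,
        Algebra.norm K (a - algebraMap K _ (algebraMap k K (c i))) = algebraMap O K r := by
  let κ := ResidueField O
  have : IsSimpleRing (κ ⊗[k] D) := isSimpleRing_tensorProduct_of_center_eq_bot hD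
  have : IsArtinianRing (κ ⊗[k] D) := IsArtinianRing.of_finite κ _
  obtain ⟨ρ, hρ⟩ : ∃ ρ : O ⊗[k] D →ₐ[O] κ ⊗[k] D, ∀ x d, ρ (x ⊗ₜ d) = residue O x ⊗ₜ d :=
    ⟨Algebra.TensorProduct.map (Algebra.ofId O κ) (AlgHom.id k D), fun x d => by simp; rfl⟩
  have hsurj : Function.Surjective ρ := by
    intro y
    induction y using TensorProduct.induction_on with
    | zero => exact ⟨0, map_zero _⟩
    | tmul y d =>
      obtain ⟨x, rfl⟩ := residue_surjective y
      exact ⟨x ⊗ₜ d, hρ x d⟩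
    | add a b ha hb =>
      obtain ⟨x, rfl⟩ := ha
      obtain ⟨y, rfl⟩ := hb
      exact ⟨x + y, map_add _ _ _⟩
  have hker : ∀ x, ρ x = 0 → ∃ y, x = ϖ • y := by
    intro x hx
    let b := Module.finBasis k D
    let bO := Algebra.TensorProduct.basis O b
    let bκ := Algebra.TensorProduct.basis κ b
    have key : ∀ x i, bκ.repr (ρ x) i = residue O (bO.repr x i) := by
      intro x i
      induction x using TensorProduct.induction_on with
      | zero => simp
      | tmul p d => 
        rw [hρ]
        simp [bκ, bO]
        exact Or.inl rfl
      | add a b ha hb => simp [ha, hb]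
    have h1 : ∀ i, ∃ y, bO.repr x i = ϖ * y := by
      intro i
      have := key x i
      rw [hx, map_zero, Finsupp.zero_apply, eq_comm, residue_eq_zero_iff, hϖ.maximalIdeal_eq,
        Ideal.mem_span_singleton] at this
      exact this
    choose y hy using h1
    refine ⟨∑ i, y i • bO i, ?_⟩
    rw [Finset.smul_sum, ← bO.sum_repr x]
    exact Finset.sum_congr rfl fun i _ => by rw [hy, mul_smul]
  have hN : Module.length O (κ ⊗[k] D) = Module.finrank k D := by
    rw [Module.length_eq_of_surjective (R := κ) residue_surjective, Module.length_eq_finrank,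
      Module.finrank_baseChange]
  obtain ⟨l, s, hl, hls, hdvd, hsh⟩ := exists_dvd_det_and_exists_shifts hϖ ρ hsurj hker hN
  refine ⟨l, s, hl, hls, ?_, ?_⟩
  · intro a ha
    obtain ⟨r, hr, x, hx⟩ := exists_smul_eq_map_tensorProduct O K a
    have h1 := norm_map_tensorProduct D O K x
    rw [← hx, Algebra.smul_def, map_mul, Algebra.norm_algebraMap, Module.finrank_baseChange] at h1
    have hna := Algebra.norm_ne_zero_of_isDomain (F := K) ha
    have hr' : algebraMap O K r ≠ 0 := by simpa using hr
    have hdet : LinearMap.det (LinearMap.mulRight O x) ≠ 0 := by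
      intro h
      rw [h, map_zero] at h1
      exact mul_ne_zero (pow_ne_zero _ hr') hna h1
    obtain ⟨m, u, hm⟩ := IsDiscreteValuationRing.eq_unit_mul_pow_irreducible hdet hϖ
    obtain ⟨m', u', hm'⟩ := IsDiscreteValuationRing.eq_unit_mul_pow_irreducible hr hϖ
    obtain ⟨t, rfl⟩ := hdvd x m ⟨u⁻¹, by rw [hm]; rw [mul_right_comm]; simp⟩
    have hϖ0 : algebraMap O K ϖ ≠ 0 := by simpa using hϖ.ne_zero
    refine ⟨t - l * m', u * u'⁻¹ ^ (Module.finrank k D), ?_⟩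
    have hu' : algebraMap O K u' * algebraMap O K (u'⁻¹ : Oˣ) = 1 := by
      rw [← map_mul]; simp
    apply mul_left_cancel₀ (pow_ne_zero (Module.finrank k D) hr')
    rw [h1, hm, hm', mul_sub, zpow_sub₀ hϖ0]
    have e1 : (s : ℤ) * (l * m') = ((m' * Module.finrank k D : ℕ) : ℤ) := by
      rw [← hls]; push_cast; ring
    have e2 : (s : ℤ) * t = ((s * t : ℕ) : ℤ) := by push_cast; ring
    rw [e1, e2, zpow_natCast, zpow_natCast]
    simp only [map_mul, map_pow, Units.val_mul, Units.val_pow_eq_pow_val, mul_pow, pow_mul]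
    field_simp
    rw [← mul_pow, hu', one_pow]
  · intro c
    obtain ⟨a, ha⟩ := hsh fun i => algebraMap k O (c i)
    refine ⟨Algebra.TensorProduct.map (IsScalarTower.toAlgHom k O K) (AlgHom.id k D) a,
      fun i => ⟨_, ha i, ?_⟩⟩
    rw [← norm_map_tensorProduct]
    congr 1
    rw [map_sub]
    simp [Algebra.TensorProduct.algebraMap_apply]
end

section
open Polynomial

theorem Polynomial.norm_eval_le_one {E : Type*} [NormedField E]
    [IsUltrametricDist E] {h : E[X]} (hc : ∀ m, ‖h.coeff m‖ ≤ 1) {x : E}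
    (hx : ‖x‖ ≤ 1) : ‖h.eval x‖ ≤ 1 := by
  rw [eval_eq_sum_range]
  refine IsUltrametricDist.norm_sum_le_of_forall_le_of_nonneg zero_le_one fun i _ => ?_
  rw [norm_mul, norm_pow]
  exact mul_le_one₀ (hc i) (by positivity) (pow_le_one₀ (norm_nonneg _) hx)

theorem irreducible_comp_X_add_C {F : Type*} [Field F] {h : F[X]} (hi : Irreducible h) (c : F) :
    Irreducible (h.comp (X + C c)) := by
  have := (MulEquiv.irreducible_iff (algEquivAevalXAddC c)).mpr hi
  rwa [algEquivAevalXAddC_apply, ← comp_eq_aeval] at this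

section
variable {E : Type*} [NontriviallyNormedField E] [CompleteSpace E] [IsUltrametricDist E]

theorem spectralValue_eq_of_irreducible {h : E[X]} (hm : h.Monic) (hi : Irreducible h) :
    spectralValue h = ‖h.coeff 0‖ ^ (1 / h.natDegree : ℝ) := by
  have : Fact (Irreducible h) := ⟨hi⟩
  have hmin : minpoly E (AdjoinRoot.root h) = h := by
    rw [AdjoinRoot.minpoly_root hi.ne_zero, hm.leadingCoeff, inv_one, C_1, mul_one]
  have : FiniteDimensional E (AdjoinRoot h) := (AdjoinRoot.powerBasis hi.ne_zero).finite
  have := spectralNorm.spectralNorm_eq_norm_coeff_zero_rpow E _ (AdjoinRoot.root h)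
  rwa [spectralNorm, hmin] at this

theorem Irreducible.norm_coeff_le_one {h : E[X]} (hi : Irreducible h) (hm : h.Monic)
    (h0 : ‖h.coeff 0‖ ≤ 1) (m : ℕ) : ‖h.coeff m‖ ≤ 1 := by
  refine (spectralValue_le_one_iff hm).mp ?_ m
  rw [spectralValue_eq_of_irreducible hm hi]
  exact Real.rpow_le_one (norm_nonneg _) h0 (by positivity)

theorem Irreducible.norm_coeff_lt_one {h : E[X]} (hi : Irreducible h) (hm : h.Monic)
    (h0 : ‖h.coeff 0‖ < 1) {m : ℕ} (hmd : m < h.natDegree) : ‖h.coeff m‖ < 1 := by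
  have h1 : spectralValueTerms h m < 1 := by
    refine (le_ciSup (spectralValueTerms_bddAbove h) m).trans_lt ?_
    rw [← spectralValue, spectralValue_eq_of_irreducible hm hi]
    exact Real.rpow_lt_one (norm_nonneg _) h0 (by have := hi.natDegree_pos; positivity)
  rw [spectralValueTerms_of_lt_natDegree h hmd] at h1
  by_contra hc
  refine absurd (Real.one_le_rpow (not_lt.mp hc) ?_) (not_le.mpr h1)
  have : (m : ℝ) < h.natDegree := by exact_mod_cast hmd
  exact one_div_nonneg.mpr (by linarith)

/-- An irreducible polynomial over a complete nonarchimedean field takes small values in at most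
one residue class. -/
theorem Irreducible.norm_eval_eq_one {h : E[X]} (hi : Irreducible h) (hm : h.Monic) {c d : E}
    (h0 : ‖h.eval c‖ < 1) (hcd : ‖d - c‖ = 1) : ‖h.eval d‖ = 1 := by
  let g := h.comp (X + C c)
  have hgi : Irreducible g := irreducible_comp_X_add_C hi c
  have hgm : g.Monic := hm.comp_X_add_C c
  have hg0 : ‖g.coeff 0‖ < 1 := by
    rw [coeff_zero_eq_eval_zero]; simpa [g] using h0
  have hgd : h.eval d = g.eval (d - c) := by simp [g]
  have hlt : ‖∑ i ∈ Finset.range g.natDegree, g.coeff i * (d - c) ^ i‖ < 1 := by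
    have hne : (Finset.range g.natDegree).Nonempty := by simpa using hgi.natDegree_pos.ne'
    obtain ⟨i, hi, hle⟩ := IsUltrametricDist.exists_norm_finsetSum_le_of_nonempty hne
      fun i => g.coeff i * (d - c) ^ i
    refine hle.trans_lt ?_
    rw [norm_mul, norm_pow, hcd, one_pow, mul_one]
    exact hgi.norm_coeff_lt_one hgm hg0 (Finset.mem_range.mp hi)
  rw [hgd, eval_eq_sum_range, Finset.sum_range_succ, hgm.coeff_natDegree, one_mul,
    IsUltrametricDist.norm_add_eq_max_of_norm_ne_norm]
  · rw [norm_pow, hcd, one_pow, max_eq_right hlt.le]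
  · rw [norm_pow, hcd, one_pow]; exact hlt.ne

end

section
variable {F A : Type*} [Field F] [Ring A] [IsDomain A] [Algebra F A] [FiniteDimensional F A]

theorem minpoly_sub_algebraMap_of_isDomain (u : A) (c : F) :
    minpoly F (u - algebraMap F A c) = (minpoly F u).comp (X + C c) := by
  have hintg : IsIntegral F u := Algebra.IsIntegral.isIntegral u
  refine (minpoly.eq_of_irreducible_of_monic
    (irreducible_comp_X_add_C (minpoly.irreducible hintg) c) ?_
    ((minpoly.monic hintg).comp_X_add_C c)).symm
  simp [aeval_comp]

/-- Up to sign, the norm of `u - c` is a power of the value at `c` of the minimal polynomial. -/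
theorem exists_norm_sub_algebraMap_eq (u : A) : ∃ d r : ℕ, 0 < r ∧ ∀ c : F,
    Algebra.norm F (u - algebraMap F A c) = ((-1) ^ d * (minpoly F u).eval c) ^ r := by
  have hintg : IsIntegral F u := Algebra.IsIntegral.isIntegral u
  refine ⟨(minpoly F u).natDegree, Module.finrank F A / (minpoly F u).natDegree, ?_, fun c => ?_⟩
  · refine Nat.div_pos ?_ (minpoly.natDegree_pos hintg)
    exact minpoly.natDegree_le u
  · rw [Algebra.norm_eq_pow_minpoly_of_isDomain, minpoly_sub_algebraMap_of_isDomain,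
      natDegree_comp, natDegree_X_add_C, mul_one, coeff_zero_eq_eval_zero]
    simp
end

end

section
open Polynomial

section
variable {E : Type*} [NontriviallyNormedField E] [CompleteSpace E] [IsUltrametricDist E]
  {U : Type*} [DivisionRing U] [Algebra E U] [FiniteDimensional E U]

theorem norm_coeff_minpoly_le_one {u : U} (h : ‖Algebra.norm E u‖ ≤ 1) (m : ℕ) :
    ‖(minpoly E u).coeff m‖ ≤ 1 := by
  have hintg : IsIntegral E u := Algebra.IsIntegral.isIntegral u
  refine (minpoly.irreducible hintg).norm_coeff_le_one (minpoly.monic hintg) ?_ m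
  obtain ⟨d, r, hr, hN⟩ := exists_norm_sub_algebraMap_eq (F := E) u
  have h0 := hN 0
  rw [map_zero, sub_zero] at h0
  rw [h0, norm_pow, norm_mul, norm_pow, norm_neg, norm_one, one_pow, one_mul,
    pow_le_one_iff_of_nonneg (norm_nonneg _) hr.ne'] at h
  rwa [coeff_zero_eq_eval_zero]

theorem norm_norm_add_one_le_one {u : U} (h : ‖Algebra.norm E u‖ ≤ 1) :
    ‖Algebra.norm E (u + 1)‖ ≤ 1 := by
  obtain ⟨d, r, hr, hN⟩ := exists_norm_sub_algebraMap_eq (F := E) u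
  have h1 := hN (-1)
  rw [map_neg, map_one, sub_neg_eq_add] at h1
  rw [h1, norm_pow, norm_mul, norm_pow, norm_neg, norm_one, one_pow, one_mul]
  exact pow_le_one₀ (norm_nonneg _)
    (norm_eval_le_one (norm_coeff_minpoly_le_one h) (by simp))

theorem norm_trace_mulLeft_le_one {u : U} (h : ‖Algebra.norm E u‖ ≤ 1) :
    ‖LinearMap.trace E U (LinearMap.mulLeft E u)‖ ≤ 1 := by
  rw [Algebra.trace_eq_minpoly_of_isDomain, norm_neg, norm_mul]
  refine mul_le_one₀ (IsUltrametricDist.norm_natCast_le_one E _) (norm_nonneg _) ?_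
  rw [nextCoeff]
  split_ifs
  · simp
  · exact norm_coeff_minpoly_le_one h _

variable (E U) in
/-- The valuation ring of a finite dimensional division algebra over a complete field. -/
def normUnitBall : Subring U where
  carrier := {u | ‖Algebra.norm E u‖ ≤ 1}
  mul_mem' {a b} ha hb := by
    rw [Set.mem_ofPred_eq, map_mul, norm_mul]
    exact mul_le_one₀ ha (norm_nonneg _) hb
  one_mem' := by simp
  zero_mem' := by
    rw [Set.mem_ofPred_eq, ← map_zero (algebraMap E U), Algebra.norm_algebraMap,
      zero_pow Module.finrank_pos.ne', norm_zero]
    exact zero_le_one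
  neg_mem' {a} ha := by
    rw [Set.mem_ofPred_eq, ← neg_one_mul, map_mul, norm_mul]
    refine mul_le_one₀ ?_ (norm_nonneg _) ha
    rw [← map_one (algebraMap E U), ← map_neg, Algebra.norm_algebraMap]
    simp
  add_mem' {a b} ha hb := by
    have key : ∀ a b : U, ‖Algebra.norm E b‖ ≤ 1 → ‖Algebra.norm E a‖ ≤ ‖Algebra.norm E b‖ →
        ‖Algebra.norm E (a + b)‖ ≤ 1 := by
      intro a b hb hab
      by_cases hb0 : b = 0
      · subst hb0
        rw [add_zero]
        exact hab.trans hb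
      · have h1 : a + b = (a * b⁻¹ + 1) * b := by
          rw [add_mul, one_mul, mul_assoc, inv_mul_cancel₀ hb0, mul_one]
        rw [h1, map_mul, norm_mul]
        refine mul_le_one₀ (norm_norm_add_one_le_one ?_) (norm_nonneg _) hb
        have h2 : ‖Algebra.norm E (a * b⁻¹)‖ * ‖Algebra.norm E b‖ = ‖Algebra.norm E a‖ := by
          rw [← norm_mul, ← map_mul, mul_assoc, inv_mul_cancel₀ hb0, mul_one]
        have h3 : 0 < ‖Algebra.norm E b‖ := norm_pos_iff.mpr (Algebra.norm_ne_zero_of_isDomain hb0)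
        rw [← h2] at hab
        exact le_of_mul_le_mul_right (by simpa using hab) h3
    rcases le_total ‖Algebra.norm E a‖ ‖Algebra.norm E b‖ with h | h
    · exact key a b hb h
    · rw [add_comm]
      exact key b a ha h

theorem mem_normUnitBall {u : U} : u ∈ normUnitBall E U ↔ ‖Algebra.norm E u‖ ≤ 1 := Iff.rfl
end

section
variable {F U : Type*} [Field F] [Ring U] [Algebra F U] [FiniteDimensional F U] {q : ℕ}

theorem Algebra.norm_matrixDiagonal (d : Fin q → U) :
    Algebra.norm F (Matrix.diagonal d) = (∏ i, Algebra.norm F (d i)) ^ q := by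
  let L : (Fin q → Fin q → U) →ₗ[F] (Fin q → Fin q → U) :=
    LinearMap.pi fun i => (LinearMap.pi fun j =>
      (LinearMap.mulLeft F (d i)).comp (LinearMap.proj j)).comp (LinearMap.proj i)
  have h1 : Algebra.norm F (Matrix.diagonal d) = LinearMap.det L := by
    rw [Algebra.norm_apply]
    change LinearMap.det (M := Matrix (Fin q) (Fin q) U) _ =
      LinearMap.det (M := Matrix (Fin q) (Fin q) U) L
    congr 1
    refine LinearMap.ext fun z => Matrix.ext fun i j => ?_
    change (Matrix.diagonal d * z) i j = d i * z i j
    simp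
  rw [h1, LinearMap.det_pi]
  simp_rw [LinearMap.det_pi, Algebra.norm_apply]
  simp [Finset.prod_pow]
  rfl

theorem Algebra.trace_mulLeft_matrix (z : Matrix (Fin q) (Fin q) U) :
    LinearMap.trace F _ (LinearMap.mulLeft F z) =
      q * ∑ i, LinearMap.trace F U (LinearMap.mulLeft F (z i i)) := by
  classical
  let b := Module.finBasis F U
  rw [LinearMap.trace_eq_matrix_trace F (b.matrix (Fin q) (Fin q)), Matrix.trace]
  simp_rw [LinearMap.trace_eq_matrix_trace F b, Matrix.trace, Fintype.sum_prod_type]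
  rw [Finset.mul_sum]
  refine Finset.sum_congr rfl fun i _ => ?_
  have : ∀ j a, Matrix.diag (LinearMap.toMatrix (b.matrix (Fin q) (Fin q))
      (b.matrix (Fin q) (Fin q)) (LinearMap.mulLeft F z)) (i, j, a) =
      Matrix.diag (LinearMap.toMatrix b b (LinearMap.mulLeft F (z i i))) a := by
    intro j a
    rw [Matrix.diag_apply, Matrix.diag_apply, LinearMap.toMatrix_apply, LinearMap.toMatrix_apply]
    have hr : ∀ x, (b.matrix (Fin q) (Fin q)).repr x (i, j, a) = b.repr (x i j) a := fun _ => rfl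
    simp [hr]
  simp_rw [this]
  simp
end

end

section
open Polynomial

section
variable {E V : Type*} [Field E] [AddCommGroup V] [Module E V] [FiniteDimensional E V]

theorem sum_finrank_ker_aeval_le {ι : Type*} (φ : Module.End E V) (h : ι → E[X]) (s : Finset ι)
    (hc : ∀ i ∈ s, ∀ j ∈ s, i ≠ j → IsCoprime (h i) (h j)) :
    ∑ i ∈ s, Module.finrank E (LinearMap.ker (aeval φ (h i))) ≤
      Module.finrank E (LinearMap.ker (aeval φ (∏ i ∈ s, h i))) := by
  classical
  induction s using Finset.induction_on with
  | empty => simp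
  | insert i s hi ih =>
    have ih := ih fun a ha b hb =>
      hc a (Finset.mem_insert_of_mem ha) b (Finset.mem_insert_of_mem hb)
    have hcop : IsCoprime (h i) (∏ j ∈ s, h j) := IsCoprime.prod_right fun j hj =>
      hc i (Finset.mem_insert_self _ _) j (Finset.mem_insert_of_mem hj) (by rintro rfl; exact hi hj)
    rw [Finset.sum_insert hi, Finset.prod_insert hi,
      ← sup_ker_aeval_eq_ker_aeval_mul_of_coprime φ hcop]
    have := Submodule.finrank_sup_add_finrank_inf_eq (LinearMap.ker (aeval φ (h i)))
      (LinearMap.ker (aeval φ (∏ j ∈ s, h j)))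
    rw [(disjoint_ker_aeval_of_isCoprime φ hcop).eq_bot, finrank_bot] at this
    omega
end

section
variable {F U : Type*} [Field F] [DivisionRing U] [Algebra F U] [FiniteDimensional F U] {q : ℕ}

/-- A nonzero left ideal of a matrix algebra over `U` has dimension at least `q * dim U`. -/
theorem le_finrank_of_leftIdeal (V : Submodule F (Matrix (Fin q) (Fin q) U)) (hV : V ≠ ⊥)
    (hmul : ∀ x, ∀ z ∈ V, x * z ∈ V) : q * Module.finrank F U ≤ Module.finrank F V := by
  obtain ⟨z, hz, hz0⟩ := Submodule.exists_mem_ne_zero_of_ne_bot hV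
  obtain ⟨a, b, hab⟩ : ∃ a b, z a b ≠ 0 := by
    by_contra! h
    exact hz0 (Matrix.ext h)
  have hL : ∀ w : Fin q → U, Matrix.vecMulVec w (z a) = Matrix.vecMulVec w (Pi.single a 1) * z := by
    intro w
    ext i j
    simp [Matrix.mul_apply, Matrix.vecMulVec_apply, Pi.single_apply]
  let L : (Fin q → U) →ₗ[F] V :=
    { toFun := fun w => ⟨Matrix.vecMulVec w (z a), by rw [hL]; exact hmul _ _ hz⟩
      map_add' := fun x y => by ext i j; simp [Matrix.vecMulVec_apply, add_mul]
      map_smul' := fun x y => by ext i j; simp [Matrix.vecMulVec_apply] }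
  have hLi : Function.Injective L := by
    intro x y hxy
    funext i
    have := congrFun (congrFun (congrArg Subtype.val hxy) i) b
    exact mul_right_cancel₀ hab this
  have := LinearMap.finrank_le_finrank_of_injective hLi
  rwa [Module.finrank_pi_fintype, Finset.sum_const, Finset.card_univ, Fintype.card_fin,
    smul_eq_mul] at this

end

section
variable {K E Δ M : Type*} [Field K] [Field E] [Algebra K E] [Ring Δ] [Algebra K Δ]
  [Ring M] [Algebra E M] (e : E ⊗[K] Δ ≃ₐ[E] M)

theorem map_one_tmul_smul (r : K) (a : Δ) :
    e (1 ⊗ₜ (r • a)) = algebraMap K E r • e (1 ⊗ₜ a) := by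
  rw [← map_smul, TensorProduct.tmul_smul, algebraMap_smul]

/-- The scalar extension of a basis, transported along an isomorphism. -/
noncomputable def baseChangeBasis {ι : Type*} (b : Module.Basis ι K Δ) : Module.Basis ι E M :=
  (Algebra.TensorProduct.basis E b).map e.toLinearEquiv

theorem baseChangeBasis_apply {ι : Type*} (b : Module.Basis ι K Δ) (i : ι) :
    baseChangeBasis e b i = e (1 ⊗ₜ b i) := by
  simp [baseChangeBasis]

theorem baseChangeBasis_repr {ι : Type*} (b : Module.Basis ι K Δ) (x : Δ) (i : ι) :
    (baseChangeBasis e b).repr (e (1 ⊗ₜ x)) i = algebraMap K E (b.repr x i) := by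
  simp [baseChangeBasis, Algebra.algebraMap_eq_smul_one]

theorem toMatrix_mulLeft_baseChange {ι : Type*} [Fintype ι] [DecidableEq ι]
    (b : Module.Basis ι K Δ) (x : Δ) :
    LinearMap.toMatrix (baseChangeBasis e b) (baseChangeBasis e b)
      (LinearMap.mulLeft E (e (1 ⊗ₜ x))) =
    (LinearMap.toMatrix b b (LinearMap.mulLeft K x)).map (algebraMap K E) := by
  ext i j
  rw [Matrix.map_apply, LinearMap.toMatrix_apply, LinearMap.toMatrix_apply,
    LinearMap.mulLeft_apply, LinearMap.mulLeft_apply, ← baseChangeBasis_repr e,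
    baseChangeBasis_apply, ← map_mul, Algebra.TensorProduct.tmul_mul_tmul, one_mul]

theorem linearIndependent_baseChange {ι : Type*} {v : ι → Δ} (hv : LinearIndependent K v) :
    LinearIndependent E fun i => e (1 ⊗ₜ[K] v i) := by
  let b := Module.Basis.extend hv.linearIndepOn_id
  let f : ι → hv.linearIndepOn_id.extend (Set.subset_univ _) := fun i =>
    ⟨v i, hv.linearIndepOn_id.subset_extend _ (Set.mem_range_self i)⟩
  have hf : Function.Injective f := fun i j hij => hv.injective (congrArg Subtype.val hij)
  convert (baseChangeBasis e b).linearIndependent.comp f hf using 2 with i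
  rw [Function.comp_apply, baseChangeBasis_apply, Module.Basis.extend_apply_self]

variable [FiniteDimensional K Δ]

theorem norm_baseChange (x : Δ) :
    Algebra.norm E (e (1 ⊗ₜ x)) = algebraMap K E (Algebra.norm K x) := by
  classical
  let b := Module.finBasis K Δ
  rw [Algebra.norm_apply, Algebra.norm_apply]
  change LinearMap.det (LinearMap.mulLeft E (e (1 ⊗ₜ x))) =
    algebraMap K E (LinearMap.det (LinearMap.mulLeft K x))
  rw [← LinearMap.det_toMatrix b, RingHom.map_det, ← LinearMap.det_toMatrix (baseChangeBasis e b),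
    toMatrix_mulLeft_baseChange]
  rfl

theorem trace_mulLeft_baseChange (x : Δ) :
    LinearMap.trace E M (LinearMap.mulLeft E (e (1 ⊗ₜ x))) =
      algebraMap K E (LinearMap.trace K Δ (LinearMap.mulLeft K x)) := by
  classical
  let b := Module.finBasis K Δ
  rw [LinearMap.trace_eq_matrix_trace K b, LinearMap.trace_eq_matrix_trace E (baseChangeBasis e b),
    toMatrix_mulLeft_baseChange, Matrix.trace, Matrix.trace, map_sum]
  rfl

/-- Irreducible factors of the minimal polynomial over an extension are still zero divisors. -/
theorem ker_aeval_mulRight_ne_bot (a : Δ) {h : E[X]} (hd : 0 < h.natDegree)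
    (hdvd : h ∣ (minpoly K a).map (algebraMap K E)) :
    LinearMap.ker (aeval (LinearMap.mulRight E (e (1 ⊗ₜ a))) h) ≠ ⊥ := by
  intro hbot
  obtain ⟨g, hg⟩ := hdvd
  set δ := e (1 ⊗ₜ a)
  have hintg : IsIntegral K a := Algebra.IsIntegral.isIntegral a
  have hmon := (minpoly.monic hintg).map (algebraMap K E)
  have h0 : aeval δ ((minpoly K a).map (algebraMap K E)) = 0 := by
    let ψ : Δ →ₐ[K] E ⊗[K] Δ := Algebra.TensorProduct.includeRight
    have h1 : aeval (ψ a) (minpoly K a) = 0 := by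
      rw [aeval_algHom_apply, minpoly.aeval, map_zero]
    rw [← aeval_map_algebraMap E] at h1
    have h2 := congrArg e h1
    rw [map_zero] at h2
    rw [← h2]
    exact aeval_algHom_apply e.toAlgHom _ _
  have hcomm : ∀ (p : E[X]) (z : M), aeval (LinearMap.mulRight E δ) p z = z * aeval δ p := by
    intro p z
    induction p using Polynomial.induction_on' generalizing z with
    | add p q hp hq => simp [hp, hq, mul_add]
    | monomial n c =>
      rw [aeval_monomial, aeval_monomial, LinearMap.pow_mulRight]
      rw [← Algebra.smul_def, ← Algebra.smul_def, mul_smul_comm]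
      simp
  have hg0 : aeval δ g = 0 := by
    have : aeval δ g ∈ LinearMap.ker (aeval (LinearMap.mulRight E δ) h) := by
      rw [LinearMap.mem_ker, hcomm, ← map_mul, mul_comm, ← hg, h0]
    rwa [hbot, Submodule.mem_bot] at this
  have hne : h * g ≠ 0 := hg ▸ hmon.ne_zero
  have hgne : g ≠ 0 := right_ne_zero_of_mul hne
  have hdeg : g.natDegree < (minpoly K a).natDegree := by
    rw [← (minpoly.monic hintg).natDegree_map (algebraMap K E), hg,
      natDegree_mul (left_ne_zero_of_mul hne) hgne]
    omega
  have hli := linearIndependent_baseChange e (linearIndependent_pow (K := K) a)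
  rw [Fintype.linearIndependent_iff] at hli
  have hco := hli (fun i => g.coeff i) ?_
  · apply hgne
    ext m
    by_cases hm : m < (minpoly K a).natDegree
    · exact hco ⟨m, hm⟩
    · rw [coeff_eq_zero_of_natDegree_lt (by omega), coeff_zero]
  · rw [aeval_eq_sum_range' hdeg, ← Fin.sum_univ_eq_sum_range
      (fun i => g.coeff i • δ ^ i)] at hg0
    rw [← hg0]
    refine Finset.sum_congr rfl fun i _ => ?_
    congr 1
    rw [← map_pow, Algebra.TensorProduct.tmul_pow, one_pow]
end

end

section
open Polynomial

theorem exists_irreducible_factor_norm_eval_lt_one {E : Type*} [NormedField E]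
    {f : E[X]} (hf : f.Monic) {c : E} (hc : ‖f.eval c‖ < 1) :
    ∃ h : E[X], h.Monic ∧ Irreducible h ∧ h ∣ f ∧ ‖h.eval c‖ < 1 := by
  classical
  by_contra! hcon
  have hprod := UniqueFactorizationMonoid.prod_normalizedFactors_eq hf.ne_zero
  rw [hf.normalize_eq_self] at hprod
  rw [← hprod, eval_multiset_prod, ← normHom_apply, map_multiset_prod, Multiset.map_map] at hc
  refine absurd hc (not_lt.mpr ?_)
  refine Multiset.one_le_prod fun x hx => ?_
  obtain ⟨h, hh, rfl⟩ := Multiset.mem_map.mp hx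
  have hi := UniqueFactorizationMonoid.irreducible_of_normalized_factor h hh
  have hmon : h.Monic := by
    have := UniqueFactorizationMonoid.normalize_normalized_factor h hh
    rw [← this]
    exact monic_normalize hi.ne_zero
  exact hcon h hmon hi (UniqueFactorizationMonoid.dvd_of_mem_normalizedFactors hh)

section
variable {K E Δ U : Type*} [Field K] [Field E] [Algebra K E] [DivisionRing Δ] [Algebra K Δ]
  [FiniteDimensional K Δ] [DivisionRing U] [Algebra E U] [FiniteDimensional E U] {q : ℕ}

theorem finrank_eq_of_algEquiv_matrix (e : E ⊗[K] Δ ≃ₐ[E] Matrix (Fin q) (Fin q) U) :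
    Module.finrank K Δ = q * (q * Module.finrank E U) := by
  rw [← Module.finrank_baseChange (R := E) (S := K) (M' := Δ), e.toLinearEquiv.finrank_eq,
    Module.finrank_matrix]
  simp [mul_assoc]
end

section
variable {K E Δ U : Type*} [Field K] [NontriviallyNormedField E] [CompleteSpace E]
  [IsUltrametricDist E] [Algebra K E] [DivisionRing Δ] [Algebra K Δ] [FiniteDimensional K Δ]
  [DivisionRing U] [Algebra E U] [FiniteDimensional E U] {q : ℕ}
  (e : E ⊗[K] Δ ≃ₐ[E] Matrix (Fin q) (Fin q) U)

include e in
/-- An element with `l` eigenvalues in different residue classes forces a large matrix size. -/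
theorem le_of_exists_shifts {l : ℕ} (c : Fin l → K)
    (hc : ∀ i j, i ≠ j → ‖algebraMap K E (c i) - algebraMap K E (c j)‖ = 1) (a : Δ)
    (ha : ∀ i, ‖algebraMap K E (Algebra.norm K (a - algebraMap K Δ (c i)))‖ < 1) : l ≤ q := by
  have hintg : IsIntegral K a := Algebra.IsIntegral.isIntegral a
  let f := (minpoly K a).map (algebraMap K E)
  have hf : f.Monic := (minpoly.monic hintg).map _
  obtain ⟨d, r, hr, hN⟩ := exists_norm_sub_algebraMap_eq (F := K) a
  have hfc : ∀ i, ‖f.eval (algebraMap K E (c i))‖ < 1 := by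
    intro i
    have h := ha i
    rw [hN, map_pow, map_mul, norm_pow, norm_mul, map_pow, map_neg, map_one, norm_pow, norm_neg,
      norm_one, one_pow, one_mul, pow_lt_one_iff_of_nonneg (norm_nonneg _) hr.ne'] at h
    rwa [eval_map_apply]
  choose h hm hi hd hlt using fun i => exists_irreducible_factor_norm_eval_lt_one hf (hfc i)
  have hcop : ∀ i j, i ≠ j → IsCoprime (h i) (h j) := by
    intro i j hij
    refine (hi i).coprime_iff_not_dvd.mpr fun hdvd => ?_
    have heq : h i = h j := eq_of_monic_of_associated (hm i) (hm j)
      ((hi i).associated_of_dvd (hi j) hdvd)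
    have h1 := (hi i).norm_eval_eq_one (hm i) (hlt i) (hc j i hij.symm)
    rw [heq] at h1
    exact absurd (hlt j) (by rw [h1]; exact lt_irrefl _)
  have hsum := sum_finrank_ker_aeval_le (LinearMap.mulRight E (e (1 ⊗ₜ a))) h Finset.univ
    fun i _ j _ => hcop i j
  have hge : ∀ i, q * Module.finrank E U ≤
      Module.finrank E (LinearMap.ker (aeval (LinearMap.mulRight E (e (1 ⊗ₜ a))) (h i))) := by
    intro i
    refine le_finrank_of_leftIdeal _ (ker_aeval_mulRight_ne_bot e a (hi i).natDegree_pos (hd i)) ?_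
    intro x z hz
    have hcomm : Commute (LinearMap.mulLeft E x) (LinearMap.mulRight E (e (1 ⊗ₜ a))) :=
      LinearMap.commute_mulLeft_right x _
    have hcomm' : Commute (LinearMap.mulLeft E x)
        (aeval (LinearMap.mulRight E (e (1 ⊗ₜ a))) (h i)) := by
      induction (h i) using Polynomial.induction_on' with
      | add p q hp hq => rw [map_add]; exact hp.add_right hq
      | monomial n c =>
        rw [aeval_monomial]
        exact (Algebra.commute_algebraMap_right c _).mul_right (hcomm.pow_right n)
    rw [LinearMap.mem_ker] at hz ⊢
    have := congrArg (fun φ => φ z) hcomm'.eq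
    simp only [Module.End.mul_apply, LinearMap.mulLeft_apply] at this
    rw [← this, hz, mul_zero]
  have h2 := Finset.sum_le_sum fun i (_ : i ∈ (Finset.univ : Finset (Fin l))) => hge i
  have h3 := (h2.trans hsum).trans (Submodule.finrank_le _)
  rw [← e.toLinearEquiv.finrank_eq, Module.finrank_baseChange, finrank_eq_of_algEquiv_matrix e,
    Finset.sum_const, Finset.card_univ, Fintype.card_fin, smul_eq_mul] at h3
  refine le_of_mul_le_mul_right h3 (Nat.pos_of_ne_zero fun h0 => ?_)
  have := finrank_eq_of_algEquiv_matrix e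
  rw [h0, mul_zero] at this
  exact Module.finrank_pos.ne' this
end

end

section
open Polynomial

section
variable {E U : Type*} [NontriviallyNormedField E] [Ring U] [Algebra E U] [FiniteDimensional E U]

theorem continuous_norm_linearMap_sub {ι : Type*} [Finite ι] (L : (ι → E) →ₗ[E] U) (u : U) :
    Continuous fun v => Algebra.norm E (L v - u) := by
  classical
  let b := Module.finBasis E U
  simp_rw [Algebra.norm_eq_matrix_det b, map_sub]
  refine Continuous.matrix_det (Continuous.sub ?_ continuous_const)
  exact ((Algebra.leftMulMatrix b).toLinearMap.comp L).continuous_on_pi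

variable {K Δ : Type*} [Field K] [Algebra K E] [Ring Δ] [Algebra K Δ] [FiniteDimensional K Δ]
  {M : Type*} [Ring M] [Algebra E M] (e : E ⊗[K] Δ ≃ₐ[E] M)

theorem exists_baseChange_mem (hK : DenseRange (algebraMap K E)) {S : Set M} (hS : S.Nonempty)
    (hopen : ∀ L : (Fin (Module.finrank K Δ) → E) →ₗ[E] M, IsOpen (L ⁻¹' S)) :
    ∃ a : Δ, e (1 ⊗ₜ a) ∈ S := by
  let b := Module.finBasis K Δ
  let B := baseChangeBasis e b
  obtain ⟨z, hz⟩ := hS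
  obtain ⟨w, hw⟩ := (DenseRange.piMap (f := fun _ : Fin (Module.finrank K Δ) => algebraMap K E)
    fun _ => hK).exists_mem_open (hopen B.equivFun.symm.toLinearMap)
      ⟨B.equivFun z, by simpa using hz⟩
  refine ⟨b.equivFun.symm w, ?_⟩
  have : e (1 ⊗ₜ b.equivFun.symm w) = B.equivFun.symm (Pi.map (fun _ => algebraMap K E) w) := by
    apply B.equivFun.injective
    rw [LinearEquiv.apply_symm_apply]
    ext i
    rw [Module.Basis.equivFun_apply, baseChangeBasis_repr, ← Module.Basis.equivFun_apply,
      LinearEquiv.apply_symm_apply]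
    rfl
  rw [this]
  exact hw

include e in
theorem exists_norm_norm_eq [IsUltrametricDist E] [FiniteDimensional E M]
    (hK : DenseRange (algebraMap K E)) (z : M)
    (hz : Algebra.norm E z ≠ 0) :
    ∃ a : Δ, ‖algebraMap K E (Algebra.norm K a)‖ = ‖Algebra.norm E z‖ := by
  obtain ⟨a, ha⟩ := exists_baseChange_mem e hK (S := {x | ‖Algebra.norm E x - Algebra.norm E z‖ <
    ‖Algebra.norm E z‖}) ⟨z, by simpa using hz⟩ fun L => by
      have h1 := continuous_norm_linearMap_sub L 0
      simp_rw [sub_zero] at h1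
      exact isOpen_lt (h1.sub continuous_const).norm continuous_const
  refine ⟨a, ?_⟩
  rw [← norm_baseChange e]
  have ha' : ‖Algebra.norm E (e (1 ⊗ₜ a)) - Algebra.norm E z‖ < ‖Algebra.norm E z‖ := ha
  have := IsUltrametricDist.norm_add_eq_max_of_norm_ne_norm ha'.ne
  rw [sub_add_cancel] at this
  rw [this, max_eq_right ha'.le]

end

section
variable {K E Δ U : Type*} [Field K] [NontriviallyNormedField E]
  [IsUltrametricDist E] [Algebra K E] [DivisionRing Δ] [Algebra K Δ] [FiniteDimensional K Δ]
  [DivisionRing U] [Algebra E U] [FiniteDimensional E U] {q : ℕ}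
  (e : E ⊗[K] Δ ≃ₐ[E] Matrix (Fin q) (Fin q) U)

include e in
/-- The division algebra part of a completion is unramified when the norms of the global division
algebra are highly divisible. -/
theorem exists_eq_zpow_smul (hK : DenseRange (algebraMap K E)) {π : E} (hπ0 : 0 < ‖π‖)
    (hπ1 : ‖π‖ < 1) {l s : ℕ} (hl : 0 < l) (hls : l * s = Module.finrank K Δ) (hlq : l ≤ q)
    (ha : ∀ a : Δ, a ≠ 0 → ∃ j : ℤ, ‖algebraMap K E (Algebra.norm K a)‖ = ‖π‖ ^ (s * j : ℤ))
    (u : U) (hu : u ≠ 0) : ∃ (j : ℤ) (u₀ : U), ‖Algebra.norm E u₀‖ = 1 ∧ u = π ^ j • u₀ := by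
  classical
  have hπne : π ≠ 0 := norm_pos_iff.mp hπ0
  have hq : 0 < q := hl.trans_le hlq
  set f := Module.finrank E U with hf
  have hf0 : 0 < f := Module.finrank_pos
  have hN : Module.finrank K Δ = q * (q * f) := finrank_eq_of_algEquiv_matrix e
  have ha' : ∀ z : Matrix (Fin q) (Fin q) U, Algebra.norm E z ≠ 0 →
      ∃ j : ℤ, ‖Algebra.norm E z‖ = ‖π‖ ^ (s * j : ℤ) := by
    intro z hz
    obtain ⟨a, h⟩ := exists_norm_norm_eq e hK z hz
    rw [← h]
    refine ha a ?_
    rintro rfl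
    rw [← map_zero (algebraMap K Δ), Algebra.norm_algebraMap, zero_pow Module.finrank_pos.ne',
      map_zero, norm_zero, eq_comm, norm_eq_zero] at h
    exact hz h
  have hdiag : ∀ v : U, Algebra.norm E (Matrix.diagonal (Function.update 1 (⟨0, hq⟩ : Fin q) v)) =
      Algebra.norm E v ^ q := by
    intro v
    rw [Algebra.norm_matrixDiagonal, Fintype.prod_eq_single ⟨0, hq⟩]
    · simp
    · intro i hi
      rw [Function.update_of_ne hi, Pi.one_apply, map_one]
  have key : ∀ v : U, v ≠ 0 → ∃ j : ℤ, ‖Algebra.norm E v‖ ^ q = ‖π‖ ^ (s * j : ℤ) := by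
    intro v hv
    obtain ⟨j, hj⟩ := ha' (Matrix.diagonal (Function.update 1 (⟨0, hq⟩ : Fin q) v)) (by
      rw [hdiag]
      exact pow_ne_zero _ (Algebra.norm_ne_zero_of_isDomain hv))
    exact ⟨j, by rw [← hj, hdiag, norm_pow]⟩
  have hs : s = q * f := by
    have hge : q * f ≤ s := by
      by_contra! hlt
      have h1 : l * s < q * (q * f) := Nat.mul_lt_mul_of_le_of_lt hlq hlt (hl.trans_le hlq)
      omega
    refine le_antisymm ?_ hge
    obtain ⟨j, hj⟩ := key (algebraMap E U π) ((_root_.map_ne_zero _).mpr hπne)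
    rw [Algebra.norm_algebraMap, norm_pow, ← pow_mul, ← zpow_natCast] at hj
    have h2 := zpow_right_injective₀ hπ0 hπ1.ne hj
    have h3 : (s : ℤ) ∣ (f * q : ℕ) := ⟨j, h2⟩
    rw [mul_comm q f]
    exact Nat.le_of_dvd (by positivity) (Int.natCast_dvd_natCast.mp h3)
  obtain ⟨j, hj⟩ := key u hu
  have hj' : ‖Algebra.norm E u‖ = ‖π‖ ^ (f * j : ℤ) := by
    rw [← pow_left_inj₀ (norm_nonneg _) (zpow_nonneg hπ0.le _) hq.ne', hj, ← zpow_natCast,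
      ← zpow_mul, hs]
    congr 1
    push_cast
    ring
  refine ⟨j, π ^ (-j) • u, ?_, ?_⟩
  · rw [Algebra.smul_def, map_mul, Algebra.norm_algebraMap, norm_mul, hj', norm_pow, norm_zpow,
      ← zpow_natCast, ← zpow_mul, ← zpow_add₀ hπ0.ne']
    convert zpow_zero _
    rw [← hf]
    ring
  · rw [smul_smul, ← zpow_add₀ hπne, add_neg_cancel, zpow_zero, one_smul]
end

end

/-- A subring of a finite dimensional algebra that is a full lattice over the valuation ring `O` and
that is its own dual for the trace form. -/
structure IsSelfDualOrder {K Δ : Type*} [Field K] [Ring Δ] [Algebra K Δ] (O : ValuationSubring K)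
    (Λ : Subring Δ) : Prop where
  smul_mem : ∀ c ∈ O, ∀ a ∈ Λ, c • a ∈ Λ
  exists_smul_mem : ∀ a, ∃ c : K, c ≠ 0 ∧ c • a ∈ Λ
  mem_iff : ∀ a, a ∈ Λ ↔ ∀ b ∈ Λ, LinearMap.trace K Δ (LinearMap.mulLeft K (a * b)) ∈ O

theorem norm_norm_smul {E U : Type*} [NormedField E] [DivisionRing U]
    [Algebra E U] [FiniteDimensional E U] (c : E) (u : U) :
    ‖Algebra.norm E (c • u)‖ = ‖c‖ ^ Module.finrank E U * ‖Algebra.norm E u‖ := by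
  rw [Algebra.smul_def, map_mul, Algebra.norm_algebraMap, norm_mul, norm_pow]

section
variable {K E Δ U : Type*} [Field K] [NontriviallyNormedField E] [CompleteSpace E]
  [IsUltrametricDist E] [Algebra K E] [DivisionRing Δ] [Algebra K Δ] [FiniteDimensional K Δ]
  [DivisionRing U] [Algebra E U] [FiniteDimensional E U] {q : ℕ}
  (e : E ⊗[K] Δ ≃ₐ[E] Matrix (Fin q) (Fin q) U)

theorem norm_trace_mulLeft_matrix_le_one {x : Matrix (Fin q) (Fin q) U}
    (hx : ∀ i j, x i j ∈ normUnitBall E U) :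
    ‖LinearMap.trace E _ (LinearMap.mulLeft E x)‖ ≤ 1 := by
  rw [Algebra.trace_mulLeft_matrix, norm_mul]
  refine mul_le_one₀ (IsUltrametricDist.norm_natCast_le_one E _) (norm_nonneg _) ?_
  exact IsUltrametricDist.norm_sum_le_of_forall_le_of_nonneg zero_le_one fun i _ =>
    norm_trace_mulLeft_le_one (hx i i)

/-- The preimage of the matrices with integral entries. -/
noncomputable def integralMatrixOrder : Subring Δ :=
  (normUnitBall E U).matrix.comap
    ((e : E ⊗[K] Δ →+* Matrix (Fin q) (Fin q) U).comp
      (Algebra.TensorProduct.includeRight : Δ →ₐ[K] E ⊗[K] Δ).toRingHom)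

omit [FiniteDimensional K Δ] in
theorem mem_integralMatrixOrder {a : Δ} :
    a ∈ integralMatrixOrder e ↔ ∀ i j, e (1 ⊗ₜ a) i j ∈ normUnitBall E U := Iff.rfl

theorem isSelfDualOrder_integralMatrixOrder (hK : DenseRange (algebraMap K E))
    {O : ValuationSubring K} (hO : ∀ c, c ∈ O ↔ ‖algebraMap K E c‖ ≤ 1) {π : K}
    (hπ0 : 0 < ‖algebraMap K E π‖) (hπ1 : ‖algebraMap K E π‖ < 1)
    (hN : ‖(Module.finrank K Δ : E)‖ = 1)
    (hU : ∀ u : U, u ≠ 0 → ∃ (j : ℤ) (u₀ : U), ‖Algebra.norm E u₀‖ = 1 ∧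
      u = (algebraMap K E π) ^ j • u₀) :
    IsSelfDualOrder O (integralMatrixOrder e) := by
  classical
  have hπne : π ≠ 0 := by rintro rfl; simp at hπ0
  have hf0 : 0 < Module.finrank E U := Module.finrank_pos
  refine ⟨fun c hc a ha => ?_, fun a => ?_, fun a => ⟨fun ha b hb => ?_, fun h => ?_⟩⟩
  · rw [mem_integralMatrixOrder] at ha ⊢
    intro i j
    rw [map_one_tmul_smul, Matrix.smul_apply, mem_normUnitBall, norm_norm_smul]
    exact mul_le_one₀ (pow_le_one₀ (norm_nonneg _) ((hO c).mp hc)) (norm_nonneg _) (ha i j)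
  · set S : ℝ := 1 + ∑ i, ∑ j, ‖Algebra.norm E (e (1 ⊗ₜ a) i j)‖ with hS
    have hS0 : 0 < S := by positivity
    obtain ⟨n, hn⟩ := exists_pow_lt_of_lt_one (inv_pos.mpr hS0) hπ1
    refine ⟨π ^ n, pow_ne_zero _ hπne, ?_⟩
    rw [mem_integralMatrixOrder]
    intro i j
    rw [map_one_tmul_smul, Matrix.smul_apply, mem_normUnitBall, norm_norm_smul, map_pow, norm_pow]
    have h1 : ‖Algebra.norm E (e (1 ⊗ₜ a) i j)‖ ≤ S := by
      have h2 := Finset.single_le_sum (f := fun j => ‖Algebra.norm E (e (1 ⊗ₜ a) i j)‖)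
        (fun _ _ => norm_nonneg _) (Finset.mem_univ j)
      have h3 := Finset.single_le_sum (f := fun i => ∑ j, ‖Algebra.norm E (e (1 ⊗ₜ a) i j)‖)
        (fun _ _ => Finset.sum_nonneg fun _ _ => norm_nonneg _) (Finset.mem_univ i)
      linarith
    have h2 : (‖algebraMap K E π‖ ^ n) ^ Module.finrank E U ≤ S⁻¹ :=
      (pow_le_of_le_one (by positivity) (pow_le_one₀ hπ0.le hπ1.le) hf0.ne').trans hn.le
    calc _ ≤ S⁻¹ * S := mul_le_mul h2 h1 (norm_nonneg _) (inv_nonneg.mpr hS0.le)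
      _ = 1 := inv_mul_cancel₀ hS0.ne'
  · rw [hO, ← trace_mulLeft_baseChange e]
    exact norm_trace_mulLeft_matrix_le_one (mul_mem ha hb)
  · by_contra ha
    rw [mem_integralMatrixOrder] at ha
    push Not at ha
    obtain ⟨i₀, j₀, hij⟩ := ha
    have hu0 : e (1 ⊗ₜ a) i₀ j₀ ≠ 0 := fun h0 => hij (h0 ▸ zero_mem _)
    obtain ⟨t, u₀, hu₀, hut⟩ := hU _ hu0
    have ht : t < 0 := by
      by_contra! ht
      apply hij
      rw [hut, mem_normUnitBall, norm_norm_smul, hu₀, mul_one]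
      lift t to ℕ using ht
      rw [zpow_natCast, norm_pow]
      exact pow_le_one₀ (by positivity) (pow_le_one₀ hπ0.le hπ1.le)
    have hu₀ne : u₀ ≠ 0 := by
      rintro rfl
      rw [smul_zero] at hut
      exact hu0 hut
    set S : ℝ := 1 + ∑ i, ∑ j, ‖Algebra.norm E (e (1 ⊗ₜ a) i j)‖ with hS
    have hS1 : 1 ≤ S := by
      rw [hS, le_add_iff_nonneg_right]
      positivity
    let z : Matrix (Fin q) (Fin q) U := Matrix.single j₀ i₀ u₀⁻¹
    have hz : ∀ i j, z i j ∈ normUnitBall E U := by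
      intro i j
      simp only [z, Matrix.single_apply]
      split_ifs
      · rw [mem_normUnitBall]
        have h1 : ‖Algebra.norm E u₀⁻¹‖ * ‖Algebra.norm E u₀‖ = 1 := by
          rw [← norm_mul, ← map_mul, inv_mul_cancel₀ hu₀ne, map_one, norm_one]
        rw [hu₀, mul_one] at h1
        exact h1.le
      · exact zero_mem _
    obtain ⟨b, hb⟩ := exists_baseChange_mem e hK
      (S := {x | ∀ i j, ‖Algebra.norm E (x i j - z i j)‖ < S⁻¹})
      ⟨z, fun i j => by
        rw [sub_self, ← map_zero (algebraMap E U), Algebra.norm_algebraMap, zero_pow hf0.ne',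
          norm_zero]
        positivity⟩ fun L => by
          have hset : L ⁻¹' {x | ∀ i j, ‖Algebra.norm E (x i j - z i j)‖ < S⁻¹} =
              ⋂ i, ⋂ j, {v | ‖Algebra.norm E (L v i j - z i j)‖ < S⁻¹} := by
            ext v
            simp
          rw [hset]
          refine isOpen_iInter_of_finite fun i => isOpen_iInter_of_finite fun j => ?_
          exact isOpen_lt (continuous_norm_linearMap_sub
            ((Matrix.entryLinearMap E U i j).comp L) (z i j)).norm continuous_const
    have hb : ∀ i j, ‖Algebra.norm E (e (1 ⊗ₜ b) i j - z i j)‖ < S⁻¹ := hb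
    have hbΛ : b ∈ integralMatrixOrder e := by
      rw [mem_integralMatrixOrder]
      intro i j
      rw [← sub_add_cancel (e (1 ⊗ₜ b) i j) (z i j)]
      exact add_mem ((hb i j).le.trans (inv_le_one_of_one_le₀ hS1)) (hz i j)
    have h1 := h b hbΛ
    have hadd : ∀ x y : Matrix (Fin q) (Fin q) U,
        LinearMap.mulLeft E (x + y) = LinearMap.mulLeft E x + LinearMap.mulLeft E y :=
      fun x y => LinearMap.ext fun w => add_mul x y w
    rw [hO, ← trace_mulLeft_baseChange e, ← one_mul (1 : E),
      ← Algebra.TensorProduct.tmul_mul_tmul, map_mul,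
      ← sub_add_cancel (e (1 ⊗ₜ b)) z, mul_add, hadd, map_add] at h1
    have h2 : ‖LinearMap.trace E _ (LinearMap.mulLeft E (e (1 ⊗ₜ a) * (e (1 ⊗ₜ b) - z)))‖ ≤ 1 := by
      refine norm_trace_mulLeft_matrix_le_one fun i j => ?_
      rw [Matrix.mul_apply]
      refine sum_mem fun l _ => ?_
      rw [mem_normUnitBall, map_mul, norm_mul, Matrix.sub_apply]
      have h2 := Finset.single_le_sum (f := fun j => ‖Algebra.norm E (e (1 ⊗ₜ a) i j)‖)
        (fun _ _ => norm_nonneg _) (Finset.mem_univ l)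
      have h3 := Finset.single_le_sum (f := fun i => ∑ j, ‖Algebra.norm E (e (1 ⊗ₜ a) i j)‖)
        (fun _ _ => Finset.sum_nonneg fun _ _ => norm_nonneg _) (Finset.mem_univ i)
      calc _ ≤ S * S⁻¹ := mul_le_mul (by linarith) (hb l j).le (norm_nonneg _) (by linarith)
        _ = 1 := mul_inv_cancel₀ (by linarith)
    have h3 : LinearMap.trace E _ (LinearMap.mulLeft E (e (1 ⊗ₜ a) * z)) =
        (q * Module.finrank E U : ℕ) * (algebraMap K E π) ^ t := by
      rw [Algebra.trace_mulLeft_matrix, Fintype.sum_eq_single i₀]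
      · have : (e (1 ⊗ₜ a) * z) i₀ i₀ = algebraMap E U (algebraMap K E π ^ t) := by
          rw [Matrix.mul_apply, Fintype.sum_eq_single j₀]
          · simp only [z, Matrix.single_apply_same]
            rw [hut, smul_mul_assoc, mul_inv_cancel₀ hu₀ne]
            exact (Algebra.algebraMap_eq_smul_one _).symm
          · intro j hj
            simp only [z]
            rw [Matrix.single_apply_of_row_ne hj.symm, mul_zero]
        rw [this]
        have h4 : LinearMap.mulLeft E (algebraMap E U (algebraMap K E π ^ t)) =
            (algebraMap K E π ^ t) • LinearMap.id := by
          ext x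
          simp [Algebra.smul_def]
        rw [h4, map_smul, LinearMap.trace_id, smul_eq_mul]
        push_cast
        ring
      · intro i hi
        have : (e (1 ⊗ₜ a) * z) i i = 0 := by
          rw [Matrix.mul_apply]
          refine Finset.sum_eq_zero fun j _ => ?_
          simp only [z]
          rw [Matrix.single_apply_of_col_ne _ _ hi.symm, mul_zero]
        rw [this, LinearMap.mulLeft_zero_eq_zero, map_zero]
    have hqf : ‖((q * Module.finrank E U : ℕ) : E)‖ = 1 := by
      rw [finrank_eq_of_algEquiv_matrix e, Nat.cast_mul, norm_mul] at hN
      refine le_antisymm (IsUltrametricDist.norm_natCast_le_one E _) ?_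
      rw [← hN]
      exact mul_le_of_le_one_left (norm_nonneg _) (IsUltrametricDist.norm_natCast_le_one E _)
    have h4 : 1 < ‖LinearMap.trace E _ (LinearMap.mulLeft E (e (1 ⊗ₜ a) * z))‖ := by
      rw [h3, norm_mul, hqf, one_mul, norm_zpow]
      exact one_lt_zpow_of_neg₀ hπ0 hπ1 ht
    rw [IsUltrametricDist.norm_add_eq_max_of_norm_ne_norm (h2.trans_lt h4).ne,
      max_eq_right (h2.trans h4.le)] at h1
    exact absurd h1 (not_le.mpr h4)
end

section
variable {K E Δ : Type} [Field K] [NontriviallyNormedField E] [CompleteSpace E]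
  [IsUltrametricDist E] [Algebra K E] [DivisionRing Δ] [Algebra K Δ] [FiniteDimensional K Δ]

theorem exists_isSelfDualOrder_of_complete (hΔ : Subalgebra.center K Δ = ⊥)
    (hK : DenseRange (algebraMap K E))
    {O : ValuationSubring K} (hO : ∀ c, c ∈ O ↔ ‖algebraMap K E c‖ ≤ 1) {π : K}
    (hπ0 : 0 < ‖algebraMap K E π‖) (hπ1 : ‖algebraMap K E π‖ < 1)
    (hN : ‖(Module.finrank K Δ : E)‖ = 1)
    {l s : ℕ} (hl : 0 < l) (hls : l * s = Module.finrank K Δ)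
    (ha : ∀ a : Δ, a ≠ 0 →
      ∃ j : ℤ, ‖algebraMap K E (Algebra.norm K a)‖ = ‖algebraMap K E π‖ ^ (s * j : ℤ))
    (c : Fin l → K)
    (hc : ∀ i j, i ≠ j → ‖algebraMap K E (c i) - algebraMap K E (c j)‖ = 1) (b : Δ)
    (hb : ∀ i, ‖algebraMap K E (Algebra.norm K (b - algebraMap K Δ (c i)))‖ < 1) :
    ∃ Λ : Subring Δ, IsSelfDualOrder O Λ := by
  have := isSimpleRing_tensorProduct_of_center_eq_bot (L := E) hΔ
  have : IsArtinianRing (E ⊗[K] Δ) := IsArtinianRing.of_finite E _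
  obtain ⟨q, _, U, _, _, _, ⟨e⟩⟩ :=
    IsSimpleRing.exists_algEquiv_matrix_divisionRing_finite E (E ⊗[K] Δ)
  exact ⟨_, isSelfDualOrder_integralMatrixOrder e hK hO hπ0 hπ1 hN
    (exists_eq_zpow_smul e hK hπ0 hπ1 hl hls (le_of_exists_shifts e c hc b hb) ha)⟩
end

section
variable (O K : Type) [CommRing O] [IsDomain O] [IsDiscreteValuationRing O] [Field K] [Algebra O K]
  [IsFractionRing O K]

theorem valuation_maximalIdeal_le_one_iff (c : K) :
    (⟨IsLocalRing.maximalIdeal O, inferInstance, IsDiscreteValuationRing.not_a_field O⟩ :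
      IsDedekindDomain.HeightOneSpectrum O).valuation K c ≤ 1 ↔ c ∈ (algebraMap O K).range := by
  constructor
  · intro h
    refine IsDedekindDomain.HeightOneSpectrum.mem_integers_of_valuation_le_one (R := O) K c
      fun v => ?_
    have hv : v = ⟨IsLocalRing.maximalIdeal O, inferInstance,
        IsDiscreteValuationRing.not_a_field O⟩ :=
      IsDedekindDomain.HeightOneSpectrum.ext
        (IsLocalRing.eq_maximalIdeal (v.isPrime.isMaximal v.ne_bot))
    rw [hv]
    exact h
  · rintro ⟨r, rfl⟩
    exact IsDedekindDomain.HeightOneSpectrum.valuation_le_one _ r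

theorem exists_complete_field_of_isDiscreteValuationRing :
    ∃ (E : Type) (_ : NontriviallyNormedField E) (_ : CompleteSpace E) (_ : IsUltrametricDist E)
      (_ : Algebra K E), DenseRange (algebraMap K E) ∧
      ∀ c : K, ‖algebraMap K E c‖ ≤ 1 ↔ c ∈ (algebraMap O K).range := by
  let v : IsDedekindDomain.HeightOneSpectrum O :=
    ⟨IsLocalRing.maximalIdeal O, inferInstance, IsDiscreteValuationRing.not_a_field O⟩
  let hr : (Valued.v : Valuation (v.adicCompletion K) (WithZero (Multiplicative ℤ))).RankOne :=
    Valuation.IsRankOneDiscrete.rankOne (Valued.v) (e := 2) one_lt_two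
  let hn : NontriviallyNormedField (v.adicCompletion K) := Valued.toNontriviallyNormedField _ _
  refine ⟨v.adicCompletion K, hn, inferInstanceAs (CompleteSpace (v.adicCompletion K)),
    inferInstance, inferInstance, v.denseRange_algebraMap K, fun c => ?_⟩
  refine Iff.trans (Valued.toNormedField.norm_le_one_iff (val := inferInstance)) ?_
  rw [← valuation_maximalIdeal_le_one_iff]
  change Valued.v (c : v.adicCompletion K) ≤ 1 ↔ _
  rw [IsDedekindDomain.HeightOneSpectrum.adicCompletion.valued_coe]
end

section
variable {k : Type} [Field k] {D : Type} [DivisionRing D] [Algebra k D]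

theorem center_tensorProduct_eq_bot {K : Type} [Field K] [Algebra k K]
    (hD : Subalgebra.center k D = ⊥) : Subalgebra.center K (K ⊗[k] D) = ⊥ := by
  rw [eq_bot_iff]
  intro x hx
  have h1 : x ∈ Subalgebra.centralizer k
      ((Algebra.TensorProduct.includeRight : D →ₐ[k] K ⊗[k] D).range : Set (K ⊗[k] D)) := by
    rw [Subalgebra.mem_centralizer_iff]
    exact fun y _ => Subalgebra.mem_center_iff.mp hx y
  rw [Subalgebra.centralizer_range_includeRight_eq_center_tensorProduct, hD] at h1
  obtain ⟨y, rfl⟩ := h1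
  clear hx
  induction y using TensorProduct.induction_on with
  | zero => exact zero_mem _
  | add a b ha hb =>
    rw [map_add]
    exact add_mem ha hb
  | tmul a d =>
    obtain ⟨c, hc⟩ := Algebra.mem_bot.mp d.2
    refine Algebra.mem_bot.mpr ⟨c • a, ?_⟩
    change (c • a) ⊗ₜ[k] (1 : D) = a ⊗ₜ (d : D)
    rw [← hc, TensorProduct.smul_tmul, Algebra.algebraMap_eq_smul_one]

theorem Algebra.norm_eq_of_minpoly_eq {K A B : Type*} [Field K] [Ring A] [IsDomain A] [Algebra K A]
    [FiniteDimensional K A] [Ring B] [IsDomain B] [Algebra K B] [FiniteDimensional K B]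
    (hAB : Module.finrank K A = Module.finrank K B) {a : A} {b : B}
    (h : minpoly K a = minpoly K b) (c : K) :
    Algebra.norm K (a - algebraMap K A c) = Algebra.norm K (b - algebraMap K B c) := by
  rw [Algebra.norm_eq_pow_minpoly_of_isDomain, Algebra.norm_eq_pow_minpoly_of_isDomain,
    minpoly_sub_algebraMap_of_isDomain, minpoly_sub_algebraMap_of_isDomain, h, hAB]

/-- A division algebra with the same maximal subfields as a constant one is unramified. -/
theorem exists_isSelfDualOrder_of_haveSameMaximalSubfields [Infinite k]
    (hD : Subalgebra.center k D = ⊥) {n : ℕ} (hn : 0 < n) (hn' : Module.finrank k D = n ^ 2)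
    (hnk : (n : k) ≠ 0) {K : Type} [Field K] [Algebra k K] [IsDomain (K ⊗[k] D)]
    {Δ : Type} [DivisionRing Δ] [Algebra K Δ] (hΔ : Subalgebra.center K Δ = ⊥)
    (hnΔ : Module.finrank K Δ = n ^ 2) (h : HaveSameMaximalSubfields K n Δ (K ⊗[k] D))
    (O : ValuationSubring K) [IsDiscreteValuationRing O] (hO : ∀ c, algebraMap k K c ∈ O) :
    ∃ Λ : Subring Δ, IsSelfDualOrder O Λ := by
  have hpos : 0 < n ^ 2 := by positivity
  have : FiniteDimensional k D := FiniteDimensional.of_finrank_pos (hn' ▸ hpos)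
  have : FiniteDimensional K Δ := FiniteDimensional.of_finrank_pos (hnΔ ▸ hpos)
  have hfin : Module.finrank K (K ⊗[k] D) = n ^ 2 := by rw [Module.finrank_baseChange, hn']
  let _ : Algebra k O := ((algebraMap k K).codRestrict O hO).toAlgebra
  have : IsScalarTower k O K := IsScalarTower.of_algebraMap_eq fun _ => rfl
  obtain ⟨ϖ, hϖ⟩ := IsDiscreteValuationRing.exists_irreducible O
  obtain ⟨l, s, hl, hls, ha, hb⟩ := constant_exists_dvd_norm_and_exists_shifts D hD O K hϖ
  obtain ⟨E, _, _, _, _, hdense, hE⟩ := exists_complete_field_of_isDiscreteValuationRing O K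
  have hOE : ∀ c : K, c ∈ O ↔ ‖algebraMap K E c‖ ≤ 1 := by
    intro c
    rw [hE]
    exact ⟨fun hc => ⟨⟨c, hc⟩, rfl⟩, by rintro ⟨r, rfl⟩; exact r.2⟩
  have hunit : ∀ u : Oˣ, ‖algebraMap K E (algebraMap O K u)‖ = 1 := by
    intro u
    refine le_antisymm ((hOE _).mp (u : O).2) ?_
    have h1 : ‖algebraMap K E (algebraMap O K u)‖ *
        ‖algebraMap K E (algebraMap O K (u⁻¹ : Oˣ))‖ = 1 := by
      rw [← norm_mul, ← map_mul, ← map_mul, Units.mul_inv, map_one, map_one, norm_one]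
    rw [← h1]
    exact mul_le_of_le_one_right (norm_nonneg _) ((hOE _).mp ((u⁻¹ : Oˣ) : O).2)
  have hmax : ∀ r ∈ IsLocalRing.maximalIdeal O, ‖algebraMap K E (algebraMap O K r)‖ < 1 := by
    intro r hr
    refine lt_of_le_of_ne ((hOE _).mp r.2) fun h1 => ?_
    have hr0 : algebraMap O K r ≠ 0 := by
      intro h0
      rw [h0, map_zero, norm_zero] at h1
      exact zero_ne_one h1
    have h2 : (algebraMap O K r)⁻¹ ∈ O := by
      rw [hOE, map_inv₀, norm_inv, h1, inv_one]
    have h3 : IsUnit r := IsUnit.of_mul_eq_one ⟨_, h2⟩ (Subtype.ext (mul_inv_cancel₀ hr0))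
    exact (IsLocalRing.mem_maximalIdeal r).mp hr h3
  have hconst : ∀ c : k, c ≠ 0 → ‖algebraMap K E (algebraMap k K c)‖ = 1 := by
    intro c hc
    exact hunit (Units.map (algebraMap k O) (Units.mk0 c hc))
  have hϖ0 : 0 < ‖algebraMap K E (algebraMap O K ϖ)‖ := by
    rw [norm_pos_iff, map_ne_zero]
    exact fun h0 => hϖ.ne_zero (Subtype.ext h0)
  have hϖ1 := hmax ϖ ((IsLocalRing.mem_maximalIdeal _).mpr hϖ.not_isUnit)
  let c : Fin l → k := fun i => Infinite.natEmbedding k i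
  have hc : Function.Injective c := fun i j hij =>
    Fin.val_injective ((Infinite.natEmbedding k).injective hij)
  obtain ⟨a, haa⟩ := hb c
  obtain ⟨b, hba⟩ := h.symm.exists_minpoly_eq (center_tensorProduct_eq_bot hD) hfin a
  refine exists_isSelfDualOrder_of_complete hΔ hdense hOE hϖ0 hϖ1 ?_ hl
    (by rw [hls, hn', hnΔ]) ?_ (fun i => algebraMap k K (c i)) ?_ b ?_
  · rw [hnΔ, Nat.cast_pow, norm_pow, ← map_natCast (algebraMap K E), ← map_natCast (algebraMap k K),
      hconst _ hnk, one_pow]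
  · intro x hx
    obtain ⟨y, hy⟩ := h.exists_minpoly_eq hΔ hnΔ x
    have hN := Algebra.norm_eq_of_minpoly_eq (hfin.trans hnΔ.symm) hy 0
    rw [map_zero, map_zero, sub_zero, sub_zero] at hN
    have hy0 : y ≠ 0 := by
      rintro rfl
      refine Algebra.norm_ne_zero_of_isDomain (F := K) hx ?_
      rw [← hN, ← map_zero (algebraMap K _), Algebra.norm_algebraMap, hfin, zero_pow hpos.ne']
    obtain ⟨j, u, hju⟩ := ha y hy0
    refine ⟨j, ?_⟩
    rw [← hN, hju, map_mul, norm_mul, hunit, one_mul, map_zpow₀, norm_zpow]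
  · intro i j hij
    rw [← map_sub, ← map_sub]
    exact hconst _ (sub_ne_zero.mpr (hc.ne hij))
  · intro i
    obtain ⟨r, hr, hr'⟩ := haa i
    rw [Algebra.norm_eq_of_minpoly_eq (hnΔ.trans hfin.symm) hba, hr']
    exact hmax r hr
end

section
variable (K Δ : Type*) [Field K] [DivisionRing Δ] [Algebra K Δ]

/-- The bilinear form `(a, b) ↦ tr (x ↦ a * b * x)`. -/
noncomputable def mulTraceForm : LinearMap.BilinForm K Δ :=
  (LinearMap.mul K Δ).compr₂ ((LinearMap.trace K Δ).comp (LinearMap.mul K Δ))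

variable {K Δ}

theorem mulTraceForm_apply (a b : Δ) :
    mulTraceForm K Δ a b = LinearMap.trace K Δ (LinearMap.mulLeft K (a * b)) := rfl

theorem mulTraceForm_comm (a b : Δ) : mulTraceForm K Δ a b = mulTraceForm K Δ b a := by
  rw [mulTraceForm_apply, mulTraceForm_apply, LinearMap.mulLeft_mul, LinearMap.mulLeft_mul,
    ← Module.End.mul_eq_comp, ← Module.End.mul_eq_comp, LinearMap.trace_mul_comm]

theorem mulTraceForm_one_algebraMap [FiniteDimensional K Δ] (c : K) :
    mulTraceForm K Δ 1 (algebraMap K Δ c) = c * Module.finrank K Δ := by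
  rw [mulTraceForm_apply, one_mul]
  have : LinearMap.mulLeft K (algebraMap K Δ c) = c • (1 : Module.End K Δ) := by
    ext x; simp [Algebra.smul_def]
  rw [this, map_smul, LinearMap.trace_one, smul_eq_mul]

theorem mulTraceForm_nondegenerate [FiniteDimensional K Δ] (hN : (Module.finrank K Δ : K) ≠ 0) :
    (mulTraceForm K Δ).Nondegenerate := by
  have key : ∀ a : Δ, a ≠ 0 → mulTraceForm K Δ a a⁻¹ ≠ 0 := by
    intro a ha
    have := mulTraceForm_one_algebraMap (Δ := Δ) (1 : K)
    rw [mulTraceForm_apply, map_one, one_mul, one_mul] at this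
    rw [mulTraceForm_apply, mul_inv_cancel₀ ha, this]
    exact hN
  constructor
  · intro a h
    by_contra ha
    exact key a ha (h _)
  · intro a h
    by_contra ha
    exact key a ha (by rw [mulTraceForm_comm]; exact h _)

theorem isSelfDualOrder_iff_mulTraceForm_mem {O : ValuationSubring K} {Λ : Subring Δ}
    (h : IsSelfDualOrder O Λ) (a : Δ) : a ∈ Λ ↔ ∀ b ∈ Λ, mulTraceForm K Δ a b ∈ O :=
  h.mem_iff a

theorem exists_isSelfDualOrder_of_repr_mem [FiniteDimensional K Δ]
    (hN : (Module.finrank K Δ : K) ≠ 0) {ι : Type*} [Fintype ι] [DecidableEq ι]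
    (b : Module.Basis ι K Δ) (O : ValuationSubring K)
    (h1 : ∀ i, b.repr 1 i ∈ O) (hmul : ∀ i j l, b.repr (b i * b j) l ∈ O)
    (htr : ∀ i j, mulTraceForm K Δ (b i) (b j) ∈ O)
    (hdual : ∀ i j, b.repr ((mulTraceForm K Δ).dualBasis
      (mulTraceForm_nondegenerate hN) b i) j ∈ O) :
    ∃ Λ : Subring Δ, IsSelfDualOrder O Λ ∧ ∀ i, b i ∈ Λ := by
  set b' := (mulTraceForm K Δ).dualBasis (mulTraceForm_nondegenerate hN) b with hb'
  have hmul' : ∀ x y : Δ, (∀ i, b.repr x i ∈ O) → (∀ i, b.repr y i ∈ O) →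
      ∀ i, b.repr (x * y) i ∈ O := by
    intro x y hx hy l
    rw [← b.sum_repr x, ← b.sum_repr y, Finset.sum_mul, map_sum, Finset.sum_apply']
    refine sum_mem fun i _ => ?_
    rw [Finset.mul_sum, map_sum, Finset.sum_apply']
    refine sum_mem fun j _ => ?_
    rw [smul_mul_smul_comm, map_smul, Finsupp.smul_apply, smul_eq_mul]
    exact mul_mem (mul_mem (hx i) (hy j)) (hmul i j l)
  let Λ : Subring Δ :=
    { carrier := {a | ∀ i, b.repr a i ∈ O}
      mul_mem' := fun {x y} hx hy => hmul' x y hx hy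
      one_mem' := h1
      add_mem' := fun {x y} hx hy i => by
        rw [map_add, Finsupp.add_apply]; exact add_mem (hx i) (hy i)
      zero_mem' := fun i => by rw [map_zero, Finsupp.zero_apply]; exact zero_mem _
      neg_mem' := fun {x} hx i => by rw [map_neg, Finsupp.neg_apply]; exact neg_mem (hx i) }
  have hΛ : ∀ a, a ∈ Λ ↔ ∀ i, b.repr a i ∈ O := fun a => Iff.rfl
  have hbΛ : ∀ i, b i ∈ Λ := fun i j => by
    rw [b.repr_self, Finsupp.single_apply]
    split_ifs
    exacts [one_mem _, zero_mem _]
  have hsm : ∀ c ∈ O, ∀ a ∈ Λ, c • a ∈ Λ := fun c hc a ha i => by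
    rw [map_smul, Finsupp.smul_apply, smul_eq_mul]; exact mul_mem hc (ha i)
  refine ⟨Λ, ⟨hsm, fun a => ?_, fun a => ?_⟩, hbΛ⟩
  · choose r hr hr' using fun i => (show ∃ r : K, r ≠ 0 ∧ r ∈ O ∧ r * b.repr a i ∈ O by
      rcases O.mem_or_inv_mem (b.repr a i) with h | h
      · exact ⟨1, one_ne_zero, one_mem _, by rwa [one_mul]⟩
      · by_cases h0 : b.repr a i = 0
        · exact ⟨1, one_ne_zero, one_mem _, by rw [h0, mul_zero]; exact zero_mem _⟩
        · exact ⟨_, inv_ne_zero h0, h, by rw [inv_mul_cancel₀ h0]; exact one_mem _⟩)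
    refine ⟨∏ i, r i, Finset.prod_ne_zero_iff.mpr fun i _ => hr i, fun i => ?_⟩
    rw [map_smul, Finsupp.smul_apply, smul_eq_mul, ← Finset.prod_erase_mul _ _ (Finset.mem_univ i),
      mul_assoc]
    exact mul_mem (prod_mem fun j _ => (hr' j).1) (hr' i).2
  · change a ∈ Λ ↔ ∀ b ∈ Λ, mulTraceForm K Δ a b ∈ O
    constructor
    · intro ha c hc
      rw [← b.sum_repr a, map_sum, LinearMap.sum_apply]
      refine sum_mem fun i _ => ?_
      rw [map_smul, LinearMap.smul_apply, ← b.sum_repr c, map_sum, smul_eq_mul]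
      refine mul_mem (ha i) (sum_mem fun j _ => ?_)
      rw [map_smul, smul_eq_mul]
      exact mul_mem (hc j) (htr i j)
    · intro h
      rw [← b'.sum_repr a]
      refine sum_mem fun i _ => hsm _ ?_ _ (hdual i)
      rw [hb', LinearMap.BilinForm.dualBasis_repr_apply]
      exact h _ (hbΛ i)

theorem exists_basis_of_selfDual [FiniteDimensional K Δ] (hN : (Module.finrank K Δ : K) ≠ 0)
    {A : Type*} [CommRing A] [IsDomain A] [IsPrincipalIdealRing A] [Algebra A K]
    [IsFractionRing A K] (L : Set Δ)
    (h1 : ∀ a, ∃ f : A, f ≠ 0 ∧ algebraMap A K f • a ∈ L)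
    (h2 : ∀ a, a ∈ L ↔ ∀ b ∈ L, mulTraceForm K Δ a b ∈ (algebraMap A K).range) :
    ∃ e : Module.Basis (Fin (Module.finrank K Δ)) K Δ,
      (∀ a, a ∈ L ↔ ∀ i, e.repr a i ∈ (algebraMap A K).range) ∧
      (∃ d : A, IsUnit d ∧ (LinearMap.BilinForm.toMatrix e (mulTraceForm K Δ)).det =
        algebraMap A K d) := by
  classical
  let _ : Module A Δ := Module.compHom Δ (algebraMap A K)
  have hsmul : ∀ (r : A) (x : Δ), r • x = algebraMap A K r • x := fun _ _ => rfl
  have : IsScalarTower A K Δ := ⟨fun r c x => by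
    rw [hsmul, Algebra.smul_def r c, mul_smul]⟩
  let M : Submodule A Δ :=
    { carrier := L
      add_mem' := fun {x y} hx hy => (h2 _).mpr fun b hb => by
        rw [map_add, LinearMap.add_apply]
        exact add_mem ((h2 x).mp hx b hb) ((h2 y).mp hy b hb)
      zero_mem' := (h2 _).mpr fun b hb => by
        rw [map_zero, LinearMap.zero_apply]; exact zero_mem _
      smul_mem' := fun r x hx => (h2 _).mpr fun b hb => by
        rw [hsmul, map_smul, LinearMap.smul_apply, smul_eq_mul]
        exact mul_mem ⟨r, rfl⟩ ((h2 x).mp hx b hb) }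
  have hM : ∀ a, a ∈ M ↔ a ∈ L := fun a => Iff.rfl
  have hnd := mulTraceForm_nondegenerate (K := K) (Δ := Δ) hN
  -- a basis contained in `M`
  let b₀ := Module.finBasis K Δ
  choose f hf0 hfL using fun i => h1 (b₀ i)
  have hfK : ∀ i, algebraMap A K (f i) ≠ 0 := fun i => by
    rw [Ne, FaithfulSMul.algebraMap_eq_zero_iff]; exact hf0 i
  let b := b₀.isUnitSMul fun i => (hfK i).isUnit
  have hb : ∀ i, b i ∈ M := fun i => by
    rw [hM, Module.Basis.isUnitSMul_apply]; exact hfL i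
  have hfg : M.FG := by
    have hle : M ≤ Submodule.span A (Set.range ((mulTraceForm K Δ).dualBasis hnd b)) := by
      intro a ha
      rw [← ((mulTraceForm K Δ).dualBasis hnd b).sum_repr a]
      refine sum_mem fun i _ => ?_
      rw [LinearMap.BilinForm.dualBasis_repr_apply]
      obtain ⟨r, hr⟩ := (h2 a).mp ha _ (hb i)
      rw [← hr, ← hsmul]
      exact Submodule.smul_mem _ _ (Submodule.subset_span ⟨i, rfl⟩)
    have : IsNoetherian A (Submodule.span A (Set.range ((mulTraceForm K Δ).dualBasis hnd b))) :=
      isNoetherian_span_of_finite A (Set.finite_range _)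
    exact (isNoetherian_submodule.mp this) M hle
  have : Module.Finite A M := Module.Finite.iff_fg.mpr hfg
  have : FaithfulSMul A K := inferInstance
  have : Module.IsTorsionFree A Δ := Module.IsTorsionFree.trans_faithfulSMul A K Δ
  have : Module.Free A M := inferInstance
  let c := Module.Free.chooseBasis A M
  have hli : LinearIndependent K (fun i => (c i : Δ)) := by
    rw [← LinearIndependent.iff_fractionRing A K]
    exact c.linearIndependent.map' M.subtype (Submodule.ker_subtype M)
  have hmemspan : ∀ a ∈ M, a ∈ Submodule.span K (Set.range fun i => (c i : Δ)) := by
    intro a ha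
    have := congrArg M.subtype (c.sum_repr ⟨a, ha⟩)
    rw [map_sum] at this
    rw [← show M.subtype ⟨a, ha⟩ = a from rfl, ← this]
    refine sum_mem fun i _ => ?_
    rw [map_smul, hsmul]
    exact Submodule.smul_mem _ _ (Submodule.subset_span ⟨i, rfl⟩)
  have hsp : ⊤ ≤ Submodule.span K (Set.range fun i => (c i : Δ)) := by
    rw [← b.span_eq, Submodule.span_le]
    rintro _ ⟨i, rfl⟩
    exact hmemspan _ (hb i)
  let e₀ := Module.Basis.mk hli hsp
  have hcard : Fintype.card (Module.Free.ChooseBasisIndex A M) = Module.finrank K Δ :=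
    (Module.finrank_eq_card_basis e₀).symm
  let σ := Fintype.equivFinOfCardEq hcard
  let e := e₀.reindex σ
  have heM : ∀ i, e i ∈ M := fun i => by
    rw [Module.Basis.reindex_apply, Module.Basis.mk_apply]; exact (c _).2
  have hmem : ∀ a, a ∈ L ↔ ∀ i, e.repr a i ∈ (algebraMap A K).range := by
    intro a
    constructor
    · intro ha i
      have h3 : a = ∑ j, algebraMap A K (c.repr ⟨a, ha⟩ (σ.symm j)) • e j := by
        have := congrArg M.subtype (c.sum_repr ⟨a, ha⟩)
        rw [map_sum] at this
        rw [← σ.symm.sum_comp] at this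
        refine this.symm.trans (Finset.sum_congr rfl fun j _ => ?_)
        rw [map_smul, hsmul, Module.Basis.reindex_apply, Module.Basis.mk_apply]
        rfl
      rw [h3, Module.Basis.repr_sum_self]
      exact ⟨_, rfl⟩
    · intro h
      rw [← hM, ← e.sum_repr a]
      refine sum_mem fun i _ => ?_
      obtain ⟨r, hr⟩ := h i
      rw [← hr, ← hsmul]
      exact M.smul_mem _ (heM i)
  refine ⟨e, hmem, ?_⟩
  have hdual : ∀ i, (mulTraceForm K Δ).dualBasis hnd e i ∈ L := by
    intro i
    rw [h2]
    intro a ha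
    rw [← e.sum_repr a, map_sum]
    refine sum_mem fun j _ => ?_
    rw [map_smul, smul_eq_mul, LinearMap.BilinForm.apply_dualBasis_left]
    refine mul_mem ((hmem a).mp ha j) ?_
    split_ifs
    exacts [one_mem _, zero_mem _]
  choose G hG using fun i j => (h2 _).mp (heM i) _ (heM j)
  choose H hH using fun i j => (hmem _).mp (hdual i) j
  have hprod : (Matrix.of H * Matrix.of G) = 1 := by
    apply Matrix.map_injective (FaithfulSMul.algebraMap_injective A K)
    ext i j
    change algebraMap A K ((Matrix.of H * Matrix.of G) i j) =
      algebraMap A K ((1 : Matrix _ _ A) i j)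
    rw [Matrix.mul_apply, map_sum]
    simp only [Matrix.of_apply, map_mul, hG, hH]
    have h5 := LinearMap.BilinForm.apply_dualBasis_left (B := mulTraceForm K Δ) (hB := hnd) (b := e)
      (i := i) (j := j)
    rw [← e.sum_repr ((mulTraceForm K Δ).dualBasis hnd e i), map_sum, LinearMap.sum_apply] at h5
    simp only [map_smul, LinearMap.smul_apply, smul_eq_mul] at h5
    rw [h5, Matrix.one_apply]
    simp only [eq_comm (a := i) (b := j)]
    split_ifs <;> simp
  refine ⟨(Matrix.of G).det, ?_, ?_⟩
  · have := congrArg Matrix.det hprod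
    rw [Matrix.det_mul, Matrix.det_one] at this
    exact IsUnit.of_mul_eq_one_right _ this
  · rw [RingHom.map_det]
    congr 1
    ext i j
    rw [LinearMap.BilinForm.toMatrix_apply, ← hG]; rfl
end

section
open IsDedekindDomain WithZero
variable {K Δ A : Type*} [Field K] [DivisionRing Δ] [Algebra K Δ] [CommRing A]
  [IsDedekindDomain A] [Algebra A K] [IsFractionRing A K]

theorem exists_algebraMap_smul_mem {v : HeightOneSpectrum A} {Λ : Subring Δ}
    (h : IsSelfDualOrder (v.valuation K).valuationSubring Λ) (a : Δ) :
    ∃ f : A, f ≠ 0 ∧ algebraMap A K f • a ∈ Λ := by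
  obtain ⟨c, hc, hca⟩ := h.exists_smul_mem a
  obtain ⟨x, y, hy, rfl⟩ := IsFractionRing.div_surjective (A := A) c
  have hy0 : algebraMap A K y ≠ 0 := by
    rw [Ne, FaithfulSMul.algebraMap_eq_zero_iff]; exact nonZeroDivisors.ne_zero hy
  refine ⟨x, ?_, ?_⟩
  · rintro rfl; simp at hc
  · have := h.smul_mem (algebraMap A K y)
      ((Valuation.mem_valuationSubring_iff _ _).mpr (v.valuation_le_one y)) _ hca
    rwa [smul_smul, mul_div_cancel₀ _ hy0] at this

theorem exists_algebraMap_smul_mem_of_ne {v p : HeightOneSpectrum A} (hvp : v ≠ p) {Λ : Subring Δ}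
    (h : IsSelfDualOrder (v.valuation K).valuationSubring Λ) (a : Δ) :
    ∃ f : A, f ∉ p.asIdeal ∧ algebraMap A K f • a ∈ Λ := by
  obtain ⟨x, hx0, hx⟩ := exists_algebraMap_smul_mem h a
  set n := (Associates.mk v.asIdeal).count (Associates.mk (Ideal.span {x} : Ideal A)).factors
  have hn : v.intValuation x = exp (-(n : ℤ)) := v.intValuation_if_neg hx0
  have hnot : ¬ (v.asIdeal ^ n ≤ p.asIdeal) := by
    intro hle
    have h1 : v.asIdeal ≤ p.asIdeal := p.isPrime.le_of_pow_le hle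
    exact hvp (HeightOneSpectrum.ext (v.isMaximal.eq_of_le p.isPrime.ne_top h1))
  obtain ⟨f, hf, hfp⟩ := SetLike.not_le_iff_exists.mp hnot
  refine ⟨f, hfp, ?_⟩
  have hxK : algebraMap A K x ≠ 0 := by rwa [Ne, FaithfulSMul.algebraMap_eq_zero_iff]
  have hmem : algebraMap A K f / algebraMap A K x ∈ (v.valuation K).valuationSubring := by
    rw [Valuation.mem_valuationSubring_iff, map_div₀, HeightOneSpectrum.valuation_of_algebraMap,
      HeightOneSpectrum.valuation_of_algebraMap, hn]
    exact div_le_one_of_le₀ ((v.intValuation_le_pow_iff_mem f n).mpr hf) zero_le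
  have := h.smul_mem _ hmem _ hx
  rwa [smul_smul, div_mul_cancel₀ _ hxK] at this

theorem finite_setOf_notMem {ι : Type*} [Fintype ι] (b : Module.Basis ι K Δ)
    {Λ : HeightOneSpectrum A → Subring Δ}
    (h : ∀ v, IsSelfDualOrder (v.valuation K).valuationSubring (Λ v))
    (hb : ∀ i, {v | b i ∉ Λ v}.Finite) (a : Δ) : {v | a ∉ Λ v}.Finite := by
  refine Set.Finite.subset ((Set.finite_iUnion hb).union
    (Set.finite_iUnion fun i => HeightOneSpectrum.Support.finite A (b.repr a i))) fun v hv => ?_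
  by_contra hcon
  simp only [Set.mem_union, Set.mem_iUnion, not_or, not_exists, HeightOneSpectrum.Support,
    Set.mem_ofPred_eq, not_not, not_lt] at hcon
  refine hv ?_
  rw [← b.sum_repr a]
  exact sum_mem fun i _ => (h v).smul_mem _
    ((Valuation.mem_valuationSubring_iff _ _).mpr (hcon.2 i)) _ (hcon.1 i)

theorem exists_algebraMap_smul_mem_forall {Λ : HeightOneSpectrum A → Subring Δ}
    (h : ∀ v, IsSelfDualOrder (v.valuation K).valuationSubring (Λ v)) {a : Δ}
    (ha : {v | a ∉ Λ v}.Finite) (T : Submonoid A)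
    (hT : ∀ v, a ∉ Λ v → ∃ f ∈ T, algebraMap A K f • a ∈ Λ v) :
    ∃ f ∈ T, ∀ v, algebraMap A K f • a ∈ Λ v := by
  classical
  choose! f hfT hf using hT
  refine ⟨∏ v ∈ ha.toFinset, f v, prod_mem fun v hv => hfT v (by simpa using hv), fun v => ?_⟩
  have hintg : ∀ r : A, algebraMap A K r ∈ (v.valuation K).valuationSubring := fun r =>
    (Valuation.mem_valuationSubring_iff _ _).mpr (v.valuation_le_one r)
  by_cases hv : a ∈ Λ v
  · exact (h v).smul_mem _ (hintg _) _ hv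
  · rw [← Finset.prod_erase_mul _ _ (show v ∈ ha.toFinset by simpa using hv), map_mul, mul_smul]
    exact (h v).smul_mem _ (hintg _) _ (hf v hv)

theorem selfDual_of_forall_isSelfDualOrder {Λ : HeightOneSpectrum A → Subring Δ}
    (h : ∀ v, IsSelfDualOrder (v.valuation K).valuationSubring (Λ v))
    (hfin : ∀ a, {v | a ∉ Λ v}.Finite) :
    (∀ a, ∃ f : A, f ≠ 0 ∧ ∀ v, algebraMap A K f • a ∈ Λ v) ∧
    (∀ a, (∀ v, a ∈ Λ v) ↔
      ∀ b, (∀ v, b ∈ Λ v) → mulTraceForm K Δ a b ∈ (algebraMap A K).range) := by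
  refine ⟨fun a => ?_, fun a => ⟨fun ha b hb => ?_, fun H p => ?_⟩⟩
  · obtain ⟨f, hf, hfa⟩ := exists_algebraMap_smul_mem_forall h (hfin a) (nonZeroDivisors A)
      fun v _ => by
        obtain ⟨f, hf0, hf⟩ := exists_algebraMap_smul_mem (h v) a
        exact ⟨f, mem_nonZeroDivisors_of_ne_zero hf0, hf⟩
    exact ⟨f, nonZeroDivisors.ne_zero hf, hfa⟩
  · refine HeightOneSpectrum.mem_integers_of_valuation_le_one K _ fun v => ?_
    exact (Valuation.mem_valuationSubring_iff _ _).mp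
      ((isSelfDualOrder_iff_mulTraceForm_mem (h v) a).mp (ha v) b (hb v))
  · rw [isSelfDualOrder_iff_mulTraceForm_mem (h p)]
    intro b hb
    have := p.isPrime
    obtain ⟨f, hf, hfb⟩ := exists_algebraMap_smul_mem_forall h (hfin b) p.asIdeal.primeCompl
      fun v hv => exists_algebraMap_smul_mem_of_ne (by rintro rfl; exact hv hb) (h v) b
    obtain ⟨r, hr⟩ := H _ hfb
    rw [map_smul, smul_eq_mul] at hr
    have h1 : p.valuation K (algebraMap A K f) = 1 :=
      (HeightOneSpectrum.valuation_eq_one_iff_notMem p).mpr hf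
    have h2 : p.valuation K (algebraMap A K r) ≤ 1 := p.valuation_le_one r
    rw [hr, map_mul, h1, one_mul] at h2
    exact (Valuation.mem_valuationSubring_iff _ _).mpr h2

theorem exists_globally_selfDual [FiniteDimensional K Δ] (hN : (Module.finrank K Δ : K) ≠ 0)
    (hloc : ∀ v : HeightOneSpectrum A,
      ∃ Λ : Subring Δ, IsSelfDualOrder (v.valuation K).valuationSubring Λ) :
    ∃ L : Subring Δ,
      (∀ a, ∃ f : A, f ≠ 0 ∧ algebraMap A K f • a ∈ L) ∧
      (∀ a, a ∈ L ↔ ∀ b ∈ L, mulTraceForm K Δ a b ∈ (algebraMap A K).range) := by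
  classical
  let b := Module.finBasis K Δ
  let b' := (mulTraceForm K Δ).dualBasis (mulTraceForm_nondegenerate hN) b
  have hex : ∀ v : HeightOneSpectrum A, ∃ Λ : Subring Δ,
      IsSelfDualOrder (v.valuation K).valuationSubring Λ ∧
      (((∀ i, b.repr 1 i ∈ (v.valuation K).valuationSubring) ∧
        (∀ i j l, b.repr (b i * b j) l ∈ (v.valuation K).valuationSubring) ∧
        (∀ i j, mulTraceForm K Δ (b i) (b j) ∈ (v.valuation K).valuationSubring) ∧
        (∀ i j, b.repr (b' i) j ∈ (v.valuation K).valuationSubring)) → ∀ i, b i ∈ Λ) := by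
    intro v
    by_cases hv : ((∀ i, b.repr 1 i ∈ (v.valuation K).valuationSubring) ∧
        (∀ i j l, b.repr (b i * b j) l ∈ (v.valuation K).valuationSubring) ∧
        (∀ i j, mulTraceForm K Δ (b i) (b j) ∈ (v.valuation K).valuationSubring) ∧
        (∀ i j, b.repr (b' i) j ∈ (v.valuation K).valuationSubring))
    · obtain ⟨Λ, h1, h2⟩ := exists_isSelfDualOrder_of_repr_mem hN b _ hv.1 hv.2.1 hv.2.2.1 hv.2.2.2
      exact ⟨Λ, h1, fun _ => h2⟩
    · obtain ⟨Λ, h1⟩ := hloc v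
      exact ⟨Λ, h1, fun h => absurd h hv⟩
  choose Λ hΛ hΛb using hex
  have hS := HeightOneSpectrum.Support.finite A (K := K)
  have hbfin : ∀ i, {v | b i ∉ Λ v}.Finite := by
    intro i
    refine Set.Finite.subset ((Set.finite_iUnion fun i => hS (b.repr 1 i)).union
      ((Set.finite_iUnion fun i => Set.finite_iUnion fun j => Set.finite_iUnion fun l =>
          hS (b.repr (b i * b j) l)).union
        ((Set.finite_iUnion fun i => Set.finite_iUnion fun j =>
          hS (mulTraceForm K Δ (b i) (b j))).union
        (Set.finite_iUnion fun i => Set.finite_iUnion fun j =>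
          hS (b.repr (b' i) j))))) fun v hv => ?_
    by_contra hcon
    simp only [Set.mem_union, Set.mem_iUnion, not_or, not_exists, HeightOneSpectrum.Support,
      Set.mem_ofPred_eq, not_lt] at hcon
    exact hv (hΛb v hcon i)
  obtain ⟨h1, h2⟩ := selfDual_of_forall_isSelfDualOrder hΛ (finite_setOf_notMem b hΛ hbfin)
  refine ⟨⨅ v, Λ v, ?_, ?_⟩
  · simpa only [Subring.mem_iInf] using h1
  · simpa only [Subring.mem_iInf] using h2
end

section
open Polynomial
open WithZero
variable {k K : Type*} [Field k] [Field K] [Algebra k[X] K] [IsFractionRing k[X] K] [Algebra k K]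
  [IsScalarTower k k[X] K]

omit [Algebra k K] [IsScalarTower k k[X] K] in
theorem exists_valuation_infty : ∃ v : Valuation K ℤᵐ⁰,
    ∀ p : k[X], p ≠ 0 → v (algebraMap k[X] K p) = exp (p.natDegree : ℤ) := by
  classical
  let φ : K ≃ₐ[k[X]] RatFunc k := IsLocalization.algEquiv (nonZeroDivisors k[X]) K (RatFunc k)
  refine ⟨(RatFunc.inftyValuation k).comap (φ : K →+* RatFunc k), fun p hp => ?_⟩
  rw [Valuation.comap_apply]
  have h : (φ : K →+* RatFunc k) (algebraMap k[X] K p) = algebraMap k[X] (RatFunc k) p :=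
    φ.commutes p
  rw [h]
  exact RatFunc.inftyValuation.polynomial k hp

/-- The place at infinity of a rational function field. -/
theorem exists_valuationSubring_infty : ∃ O : ValuationSubring K, IsDiscreteValuationRing O ∧
    (∀ c : k, algebraMap k K c ∈ O) ∧
    (∀ (p : k[X]) (c : ℕ), (algebraMap k[X] K X)⁻¹ ^ c * algebraMap k[X] K p ∈ O ↔
      p.natDegree ≤ c) ∧
    (∀ f ∈ O, ∃ (c : k) (g : K), g ∈ O ∧ f = algebraMap k K c + (algebraMap k[X] K X)⁻¹ * g) := by
  obtain ⟨v, hv⟩ := exists_valuation_infty (k := k) (K := K)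
  have hinj := FaithfulSMul.algebraMap_injective k[X] K
  have hX : v (algebraMap k[X] K X) = exp 1 := by rw [hv X X_ne_zero, natDegree_X]; rfl
  have hX0 : algebraMap k[X] K X ≠ 0 := by
    rw [Ne, FaithfulSMul.algebraMap_eq_zero_iff]; exact X_ne_zero
  have hnt : v.IsNontrivial := ⟨⟨algebraMap k[X] K X, by rw [hX]; simp, by rw [hX]; decide⟩⟩
  have hk : ∀ c : k, v (algebraMap k K c) ≤ 1 := by
    intro c
    rw [IsScalarTower.algebraMap_apply k k[X] K, Polynomial.algebraMap_apply,
            Algebra.algebraMap_self_apply]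
    by_cases hc : c = 0
    · simp [hc]
    · rw [hv _ (C_ne_zero.mpr hc), natDegree_C]; simp
  refine ⟨v.valuationSubring, inferInstance, hk, fun p c => ?_, fun f hf => ?_⟩
  · rw [Valuation.mem_valuationSubring_iff, map_mul, map_pow, map_inv₀, hX]
    by_cases hp : p = 0
    · simp [hp]
    · rw [hv p hp, ← exp_neg, ← exp_nsmul, ← exp_add, ← exp_zero, exp_le_exp]
      simp
  · rw [Valuation.mem_valuationSubring_iff] at hf
    obtain ⟨p, q, hq, rfl⟩ := IsFractionRing.div_surjective (A := k[X]) f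
    replace hq := nonZeroDivisors.ne_zero hq
    have hqK : algebraMap k[X] K q ≠ 0 := by rwa [Ne, FaithfulSMul.algebraMap_eq_zero_iff]
    have hpq : p.natDegree ≤ q.natDegree := by
      by_cases hp : p = 0
      · simp [hp]
      · rw [map_div₀, hv p hp, hv q hq, ← exp_sub, ← exp_zero, exp_le_exp] at hf
        omega
    set c := p.coeff q.natDegree / q.leadingCoeff with hc
    refine ⟨c, algebraMap k[X] K X * (algebraMap k[X] K p / algebraMap k[X] K q -
      algebraMap k K c), ?_, ?_⟩
    · have h1 : algebraMap k[X] K p / algebraMap k[X] K q - algebraMap k K c =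
          algebraMap k[X] K (p - C c * q) / algebraMap k[X] K q := by
        rw [map_sub, map_mul, sub_div, mul_div_cancel_right₀ _ hqK,
          IsScalarTower.algebraMap_apply k k[X] K, Polynomial.algebraMap_apply,
            Algebra.algebraMap_self_apply]
      rw [Valuation.mem_valuationSubring_iff, h1]
      by_cases h0 : p - C c * q = 0
      · simp [h0]
      · rw [map_mul, map_div₀, hX, hv _ h0, hv _ hq, ← exp_sub, ← exp_add, ← exp_zero, exp_le_exp]
        have hle : (p - C c * q).natDegree ≤ q.natDegree :=
          (natDegree_sub_le _ _).trans (max_le hpq (natDegree_C_mul_le _ _))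
        have hne : (p - C c * q).natDegree ≠ q.natDegree := by
          intro h
          have : (p - C c * q).coeff (p - C c * q).natDegree = 0 := by
            rw [h, coeff_sub, coeff_C_mul, coeff_natDegree, hc,
              div_mul_cancel₀ _ (leadingCoeff_ne_zero.mpr hq), sub_self]
          rw [coeff_natDegree, leadingCoeff_eq_zero] at this
          exact h0 this
        omega
    · rw [inv_mul_cancel_left₀ hX0]; ring
end

section
open Polynomial

theorem IsFiniteLength.finrank_le_length {k O V : Type*} [Field k] [CommRing O] [IsLocalRing O]
    [Algebra k O] {t : O} (ht : t ∈ IsLocalRing.maximalIdeal O)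
    (hO : ∀ f : O, ∃ (c : k) (g : O), f = algebraMap k O c + t * g)
    [AddCommGroup V] [Module O V] (h : IsFiniteLength O V) :
    ∀ [Module k V] [IsScalarTower k O V],
      Module.Finite k V ∧ (Module.finrank k V : ℕ∞) ≤ Module.length O V := by
  induction h with
  | of_subsingleton =>
    intro _ _
    exact ⟨inferInstance, by simp [Module.finrank_zero_of_subsingleton]⟩
  | @of_simple_quotient M _ _ N hs hN ih =>
    intro _ _
    obtain ⟨hf, hl⟩ := ih
    have hQ : ∃ x : M ⧸ N, ∀ y : M ⧸ N, ∃ c : k, c • x = y := by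
      have := IsSimpleModule.nontrivial O (M ⧸ N)
      obtain ⟨x, hx⟩ := exists_ne (0 : M ⧸ N)
      refine ⟨x, fun y => ?_⟩
      have ht0 : ∀ z : M ⧸ N, t • z = 0 := by
        intro z
        by_contra hz
        obtain ⟨r, hr⟩ := IsSimpleModule.toSpanSingleton_surjective O hz z
        rw [LinearMap.toSpanSingleton_apply, smul_smul] at hr
        have hu : IsUnit (1 - r * t) := by
          by_contra hu
          refine (Ideal.ne_top_iff_one _).mp (IsLocalRing.maximalIdeal.isMaximal O).ne_top ?_
          have := add_mem ((IsLocalRing.mem_maximalIdeal (1 - r * t)).mpr hu)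
            (Ideal.mul_mem_left _ r ht)
          rwa [sub_add_cancel] at this
        have h0 : (1 - r * t) • z = 0 := by rw [sub_smul, one_smul, hr, sub_self]
        rw [hu.smul_eq_zero] at h0
        exact hz (by rw [h0, smul_zero])
      obtain ⟨r, hr⟩ := IsSimpleModule.toSpanSingleton_surjective O hx y
      obtain ⟨c, g, rfl⟩ := hO r
      refine ⟨c, ?_⟩
      rw [LinearMap.toSpanSingleton_apply, add_smul, mul_smul, ht0, add_zero, algebraMap_smul] at hr
      exact hr
    obtain ⟨x, hx⟩ := hQ
    let N' : Submodule k M := N.restrictScalars k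
    have hfN : Module.Finite k N' := hf
    have hfQ : Module.Finite k (M ⧸ N') := by
      refine Module.Finite.of_surjective (LinearMap.toSpanSingleton k (M ⧸ N') x) ?_
      intro y
      obtain ⟨c, hc⟩ := hx y
      exact ⟨c, hc⟩
    have h1 : Module.finrank k (M ⧸ N') ≤ 1 :=
      finrank_le_one (x : M ⧸ N') fun y => hx y
    have hfM : Module.Finite k M := Module.Finite.of_submodule_quotient N'
    refine ⟨hfM, ?_⟩
    have h2 := Submodule.finrank_quotient_add_finrank N'
    have h3 := Module.length_eq_add_of_exact N.subtype N.mkQ N.subtype_injective N.mkQ_surjective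
      (LinearMap.exact_subtype_mkQ N)
    rw [h3, Module.length_eq_one O (M ⧸ N), ← h2, add_comm, Nat.cast_add]
    exact add_le_add hl (by exact_mod_cast h1)

end

section
open Polynomial
variable {k K Δ : Type*} [Field k] [Field K] [Algebra k[X] K] [IsFractionRing k[X] K] [Algebra k K]
  [IsScalarTower k k[X] K] [DivisionRing Δ] [Algebra K Δ] [Algebra k Δ] [IsScalarTower k K Δ]

omit [Algebra k K] [IsScalarTower k k[X] K] in
theorem exists_pow_mul_mem_of_infty {O : ValuationSubring K}
    (hpoly : ∀ (p : k[X]) (c : ℕ), (algebraMap k[X] K X)⁻¹ ^ c * algebraMap k[X] K p ∈ O ↔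
      p.natDegree ≤ c) (z : K) : ∃ c : ℕ, (algebraMap k[X] K X)⁻¹ ^ c * z ∈ O := by
  obtain ⟨p, q, hq, rfl⟩ := IsFractionRing.div_surjective (A := k[X]) z
  have hq' : (algebraMap k[X] K q)⁻¹ ∈ O := by
    rcases O.mem_or_inv_mem (algebraMap k[X] K q) with h | h
    · have h0 := (hpoly q 0).mp (by rwa [pow_zero, one_mul])
      obtain ⟨a, ha⟩ := natDegree_eq_zero.mp (Nat.le_zero.mp h0)
      have hq0 := nonZeroDivisors.ne_zero hq
      have ha0 : a ≠ 0 := by rintro rfl; simp at ha; exact hq0 ha.symm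
      have h1 : (algebraMap k[X] K q)⁻¹ = algebraMap k[X] K (C a⁻¹) := by
        rw [inv_eq_iff_eq_inv, eq_comm, inv_eq_iff_eq_inv, eq_comm]
        refine inv_eq_of_mul_eq_one_right ?_
        rw [← map_mul, ← ha, ← C_mul, mul_inv_cancel₀ ha0, C_1, map_one]
      rw [h1]
      simpa using (hpoly (C a⁻¹) 0).mpr (by simp)
    · exact h
  refine ⟨p.natDegree, ?_⟩
  rw [div_eq_mul_inv, ← mul_assoc]
  exact mul_mem ((hpoly p _).mpr le_rfl) hq'

theorem le_finrank_of_infty {O : ValuationSubring K} [IsDiscreteValuationRing O]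
    (hk : ∀ c : k, algebraMap k K c ∈ O)
    (hpoly : ∀ (p : k[X]) (c : ℕ), (algebraMap k[X] K X)⁻¹ ^ c * algebraMap k[X] K p ∈ O ↔
      p.natDegree ≤ c)
    (hres : ∀ f ∈ O, ∃ (c : k) (g : K), g ∈ O ∧
      f = algebraMap k K c + (algebraMap k[X] K X)⁻¹ * g)
    {N : ℕ} (e w : Module.Basis (Fin N) K Δ) {u : O} (hu : IsUnit u)
    (hdet : (e.toMatrix w).det = u) (M : Submodule k Δ)
    (hM : ∀ a, a ∈ M ↔ (∀ i, e.repr a i ∈ (algebraMap k[X] K).range) ∧ ∀ i, w.repr a i ∈ O) :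
    Module.Finite k M ∧ N ≤ Module.finrank k M := by
  classical
  have hinj := FaithfulSMul.algebraMap_injective k[X] K
  have hsm : ∀ (r : k) (p : k[X]), algebraMap k[X] K (r • p) = r • algebraMap k[X] K p :=
    fun r p => by
      rw [Algebra.smul_def, Algebra.smul_def, map_mul, ← IsScalarTower.algebraMap_apply]
  set x := algebraMap k[X] K X with hx
  have hx0 : x ≠ 0 := by
    rw [Ne, hx, FaithfulSMul.algebraMap_eq_zero_iff]; exact X_ne_zero
  have hxO : x ∉ O := fun h => by
    have := (hpoly X 0).mp (by rwa [pow_zero, one_mul])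
    simp at this
  have htO : x⁻¹ ∈ O := (O.mem_or_inv_mem x).resolve_left hxO
  let _ : Algebra k O := ((algebraMap k K).codRestrict O.toSubring hk).toAlgebra
  have hkO : ∀ c : k, ((algebraMap k O c : O) : K) = algebraMap k K c := fun c => rfl
  let t : O := ⟨x⁻¹, htO⟩
  have htmem : t ∈ IsLocalRing.maximalIdeal O := by
    rw [IsLocalRing.mem_maximalIdeal]
    intro h
    obtain ⟨s, hs⟩ := h.exists_right_inv
    have := congrArg (Subtype.val) hs
    change x⁻¹ * (s : K) = 1 at this
    rw [inv_mul_eq_one₀ hx0] at this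
    exact hxO (this ▸ s.2)
  have hres' : ∀ f : O, ∃ (c : k) (g : O), f = algebraMap k O c + t * g := by
    intro f
    obtain ⟨c, g, hg, h⟩ := hres f f.2
    exact ⟨c, ⟨g, hg⟩, Subtype.ext h⟩
  have htirr : Irreducible t := by
    rw [IsDiscreteValuationRing.irreducible_iff_uniformizer]
    refine le_antisymm (fun f hf => ?_) (by rwa [Ideal.span_singleton_le_iff_mem])
    obtain ⟨c, g, rfl⟩ := hres' f
    have hc : c = 0 := by
      by_contra hc
      have h1 := (Ideal.add_mem_iff_left _ (Ideal.mul_mem_right g _ htmem)).mp hf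
      exact (IsLocalRing.mem_maximalIdeal _).mp h1 ((IsUnit.mk0 c hc).map (algebraMap k O))
    rw [hc, map_zero, zero_add]
    exact Ideal.mem_span_singleton.mpr ⟨g, rfl⟩
  obtain ⟨c, hc⟩ : ∃ c : ℕ, ∀ i j, x⁻¹ ^ c * e.toMatrix w i j ∈ O := by
    choose c hc using fun ij : Fin N × Fin N =>
      exists_pow_mul_mem_of_infty hpoly (e.toMatrix w ij.1 ij.2)
    obtain ⟨m, hm⟩ := Finite.exists_le c
    refine ⟨m, fun i j => ?_⟩
    rw [← Nat.sub_add_cancel (hm (i, j)), pow_add, mul_assoc]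
    exact mul_mem (pow_mem htO _) (hc (i, j))
  let G : Matrix (Fin N) (Fin N) O := Matrix.of fun i j => ⟨_, hc i j⟩
  have hG : ∀ i j, ((G i j : O) : K) = x⁻¹ ^ c * e.toMatrix w i j := fun i j => rfl
  have hGdet : G.det = t ^ (N * c) * u := by
    apply FaithfulSMul.algebraMap_injective O K
    rw [RingHom.map_det]
    have h1 : (algebraMap O K).mapMatrix G = x⁻¹ ^ c • e.toMatrix w := by
      ext i j; rfl
    rw [h1, Matrix.det_smul, hdet, Fintype.card_fin, map_mul, map_pow, ← pow_mul, mul_comm c N]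
    rfl
  have hlen := Module.length_quotient_range_eq_of_det (Matrix.toLin' G) htirr (m := N * c) (by
    rw [LinearMap.det_toLin', hGdet]
    exact associated_mul_unit_left _ _ hu)
  set Q := (Fin N → O) ⧸ LinearMap.range (Matrix.toLin' G) with hQ
  have hfl : IsFiniteLength O Q := by
    rw [← Module.length_ne_top_iff, hlen]; exact ENat.natCast_ne_top _
  obtain ⟨hQf, hQr⟩ := IsFiniteLength.finrank_le_length (k := k) htmem hres' hfl
  rw [hlen] at hQr
  replace hQr : Module.finrank k Q ≤ N * c := by exact_mod_cast hQr
  let V := Fin N → degreeLT k (c + 1)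
  have hVr : Module.finrank k V = N * (c + 1) := by
    rw [Module.finrank_pi_fintype]
    simp [(degreeLTEquiv k (c + 1)).finrank_eq]
  have hVf : Module.Finite k V := by
    have : Module.Finite k (degreeLT k (c + 1)) :=
      Module.Finite.equiv (degreeLTEquiv k (c + 1)).symm
    infer_instance
  have hdeg : ∀ p : degreeLT k (c + 1), (p : k[X]).natDegree ≤ c := fun p => by
    have := mem_degreeLT.mp p.2
    exact natDegree_le_iff_coeff_eq_zero.mpr fun m hm => coeff_eq_zero_of_degree_lt
      (this.trans_le (by exact_mod_cast hm))
  obtain ⟨Ψ, hΨ⟩ : ∃ Ψ : V →ₗ[k] Δ, ∀ p, Ψ p = ∑ i, algebraMap k[X] K (p i) • e i :=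
    ⟨{ toFun := fun p => ∑ i, algebraMap k[X] K (p i) • e i
       map_add' := fun p q => by
        rw [← Finset.sum_add_distrib]
        exact Finset.sum_congr rfl fun i _ => by rw [← add_smul, ← map_add]; rfl
       map_smul' := fun r p => by
        rw [RingHom.id_apply, Finset.smul_sum]
        refine Finset.sum_congr rfl fun i _ => ?_
        rw [← smul_assoc]
        congr 1
        exact hsm r (p i : k[X]) }, fun _ => rfl⟩
  have hΨrepr : ∀ p i, e.repr (Ψ p) i = algebraMap k[X] K (p i) := fun p i => by
    rw [hΨ, Module.Basis.repr_sum_self]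
  have hΨinj : Function.Injective Ψ := by
    intro p q hpq
    ext1 i
    apply Subtype.ext
    apply hinj
    rw [← hΨrepr, ← hΨrepr, hpq]
  obtain ⟨χ, hχ⟩ : ∃ χ : V →ₗ[k] Q, ∀ p, χ p = 0 ↔ ∃ f : Fin N → O, ∀ i,
      ((Matrix.toLin' G f i : O) : K) = x⁻¹ ^ c * algebraMap k[X] K (p i) := by
    let χ₀ : V →ₗ[k] (Fin N → O) :=
      { toFun := fun p i => ⟨_, (hpoly (p i) c).mpr (hdeg (p i))⟩
        map_add' := fun p q => by
          funext i
          apply Subtype.ext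
          change _ * algebraMap k[X] K ((p i : k[X]) + q i) = _ * _ + _ * _
          rw [map_add, mul_add]
        map_smul' := fun r p => by
          funext i
          apply Subtype.ext
          change _ * algebraMap k[X] K (r • (p i : k[X])) =
            ((r • (⟨_, (hpoly (p i) c).mpr (hdeg (p i))⟩ : O) : O) : K)
          rw [Algebra.smul_def r (_ : O)]
          change _ = algebraMap k K r * _
          rw [hsm, Algebra.smul_def, mul_left_comm] }
    refine ⟨((LinearMap.range (Matrix.toLin' G)).mkQ.restrictScalars k).comp χ₀, fun p => ?_⟩
    rw [LinearMap.comp_apply, LinearMap.restrictScalars_apply, Submodule.mkQ_apply,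
      Submodule.Quotient.mk_eq_zero, LinearMap.mem_range]
    constructor
    · rintro ⟨f, hf⟩
      exact ⟨f, fun i => congrArg Subtype.val (congrFun hf i)⟩
    · rintro ⟨f, hf⟩
      exact ⟨f, funext fun i => Subtype.ext (hf i)⟩
  have hcoe : ∀ (f : Fin N → O) (i), ((Matrix.toLin' G f i : O) : K) =
      x⁻¹ ^ c * e.repr (∑ j, (f j : K) • w j) i := by
    intro f i
    rw [Matrix.toLin'_apply, Matrix.mulVec, dotProduct]
    change algebraMap O K (∑ j, G i j * f j) = _
    rw [map_sum, map_sum, Finset.sum_apply', Finset.mul_sum]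
    refine Finset.sum_congr rfl fun j _ => ?_
    rw [map_mul, map_smul, Finsupp.smul_apply, smul_eq_mul, mul_left_comm, mul_comm (f j : K),
      ← mul_comm (e.repr (w j) i)]
    change (x⁻¹ ^ c * e.repr (w j) i) * (f j : K) = _
    ring
  have hxc : x⁻¹ ^ c ≠ 0 := pow_ne_zero _ (inv_ne_zero hx0)
  have hle : M ≤ LinearMap.range Ψ := by
    intro a ha
    obtain ⟨h1, h2⟩ := (hM a).mp ha
    choose p hp using h1
    have hp' : ∀ i, (p i).natDegree ≤ c := by
      intro i
      rw [← hpoly, hp]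
      have := hcoe (fun j => ⟨w.repr a j, h2 j⟩) i
      simp only [w.sum_repr] at this
      rw [← this]
      exact Subtype.mem _
    refine ⟨fun i => ⟨p i, ?_⟩, ?_⟩
    · rw [mem_degreeLT]
      exact lt_of_le_of_lt (degree_le_of_natDegree_le (hp' i))
        (by exact_mod_cast Nat.lt_succ_self c)
    · rw [hΨ]
      conv_rhs => rw [← e.sum_repr a]
      exact Finset.sum_congr rfl fun i _ => by rw [← hp]
  have hMf : Module.Finite k M := by
    have : Module.Finite k (LinearMap.range Ψ) := inferInstance
    exact Submodule.finiteDimensional_of_le hle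
  refine ⟨hMf, ?_⟩
  have hker : (LinearMap.ker χ).map Ψ ≤ M := by
    rintro _ ⟨p, hp, rfl⟩
    obtain ⟨f, hf⟩ := (hχ p).mp hp
    rw [hM]
    have : Ψ p = ∑ j, (f j : K) • w j := by
      apply e.repr.injective
      ext i
      rw [hΨrepr]
      have := hf i
      rw [hcoe] at this
      exact (mul_left_cancel₀ hxc this).symm
    refine ⟨fun i => ⟨p i, (hΨrepr p i).symm⟩, fun i => ?_⟩
    rw [this, Module.Basis.repr_sum_self]
    exact (f i).2
  have h1 := Submodule.finrank_mono hker
  rw [← (Submodule.equivMapOfInjective Ψ hΨinj (LinearMap.ker χ)).finrank_eq] at h1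
  have h2 := LinearMap.finrank_range_add_finrank_ker χ
  have h3 := Submodule.finrank_le (LinearMap.range χ)
  rw [hVr, mul_add, mul_one] at h2
  omega
end

section
open Polynomial
variable {k K Δ : Type*} [Field k] [Field K] [Algebra k[X] K] [IsFractionRing k[X] K] [Algebra k K]
  [IsScalarTower k k[X] K] [DivisionRing Δ] [Algebra K Δ] [Algebra k Δ] [IsScalarTower k K Δ]

theorem ValuationSubring.mem_of_sq_mem (O : ValuationSubring K) {z : K} (h : z ^ 2 ∈ O) :
    z ∈ O := by
  rcases O.mem_or_inv_mem z with h1 | h1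
  · exact h1
  · by_cases hz : z = 0
    · rw [hz]; exact ZeroMemClass.zero_mem _
    · have : z ^ 2 * z⁻¹ ∈ O := MulMemClass.mul_mem h h1
      rwa [pow_two, mul_inv_cancel_right₀ hz] at this

omit [IsFractionRing k[X] K] [Algebra k Δ] [IsScalarTower k K Δ] in
theorem exists_isUnit_det_eq {O : ValuationSubring K} (hk : ∀ c : k, algebraMap k K c ∈ O)
    {N : ℕ} (e w : Module.Basis (Fin N) K Δ) {d : k[X]} (hd : IsUnit d)
    (he : (LinearMap.BilinForm.toMatrix e (mulTraceForm K Δ)).det = algebraMap k[X] K d)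
    {d' : O} (hd' : IsUnit d')
    (hw : (LinearMap.BilinForm.toMatrix w (mulTraceForm K Δ)).det = algebraMap O K d') :
    ∃ u : O, IsUnit u ∧ (e.toMatrix w).det = u := by
  obtain ⟨a, ha, rfl⟩ := Polynomial.isUnit_iff.mp hd
  obtain ⟨b, hb⟩ := hd'.exists_right_inv
  have ha0 : algebraMap k K a ≠ 0 := by simpa using ha.ne_zero
  have hb' : (d' : K) * b = 1 := congrArg Subtype.val hb
  have h1 := LinearMap.BilinForm.toMatrix_mul_basis_toMatrix e w (mulTraceForm K Δ)
  have h2 := congrArg Matrix.det h1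
  rw [Matrix.det_mul, Matrix.det_mul, Matrix.det_transpose, he, hw,
    show algebraMap k[X] K (C a) = algebraMap k K a by
      rw [IsScalarTower.algebraMap_apply k k[X] K]; rfl,
    show algebraMap O K d' = (d' : K) from rfl] at h2
  set z := (e.toMatrix w).det with hz
  have hz2 : z ^ 2 = algebraMap k K a⁻¹ * d' := by
    rw [← h2, map_inv₀]; field_simp
  have hz0 : z ≠ 0 := by
    intro h0
    rw [h0] at h2
    rw [← h2] at hb'
    simp at hb'
  have hzO : z ∈ O := O.mem_of_sq_mem (by rw [hz2]; exact mul_mem (hk _) d'.2)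
  have hzO' : z⁻¹ ∈ O := O.mem_of_sq_mem (by
    have : z⁻¹ ^ 2 = algebraMap k K a * b := by
      rw [inv_pow, hz2, map_inv₀, mul_inv, inv_inv, inv_eq_of_mul_eq_one_right hb']
    rw [this]; exact mul_mem (hk _) b.2)
  exact ⟨⟨z, hzO⟩, IsUnit.of_mul_eq_one ⟨z⁻¹, hzO'⟩ (Subtype.ext (mul_inv_cancel₀ hz0)), rfl⟩
end

section
open Polynomial
variable {k K Δ : Type*} [Field k] [Field K] [Algebra k K]
  [DivisionRing Δ] [Algebra K Δ] [Algebra k Δ] [IsScalarTower k K Δ]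

theorem linearIndependent_of_residue {O : ValuationSubring K} {x : K} (hx0 : x ≠ 0) (hx : x ∉ O)
    (hres : ∀ f ∈ O, ∃ (c : k) (g : K), g ∈ O ∧ f = algebraMap k K c + x⁻¹ * g)
    {M : Submodule k Δ} {W : Subring Δ} (hW : ∀ c ∈ O, ∀ a ∈ W, c • a ∈ W) (hMW : ∀ a ∈ M, a ∈ W)
    (hM : ∀ a ∈ M, ∀ b ∈ W, a = x⁻¹ • b → a = 0)
    {ι : Type*} [Fintype ι] {s : ι → Δ} (hsM : ∀ i, s i ∈ M) (hs : LinearIndependent k s) :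
    LinearIndependent K s := by
  rw [Fintype.linearIndependent_iff] at hs ⊢
  intro c hc
  by_contra! hne
  obtain ⟨i₁, hi₁⟩ := hne
  obtain ⟨i₀, -, hmax⟩ := Finset.exists_max_image Finset.univ (fun i => O.valuation (c i))
    ⟨i₁, Finset.mem_univ _⟩
  have hc0 : c i₀ ≠ 0 := by
    intro h0
    have := hmax i₁ (Finset.mem_univ _)
    rw [h0, map_zero] at this
    exact hi₁ ((Valuation.zero_iff _).mp (le_antisymm this zero_le))
  have hf : ∀ i, c i / c i₀ ∈ O := by
    intro i
    rw [← O.valuation_le_one_iff, map_div₀]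
    exact div_le_one_of_le₀ (hmax i (Finset.mem_univ _)) zero_le
  choose a g hg hag using fun i => hres _ (hf i)
  have h0 : ∑ i, a i • s i = x⁻¹ • ∑ i, (-(g i)) • s i := by
    have h1 : ∑ i, (c i / c i₀) • s i = 0 := by
      have : ∑ i, (c i / c i₀) • s i = (c i₀)⁻¹ • ∑ i, c i • s i := by
        rw [Finset.smul_sum]
        exact Finset.sum_congr rfl fun i _ => by rw [smul_smul, div_eq_inv_mul]
      rw [this, hc, smul_zero]
    rw [Finset.smul_sum, ← sub_eq_zero, ← h1, ← Finset.sum_sub_distrib]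
    refine Finset.sum_congr rfl fun i _ => ?_
    rw [hag i, add_smul, algebraMap_smul, mul_smul, neg_smul, smul_neg, sub_neg_eq_add]
  have h2 : ∑ i, a i • s i = 0 := by
    refine hM _ (sum_mem fun i _ => M.smul_mem _ (hsM i)) _ (sum_mem fun i _ => ?_) h0
    exact hW _ (neg_mem (hg i)) _ (hMW _ (hsM i))
  have h3 := hs a h2 i₀
  have h4 := hag i₀
  rw [h3, div_self hc0, map_zero, zero_add, eq_comm, inv_mul_eq_one₀ hx0] at h4
  exact hx (h4 ▸ hg i₀)

omit [Algebra k K] [IsScalarTower k K Δ] in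
theorem eq_zero_of_mem_inv_smul [FiniteDimensional K Δ] {O : ValuationSubring K} {x : K}
    (hx0 : x ≠ 0) (hx : x ∉ O) (hN : ((Module.finrank K Δ : K))⁻¹ ∈ O)
    (hN0 : (Module.finrank K Δ : K) ≠ 0)
    {W : Subring Δ} (hW : IsSelfDualOrder O W) {M : Subalgebra k Δ} [Module.Finite k M]
    (hMW : ∀ a ∈ M, a ∈ W) (a : Δ) (ha : a ∈ M) (b : Δ) (hb : b ∈ W) (hab : a = x⁻¹ • b) :
    a = 0 := by
  by_contra ha0
  have hdom : IsDomain M := inferInstance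
  obtain ⟨y, hy⟩ := FiniteDimensional.exists_mul_eq_one k (x := (⟨a, ha⟩ : M))
    (fun h => ha0 (congrArg Subtype.val h))
  have hy' : a * (y : Δ) = 1 := congrArg Subtype.val hy
  have h1 : b * (y : Δ) = algebraMap K Δ x := by
    have : b = x • a := by rw [hab, smul_smul, mul_inv_cancel₀ hx0, one_smul]
    rw [this, smul_mul_assoc, hy', Algebra.algebraMap_eq_smul_one]
  have h2 : algebraMap K Δ x ∈ W := h1 ▸ mul_mem hb (hMW _ y.2)
  have h3 := (isSelfDualOrder_iff_mulTraceForm_mem hW 1).mp (one_mem _) _ h2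
  rw [mulTraceForm_one_algebraMap] at h3
  have h4 := mul_mem h3 hN
  rw [mul_inv_cancel_right₀ hN0] at h4
  exact hx h4

/-- A finite dimensional `k`-subalgebra whose `k`-independent families stay independent over `K`,
and which is large enough, is a `k`-form of the algebra. -/
theorem exists_divisionRing_of_subalgebra {k K Δ : Type} [Field k] [Field K] [Algebra k K]
    [DivisionRing Δ] [Algebra K Δ] [Algebra k Δ] [IsScalarTower k K Δ] [FiniteDimensional K Δ]
    (hΔ : Subalgebra.center K Δ = ⊥) (M : Subalgebra k Δ) [Module.Finite k M]
    (hM : ∀ (r : ℕ) (s : Fin r → Δ), (∀ i, s i ∈ M) → LinearIndependent k s →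
      LinearIndependent K s) (hrank : Module.finrank K Δ ≤ Module.finrank k M) :
    ∃ (D' : Type) (_ : DivisionRing D') (_ : Algebra k D'),
      Subalgebra.center k D' = ⊥ ∧ Module.finrank k D' = Module.finrank K Δ ∧
      Nonempty (Δ ≃ₐ[K] K ⊗[k] D') := by
  have hdom : IsDomain M := inferInstance
  let b := Module.finBasis k M
  have hbk : LinearIndependent k fun i => (b i : Δ) :=
    b.linearIndependent.map' M.val.toLinearMap
      (LinearMap.ker_eq_bot.mpr Subtype.val_injective)
  have hbK := hM _ _ (fun i => (b i).2) hbk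
  have hle := hbK.fintype_card_le_finrank
  rw [Fintype.card_fin] at hle
  have hrank' := le_antisymm hle hrank
  have hspan : Submodule.span K (Set.range fun i => (b i : Δ)) = ⊤ :=
    hbK.span_eq_top_of_card_eq_finrank' (by rw [Fintype.card_fin, hrank'])
  obtain ⟨φ, hφ⟩ : ∃ φ : K ⊗[k] M →ₐ[K] Δ, ∀ m : M, φ (1 ⊗ₜ m) = m := by
    refine ⟨Algebra.TensorProduct.lift (Algebra.ofId K Δ) M.val
      fun x y => Algebra.commutes x (y : Δ), fun m => ?_⟩
    refine (Algebra.TensorProduct.lift_tmul _ _ _ _ _).trans ?_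
    rw [map_one, one_mul]; rfl
  have hsurj : Function.Surjective φ := by
    rw [← AlgHom.coe_toLinearMap, ← LinearMap.range_eq_top, ← top_le_iff, ← hspan,
      Submodule.span_le]
    rintro _ ⟨i, rfl⟩
    exact ⟨1 ⊗ₜ b i, hφ (b i)⟩
  have hinj : Function.Injective φ := by
    have : Module.finrank K (K ⊗[k] M) = Module.finrank K Δ := by
      rw [Module.finrank_baseChange, hrank']
    exact (LinearMap.injective_iff_surjective_of_finrank_eq_finrank this
      (f := φ.toLinearMap)).mpr hsurj
  refine ⟨M, divisionRingOfFiniteDimensional k M, M.algebra, ?_, hrank',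
    ⟨(AlgEquiv.ofBijective φ ⟨hinj, hsurj⟩).symm⟩⟩
  rw [eq_bot_iff]
  intro z hz
  have hz' : ∀ m : M, m * z = z * m := fun m => (Subalgebra.mem_center_iff.mp hz m)
  have hzc : (z : Δ) ∈ Subalgebra.center K Δ := by
    rw [Subalgebra.mem_center_iff]
    intro a
    have ha : a ∈ Submodule.span K (Set.range fun i => (b i : Δ)) := hspan ▸ Submodule.mem_top
    induction ha using Submodule.span_induction with
    | mem _ h => obtain ⟨i, rfl⟩ := h; exact congrArg Subtype.val (hz' (b i))
    | zero => simp
    | add u v _ _ hu hv => rw [add_mul, mul_add, hu, hv]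
    | smul c u _ hu => rw [smul_mul_assoc, hu, mul_smul_comm]
  rw [hΔ, Algebra.mem_bot] at hzc
  obtain ⟨c, hc⟩ := hzc
  by_contra hcon
  have hli : LinearIndependent k ![(1 : Δ), (z : Δ)] := by
    rw [LinearIndependent.pair_iff' one_ne_zero]
    intro r hr
    refine hcon (Algebra.mem_bot.mpr ⟨r, Subtype.ext ?_⟩)
    rw [← hr, ← Algebra.algebraMap_eq_smul_one]
    rfl
  have hli' := hM 2 _ (fun i => by fin_cases i <;> simp) hli
  rw [LinearIndependent.pair_iff' one_ne_zero] at hli'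
  exact hli' c (by rw [← hc, Algebra.algebraMap_eq_smul_one])
end

section
open Polynomial
theorem exists_form_of_haveSameMaximalSubfields {k K D Δ : Type} [Field k] [Infinite k]
    [Field K] [Algebra k[X] K] [IsFractionRing k[X] K] [Algebra k K] [IsScalarTower k k[X] K]
    [DivisionRing D] [Algebra k D] (hD : Subalgebra.center k D = ⊥) {n : ℕ} (hn : 0 < n)
    (hn' : Module.finrank k D = n ^ 2) (hnk : (n : k) ≠ 0) [IsDomain (K ⊗[k] D)]
    [DivisionRing Δ] [Algebra K Δ] (hΔ : Subalgebra.center K Δ = ⊥)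
    (hnΔ : Module.finrank K Δ = n ^ 2) (h : HaveSameMaximalSubfields K n Δ (K ⊗[k] D)) :
    ∃ (D' : Type) (_ : DivisionRing D') (_ : Algebra k D'),
      Subalgebra.center k D' = ⊥ ∧ Module.finrank k D' = n ^ 2 ∧
      Nonempty (Δ ≃ₐ[K] K ⊗[k] D') := by
  let : Algebra k Δ := Algebra.compHom Δ (algebraMap k K)
  have : IsScalarTower k K Δ := IsScalarTower.of_algebraMap_eq fun _ => rfl
  have hfin : FiniteDimensional K Δ := Module.finite_of_finrank_pos (hnΔ ▸ pow_pos hn 2)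
  have hN0 : (Module.finrank K Δ : k) ≠ 0 := by
    rw [hnΔ, Nat.cast_pow]; exact pow_ne_zero 2 hnk
  have hNK : (Module.finrank K Δ : K) = algebraMap k K (Module.finrank K Δ : k) := by simp
  have hN : (Module.finrank K Δ : K) ≠ 0 := by
    rw [hNK]; exact (_root_.map_ne_zero _).mpr hN0
  obtain ⟨L, hL1, hL2⟩ := exists_globally_selfDual (K := K) (Δ := Δ) hN (A := k[X]) fun v =>
    exists_isSelfDualOrder_of_haveSameMaximalSubfields hD hn hn' hnk hΔ hnΔ h _ fun c => by
      rw [IsScalarTower.algebraMap_apply k k[X] K]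
      exact (v.valuation_le_one (K := K) _ : v.valuation K (algebraMap k[X] K _) ≤ 1)
  obtain ⟨O, hO, hkO, hpoly, hres⟩ := exists_valuationSubring_infty (k := k) (K := K)
  obtain ⟨W, hW⟩ := exists_isSelfDualOrder_of_haveSameMaximalSubfields hD hn hn' hnk hΔ hnΔ h O hkO
  obtain ⟨e, heL, d, hd, hde⟩ := exists_basis_of_selfDual hN (A := k[X]) (L : Set Δ) hL1 hL2
  have hrange : ∀ c : K, c ∈ (algebraMap O K).range ↔ c ∈ O := fun c =>
    ⟨fun ⟨y, hy⟩ => hy ▸ y.2, fun hc => ⟨⟨c, hc⟩, rfl⟩⟩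
  obtain ⟨w, hwW, d', hd', hdw⟩ := exists_basis_of_selfDual hN (A := O) (W : Set Δ)
    (fun a => by
      obtain ⟨c, hc0, hc⟩ := hW.exists_smul_mem a
      rcases O.mem_or_inv_mem c with h1 | h1
      · exact ⟨⟨c, h1⟩, fun h0 => hc0 (congrArg Subtype.val h0), hc⟩
      · refine ⟨1, one_ne_zero, ?_⟩
        have := hW.smul_mem _ h1 _ hc
        rw [smul_smul, inv_mul_cancel₀ hc0] at this
        rwa [map_one])
    (fun a => by
      simp only [hrange]
      exact isSelfDualOrder_iff_mulTraceForm_mem hW a)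
  obtain ⟨u, hu, hdet⟩ := exists_isUnit_det_eq hkO e w hd hde hd' hdw
  have hkL : ∀ c : k, algebraMap k Δ c ∈ L := by
    intro c
    have := (heL (algebraMap k Δ c)).mpr fun i => by
      have h1 := (heL 1).mp (one_mem L) i
      rw [IsScalarTower.algebraMap_apply k K Δ, Algebra.algebraMap_eq_smul_one, map_smul,
        Finsupp.smul_apply, smul_eq_mul, IsScalarTower.algebraMap_apply k k[X] K]
      exact mul_mem ⟨_, rfl⟩ h1
    exact this
  have hkW : ∀ c : k, algebraMap k Δ c ∈ W := by
    intro c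
    rw [IsScalarTower.algebraMap_apply k K Δ, Algebra.algebraMap_eq_smul_one]
    exact hW.smul_mem _ (hkO c) _ (one_mem W)
  let M : Subalgebra k Δ := { (L ⊓ W : Subring Δ) with
    algebraMap_mem' := fun c => ⟨hkL c, hkW c⟩ }
  have hM : ∀ a, a ∈ M ↔ a ∈ L ∧ a ∈ W := fun a => Iff.rfl
  obtain ⟨hMfin, hMrank⟩ := le_finrank_of_infty hkO hpoly hres e w hu hdet
    (Subalgebra.toSubmodule M) fun a => by
      rw [Subalgebra.mem_toSubmodule, hM]
      refine and_congr (heL a) ?_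
      simpa only [hrange, SetLike.mem_coe] using hwW a
  have hMfin' : Module.Finite k M := hMfin
  have hX0 : algebraMap k[X] K X ≠ 0 := by
    rw [Ne, FaithfulSMul.algebraMap_eq_zero_iff]; exact X_ne_zero
  have hX : algebraMap k[X] K X ∉ O := by
    intro hc
    have := (hpoly X 0).mp (by simpa using hc)
    simp at this
  have hzero := eq_zero_of_mem_inv_smul (k := k) hX0 hX
    (by rw [hNK, ← map_inv₀]; exact hkO _) hN hW (M := M) fun a ha => ha.2
  obtain ⟨D', i1, i2, hc, hr, he⟩ := exists_divisionRing_of_subalgebra hΔ M (fun r s hs hli =>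
    linearIndependent_of_residue hX0 hX hres (M := Subalgebra.toSubmodule M) (W := W)
      hW.smul_mem (fun a ha => ha.2) hzero hs hli) hMrank
  exact ⟨D', i1, i2, hc, hr.trans hnΔ, he⟩
end

section
open Polynomial

section
variable {k K : Type*} [Field k] [Field K] [Algebra k[X] K] [IsFractionRing k[X] K] [Algebra k K]
  [IsScalarTower k k[X] K]

variable (k K) in
theorem map_polynomial_tensorProduct_injective (D : Type*) [Ring D] [Algebra k D] :
    Function.Injective
      (Algebra.TensorProduct.map (IsScalarTower.toAlgHom k k[X] K) (AlgHom.id k D)) := by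
  have h := Module.Flat.rTensor_preserves_injective_linearMap (M := D)
    (IsScalarTower.toAlgHom k k[X] K).toLinearMap (IsFractionRing.injective k[X] K)
  exact h

omit [IsFractionRing k[X] K] in
theorem map_polynomial_tensorProduct_smul {D : Type*} [Ring D] [Algebra k D] (r : k[X])
    (x : k[X] ⊗[k] D) :
    Algebra.TensorProduct.map (IsScalarTower.toAlgHom k k[X] K) (AlgHom.id k D) (r • x) =
      algebraMap k[X] K r •
        Algebra.TensorProduct.map (IsScalarTower.toAlgHom k k[X] K) (AlgHom.id k D) x := by
  induction x using TensorProduct.induction_on with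
  | zero => simp
  | tmul p d =>
    simp only [TensorProduct.smul_tmul', Algebra.TensorProduct.map_tmul, smul_eq_mul, map_mul]
    rfl
  | add x y hx hy => rw [smul_add, map_add, map_add, smul_add, hx, hy]

variable (k K) in
theorem isDomain_tensorProduct_of_isFractionRing_polynomial (D : Type*) [DivisionRing D]
    [Algebra k D] : IsDomain (K ⊗[k] D) := by
  set f := Algebra.TensorProduct.map (IsScalarTower.toAlgHom k k[X] K) (AlgHom.id k D) with hf
  have hinj : Function.Injective f := map_polynomial_tensorProduct_injective k K D
  have hdom : NoZeroDivisors (k[X] ⊗[k] D) :=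
    ((Algebra.TensorProduct.comm k k[X] D).trans
      ((polyEquivTensor k D).symm.restrictScalars k)).injective.noZeroDivisors _
      (map_zero _) (map_mul _)
  have hnz : NoZeroDivisors (K ⊗[k] D) := by
    refine ⟨fun {a b} hab => ?_⟩
    obtain ⟨r, hr, x, hx⟩ := exists_smul_eq_map_tensorProduct k[X] K a
    obtain ⟨s, hs, y, hy⟩ := exists_smul_eq_map_tensorProduct k[X] K b
    have hxy : f (x * y) = 0 := by
      rw [map_mul, hf, ← hx, ← hy, smul_mul_smul_comm, hab, smul_zero]
    have h0 : ∀ r : k[X], r ≠ 0 → algebraMap k[X] K r ≠ 0 := fun r hr => by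
      rwa [Ne, FaithfulSMul.algebraMap_eq_zero_iff]
    rcases mul_eq_zero.mp ((map_eq_zero_iff f hinj).mp hxy) with h | h
    · rw [h, map_zero] at hx
      exact .inl ((smul_eq_zero_iff_right (h0 r hr)).mp hx)
    · rw [h, map_zero] at hy
      exact .inr ((smul_eq_zero_iff_right (h0 s hs)).mp hy)
  have : Nontrivial (K ⊗[k] D) := inferInstance
  exact NoZeroDivisors.to_isDomain _

/-- An embedding over a rational function field specializes to one over the constants. -/
theorem nonempty_algHom_of_algHom_tensorProduct [Infinite k] {P D : Type*} [Ring P] [Algebra k P]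
    [FiniteDimensional k P] [Ring D] [Algebra k D] (φ : P →ₐ[k] K ⊗[k] D) :
    Nonempty (P →ₐ[k] D) := by
  set f := Algebra.TensorProduct.map (IsScalarTower.toAlgHom k k[X] K) (AlgHom.id k D) with hf
  have hinj : Function.Injective f := map_polynomial_tensorProduct_injective k K D
  have hfs : ∀ (r : k[X]) x, f (r • x) = algebraMap k[X] K r • f x :=
    map_polynomial_tensorProduct_smul
  let b := Module.finBasis k P
  choose r hr x hx using fun i => exists_smul_eq_map_tensorProduct k[X] K (φ (b i))
  have hg0 : ∏ i, r i ≠ 0 := Finset.prod_ne_zero_iff.mpr fun i _ => hr i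
  have hg : ∀ p : P, ∃ y, f y = algebraMap k[X] K (∏ i, r i) • φ p := by
    intro p
    refine ⟨∑ i, b.repr p i • (∏ j ∈ Finset.univ.erase i, r j) • x i, ?_⟩
    conv_rhs => rw [← b.sum_repr p]
    rw [map_sum, map_sum, Finset.smul_sum]
    refine Finset.sum_congr rfl fun i _ => ?_
    rw [map_smul f, hfs, map_smul φ, hf, ← hx, smul_smul, ← map_mul,
      Finset.prod_erase_mul _ _ (Finset.mem_univ i), smul_comm]
  set g := ∏ i, r i
  choose y hy using hg
  obtain ⟨c, hc⟩ : ∃ c : k, g.eval c ≠ 0 := by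
    by_contra! h
    exact hg0 (Polynomial.funext fun c => by rw [h c, eval_zero])
  obtain ⟨ev, hev⟩ : ∃ ev : k[X] ⊗[k] D →ₐ[k] D, ∀ p d, ev (p ⊗ₜ d) = p.eval c • d := by
    refine ⟨(Algebra.TensorProduct.lid k D).toAlgHom.comp
      (Algebra.TensorProduct.map (aeval c) (AlgHom.id k D)), fun p d => ?_⟩
    simp [Polynomial.aeval_def, Polynomial.eval₂_eq_eval_map]
  have hevs : ∀ (p : k[X]) z, ev (p • z) = p.eval c • ev z := by
    intro p z
    induction z using TensorProduct.induction_on with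
    | zero => simp
    | tmul q d => rw [TensorProduct.smul_tmul', hev, hev, smul_eq_mul, eval_mul, smul_smul]
    | add u v hu hv => rw [smul_add, map_add, map_add, smul_add, hu, hv]
  have hyadd : ∀ p q, y (p + q) = y p + y q := fun p q => hinj (by
    rw [map_add, hy, hy, hy, map_add, smul_add])
  have hysmul : ∀ (a : k) p, y (a • p) = a • y p := fun a p => hinj (by
    rw [map_smul, hy, hy, map_smul, smul_comm])
  have hymul : ∀ p q, y p * y q = g • y (p * q) := fun p q => hinj (by
    rw [map_mul, hfs, hy, hy, hy, map_mul, smul_mul_smul_comm, smul_smul])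
  have hyone : y 1 = g • 1 := hinj (by rw [hfs, hy, map_one, map_one])
  let L : P →ₗ[k] D :=
    { toFun := fun p => (g.eval c)⁻¹ • ev (y p)
      map_add' := fun p q => by rw [hyadd, map_add, smul_add]
      map_smul' := fun a p => by rw [hysmul, map_smul, smul_comm, RingHom.id_apply] }
  refine ⟨AlgHom.ofLinearMap L ?_ fun p q => ?_⟩
  · change (g.eval c)⁻¹ • ev (y 1) = 1
    rw [hyone, hevs, map_one, smul_smul, inv_mul_cancel₀ hc, one_smul]
  · change (g.eval c)⁻¹ • ev (y (p * q)) = ((g.eval c)⁻¹ • ev (y p)) * ((g.eval c)⁻¹ • ev (y q))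
    rw [smul_mul_smul_comm, ← map_mul, hymul, hevs, smul_smul, mul_assoc,
      inv_mul_cancel₀ hc, mul_one]
end

section
variable {k K : Type} [Field k] [Field K] [Algebra k[X] K] [IsFractionRing k[X] K] [Algebra k K]
  [IsScalarTower k k[X] K]

theorem nonempty_algHom_of_haveSameMaximalSubfields [Infinite k] {n : ℕ} (hn : 0 < n)
    {D D' : Type} [Ring D] [Algebra k D] [Ring D'] [Algebra k D']
    (h : HaveSameMaximalSubfields K n (K ⊗[k] D) (K ⊗[k] D')) (P : Type) [Field P] [Algebra k P]
    (hP : Module.finrank k P = n) (j : P →ₐ[k] D) : Nonempty (P →ₐ[k] D') := by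
  have : FiniteDimensional k P := Module.finite_of_finrank_pos (hP ▸ hn)
  have : IsDomain (K ⊗[k] P) := isDomain_tensorProduct_of_isFractionRing_polynomial k K P
  let _ : Field (K ⊗[k] P) := fieldOfFiniteDimensional K (K ⊗[k] P)
  obtain ⟨i⟩ := (h (K ⊗[k] P) (by rw [Module.finrank_baseChange, hP])).mp
    ⟨Algebra.TensorProduct.map (AlgHom.id K K) j⟩
  exact nonempty_algHom_of_algHom_tensorProduct (K := K)
    ((i.restrictScalars k).comp Algebra.TensorProduct.includeRight)

theorem HaveSameMaximalSubfields.of_tensorProduct [Infinite k] {n : ℕ} (hn : 0 < n)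
    {D D' : Type} [Ring D] [Algebra k D] [Ring D'] [Algebra k D']
    (h : HaveSameMaximalSubfields K n (K ⊗[k] D) (K ⊗[k] D')) :
    HaveSameMaximalSubfields k n D D' := fun P _ _ hP =>
  ⟨fun ⟨j⟩ => nonempty_algHom_of_haveSameMaximalSubfields hn h P hP j,
    fun ⟨j⟩ => nonempty_algHom_of_haveSameMaximalSubfields hn h.symm P hP j⟩

theorem HaveSameMaximalSubfields.congr_left {n : ℕ} {A B C : Type} [Ring A] [Algebra k A] [Ring B]
    [Algebra k B] [Ring C] [Algebra k C] (h : HaveSameMaximalSubfields k n A B) (e : A ≃ₐ[k] C) :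
    HaveSameMaximalSubfields k n C B := fun P _ _ hP =>
  ⟨fun ⟨j⟩ => (h P hP).mp ⟨e.symm.toAlgHom.comp j⟩,
    fun hj => ((h P hP).mpr hj).map fun j => e.toAlgHom.comp j⟩
end

end

section
/-- Every central division algebra of degree `n` over `K` in the genus of a constant one comes
from a central division algebra over `k` in the genus over `k`. -/
def GenusDescends (k K : Type) [Field k] [Field K] [Algebra k K] (n : ℕ) : Prop :=
  ∀ (D : Type) [DivisionRing D] [Algebra k D], IsCentralDivisionAlgebraOfDegree k n D →
    IsDomain (K ⊗[k] D) ∧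
    ∀ (Δ : Type) [DivisionRing Δ] [Algebra K Δ], IsCentralDivisionAlgebraOfDegree K n Δ →
      HaveSameMaximalSubfields K n Δ (K ⊗[k] D) →
      ∃ (D' : Type) (_ : DivisionRing D') (_ : Algebra k D'),
        IsCentralDivisionAlgebraOfDegree k n D' ∧ HaveSameMaximalSubfields k n D D' ∧
        Nonempty (Δ ≃ₐ[K] K ⊗[k] D')

open Polynomial in
theorem genusDescends_of_isFractionRing_polynomial {k K : Type} [Field k] [Infinite k] [Field K]
    [Algebra k[X] K] [IsFractionRing k[X] K] [Algebra k K] [IsScalarTower k k[X] K] {n : ℕ}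
    (hn : 0 < n) (hnk : (n : k) ≠ 0) : GenusDescends k K n := by
  intro D _ _ hD
  have hdom := isDomain_tensorProduct_of_isFractionRing_polynomial k K D
  refine ⟨hdom, fun Δ _ _ hΔ h => ?_⟩
  obtain ⟨D', i1, i2, hc, hr, ⟨e⟩⟩ :=
    exists_form_of_haveSameMaximalSubfields hD.1 hn hD.2 hnk hΔ.1 hΔ.2 h
  exact ⟨D', i1, i2, ⟨hc, hr⟩, (HaveSameMaximalSubfields.of_tensorProduct hn (h.congr_left e)).symm,
    ⟨e⟩⟩

theorem nonempty_tensorProduct_cancelBaseChange (k K L D : Type) [Field k] [Field K] [Field L]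
    [Algebra k K] [Algebra K L] [Algebra k L] [IsScalarTower k K L] [Ring D] [Algebra k D] :
    Nonempty (L ⊗[K] (K ⊗[k] D) ≃ₐ[L] L ⊗[k] D) :=
  ⟨AlgEquiv.symm <| AlgEquiv.ofLinearEquiv
    (TensorProduct.AlgebraTensorModule.cancelBaseChange k K L L D).symm
    (by simp [Algebra.TensorProduct.one_def]) <|
      LinearMap.map_mul_of_map_mul_tmul fun _ _ _ _ => by simp⟩

theorem GenusDescends.trans {k K L : Type} [Field k] [Field K] [Field L] [Algebra k K]
    [Algebra K L] [Algebra k L] [IsScalarTower k K L] {n : ℕ} (hn : 0 < n)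
    (h₁ : GenusDescends k K n) (h₂ : GenusDescends K L n) : GenusDescends k L n := by
  intro D _ _ hD
  have hfin : FiniteDimensional k D := Module.finite_of_finrank_pos (hD.2 ▸ pow_pos hn 2)
  obtain ⟨hdom, hK⟩ := h₁ D hD
  let _ : DivisionRing (K ⊗[k] D) := divisionRingOfFiniteDimensional K (K ⊗[k] D)
  have hE : IsCentralDivisionAlgebraOfDegree K n (K ⊗[k] D) :=
    ⟨center_tensorProduct_eq_bot hD.1, by rw [← hD.2]; exact Module.finrank_baseChange⟩
  obtain ⟨hdom', hL⟩ := h₂ (K ⊗[k] D) hE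
  obtain ⟨e⟩ := nonempty_tensorProduct_cancelBaseChange k K L D
  refine ⟨e.symm.toMulEquiv.isDomain _, fun Δ _ _ hΔ h => ?_⟩
  obtain ⟨E', i1, i2, hE', hsame, ⟨f⟩⟩ := hL Δ hΔ (h.symm.congr_left e.symm).symm
  obtain ⟨D', j1, j2, hD', hsame', ⟨g⟩⟩ := hK E' hE' hsame.symm
  obtain ⟨e'⟩ := nonempty_tensorProduct_cancelBaseChange k K L D'
  exact ⟨D', j1, j2, hD', hsame',
    ⟨f.trans ((Algebra.TensorProduct.congr AlgEquiv.refl g).trans e')⟩⟩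
end

section
open Polynomial

theorem genusDescends_of_isFractionRing_polynomial_of_algebra {k F L : Type} (R : Type) [Field k]
    [CommRing R] [IsDomain R] [Algebra k R] [Field F] [Algebra R F] [IsFractionRing R F]
    [Algebra k F] [IsScalarTower k R F] [Field L] [Algebra R[X] L] [IsFractionRing R[X] L]
    [Algebra k L] [IsScalarTower k R[X] L] [Infinite k] {n : ℕ} (hn : 0 < n) (hnk : (n : k) ≠ 0)
    (h : GenusDescends k F n) : GenusDescends k L n := by
  let _ : Algebra R[X] F[X] := Polynomial.algebra R F
  have hloc : IsLocalization ((nonZeroDivisors R).map (C : R →+* R[X])) F[X] :=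
    Polynomial.isLocalization (nonZeroDivisors R) F
  have hinj : Function.Injective (algebraMap R[X] L) := IsFractionRing.injective R[X] L
  have hunit : ∀ y : (nonZeroDivisors R).map (C : R →+* R[X]), IsUnit (algebraMap R[X] L y) := by
    rintro ⟨_, r, hr, rfl⟩
    rw [isUnit_iff_ne_zero, Ne, map_eq_zero_iff _ hinj]
    exact C_ne_zero.mpr (nonZeroDivisors.ne_zero hr)
  let _ : Algebra F[X] L := (IsLocalization.lift hunit).toAlgebra
  have htow : IsScalarTower R[X] F[X] L :=
    IsScalarTower.of_algebraMap_eq fun x => (IsLocalization.lift_eq hunit x).symm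
  have hfrac : IsFractionRing F[X] L := IsFractionRing.isFractionRing_of_isDomain_of_isLocalization
    ((nonZeroDivisors R).map (C : R →+* R[X])) F[X] L
  let _ : Algebra F L := Algebra.compHom L (algebraMap F F[X])
  have htow' : IsScalarTower F F[X] L := IsScalarTower.of_algebraMap_eq fun _ => rfl
  have htow'' : IsScalarTower k F L := by
    refine IsScalarTower.of_algebraMap_eq fun c => ?_
    rw [IsScalarTower.algebraMap_apply F F[X] L, IsScalarTower.algebraMap_apply k R[X] L,
      IsScalarTower.algebraMap_apply R[X] F[X] L, IsScalarTower.algebraMap_apply k R F]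
    congr 1
    simp [Polynomial.algebraMap_apply, RingHom.algebraMap_toAlgebra]
  have hkF := FaithfulSMul.algebraMap_injective k F
  have : Infinite F := Infinite.of_injective _ hkF
  have hnF : (n : F) ≠ 0 := by
    rw [← map_natCast (algebraMap k F)]
    exact (_root_.map_ne_zero _).mpr hnk
  exact h.trans hn (genusDescends_of_isFractionRing_polynomial hn hnF)

theorem genusDescends_of_isFractionRing_mvPolynomial {k : Type} [Field k] [Infinite k] {n : ℕ}
    (hn : 0 < n) (hnk : (n : k) ≠ 0) (m : ℕ) (K : Type) [Field K]
    [Algebra (MvPolynomial (Fin (m + 1)) k) K] [IsFractionRing (MvPolynomial (Fin (m + 1)) k) K]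
    [Algebra k K] [IsScalarTower k (MvPolynomial (Fin (m + 1)) k) K] : GenusDescends k K n := by
  induction m generalizing K with
  | zero =>
    let e : MvPolynomial (Fin 1) k ≃ₐ[k] k[X] := MvPolynomial.uniqueAlgEquiv k (Fin 1)
    let _ : Algebra k[X] K := Algebra.compHom K (e.symm : k[X] →+* MvPolynomial (Fin 1) k)
    have htow : IsScalarTower k k[X] K := by
      refine IsScalarTower.of_algebraMap_eq fun c => ?_
      rw [IsScalarTower.algebraMap_apply k (MvPolynomial (Fin (0 + 1)) k) K]
      exact congrArg _ (e.symm.commutes c).symm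
    have hfrac : IsFractionRing k[X] K :=
      IsFractionRing.of_ringEquiv_left (S := MvPolynomial (Fin (0 + 1)) k) e.symm.toRingEquiv
        fun _ => rfl
    exact genusDescends_of_isFractionRing_polynomial hn hnk
  | succ m ih =>
    let R := MvPolynomial (Fin (m + 1)) k
    let e := MvPolynomial.finSuccEquiv k (m + 1)
    let _ : Algebra R[X] K :=
      Algebra.compHom K (e.symm : R[X] →+* MvPolynomial (Fin (m + 1 + 1)) k)
    have htow : IsScalarTower k R[X] K := by
      refine IsScalarTower.of_algebraMap_eq fun c => ?_
      rw [IsScalarTower.algebraMap_apply k (MvPolynomial (Fin (m + 1 + 1)) k) K]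
      exact congrArg _ (e.symm.commutes c).symm
    have hfrac : IsFractionRing R[X] K :=
      IsFractionRing.of_ringEquiv_left (S := MvPolynomial (Fin (m + 1 + 1)) k)
        e.symm.toRingEquiv fun _ => rfl
    exact genusDescends_of_isFractionRing_polynomial_of_algebra R hn hnk (ih (FractionRing R))
end

section
theorem infinite_of_isCentralDivisionAlgebraOfDegree {k : Type} [Field k] {n : ℕ} (hn : 2 ≤ n)
    {D : Type} [DivisionRing D] [Algebra k D] (hD : IsCentralDivisionAlgebraOfDegree k n D) :
    Infinite k := by
  by_contra hk
  rw [not_infinite_iff_finite] at hk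
  have : FiniteDimensional k D := Module.finite_of_finrank_pos (hD.2 ▸ by positivity)
  have : Finite D := Module.finite_of_finite k
  have hc : Subalgebra.center k D = ⊤ := by
    rw [eq_top_iff]
    intro x _
    rw [Subalgebra.mem_center_iff]
    exact fun y => (littleWedderburn D).mul_comm y x
  have h1 : Module.finrank k D = 1 := by
    rw [← Subalgebra.bot_eq_top_iff_finrank_eq_one, ← hD.1, hc]
  rw [hD.2] at h1
  nlinarith

theorem HaveSameMaximalSubfields.of_degree_one (k : Type) [Field k] (A B : Type) [Ring A]
    [Algebra k A] [Ring B] [Algebra k B] : HaveSameMaximalSubfields k 1 A B := by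
  intro P _ _ hP
  let e := AlgEquiv.ofBijective (Algebra.ofId k P)
    (Algebra.finrank_eq_one_iff_bijective_algebraMap.mp hP)
  exact ⟨fun _ => ⟨(Algebra.ofId k B).comp e.symm.toAlgHom⟩,
    fun _ => ⟨(Algebra.ofId k A).comp e.symm.toAlgHom⟩⟩
end

/-- If `D` is a central division algebra of degree `n` (prime to `char k`) over `k`, and `Δ` is a
central division algebra of degree `n` over the rational function field
`K = k(x₁, …, x_m)` (`m ≥ 1`) with the same maximal subfields as `D ⊗_k K`, then
`Δ ≃ D' ⊗_k K` for some central division algebra `D'` of degree `n` over `k` having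
the same maximal subfields as `D`. -/
theorem genus_descends_along_purely_transcendental_extension
    (k : Type) [Field k] (n : ℕ) (hn : 0 < n) (hchar : ¬ (ringChar k ∣ n))
    (m : ℕ) (hm : 1 ≤ m)
    (D : Type) [DivisionRing D] [Algebra k D]
    (hD : IsCentralDivisionAlgebraOfDegree k n D)
    (Δ : Type) [DivisionRing Δ]
    [Algebra (FractionRing (MvPolynomial (Fin m) k)) Δ]
    (hΔ : IsCentralDivisionAlgebraOfDegree (FractionRing (MvPolynomial (Fin m) k)) n Δ)
    (hsame : HaveSameMaximalSubfields (FractionRing (MvPolynomial (Fin m) k)) n Δ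
      (FractionRing (MvPolynomial (Fin m) k) ⊗[k] D)) :
    ∃ (D' : Type) (_ : DivisionRing D') (_ : Algebra k D'),
      IsCentralDivisionAlgebraOfDegree k n D' ∧
      HaveSameMaximalSubfields k n D D' ∧
      Nonempty (Δ ≃ₐ[FractionRing (MvPolynomial (Fin m) k)]
        (FractionRing (MvPolynomial (Fin m) k) ⊗[k] D')) := by
  rcases Nat.lt_or_ge 1 n with hn1 | hn1
  · have := infinite_of_isCentralDivisionAlgebraOfDegree hn1 hD
    have hnk : (n : k) ≠ 0 := fun h => hchar ((ringChar.spec k n).mp h)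
    obtain ⟨m, rfl⟩ := Nat.exists_eq_add_of_le' hm
    exact (genusDescends_of_isFractionRing_mvPolynomial hn hnk m _ D hD).2 Δ hΔ hsame
  · obtain rfl : n = 1 := by omega
    refine ⟨k, inferInstance, inferInstance, ⟨Subsingleton.elim _ _, by simp⟩,
      HaveSameMaximalSubfields.of_degree_one k D k, ⟨?_⟩⟩
    have hbij := Algebra.finrank_eq_one_iff_bijective_algebraMap.mp (hΔ.2.trans (one_pow 2))
    exact (AlgEquiv.ofBijective (Algebra.ofId _ Δ) hbij).symm.trans
      (Algebra.TensorProduct.rid k _ _).symm
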